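/- Let d = 2 and consider on ℓ²(ℤ²) the operator H_ω = Δ + λV with V_n = λ cos(2π n·ω), n ∈ ℤ², ω ∈ 𝕋². Then for every λ, the set of frequencies ω ∈ 𝕋² for which H_ω has some continuous spectrum (i.e., the eigenvectors of H_ω do not span ℓ²(ℤ²)) has positive Lebesgue measure. -/

import Mathlib

open MeasureTheory Filter

noncomputable section

/-- The Hilbert space `ℓ²(ℤ²)`. -/
abbrev l2Z2 := lp (fun _ : Fin 2 → ℤ => ℂ) 2

/-- The eigenvalue equation `(Δψ)(n) + V_n ψ(n) = E ψ(n)` on `ℤ²`, where `Δ` is the lattice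
Laplacian (adjacency operator of the `ℓ¹`-nearest-neighbor graph). -/
def LatticeEigenEq (V : (Fin 2 → ℤ) → ℝ) (ψ : (Fin 2 → ℤ) → ℂ) (E : ℝ) : Prop :=
  ∀ n : Fin 2 → ℤ,
    (∑ i : Fin 2, (ψ (Function.update n i (n i + 1)) + ψ (Function.update n i (n i - 1))))
      + ((V n : ℝ) : ℂ) * ψ n = (E : ℂ) * ψ n

/-- The set of `ℓ²(ℤ²)` eigenvectors of `H_ω = Δ + λ cos(2π n·ω)`. -/
def eigenvectors (lam : ℝ) (ω : Fin 2 → ℝ) : Set l2Z2 :=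
  {ψ : l2Z2 | ∃ E : ℝ,
    LatticeEigenEq (fun n => lam * Real.cos (2 * Real.pi * (∑ j, (n j : ℝ) * ω j))) (⇑ψ) E}

/-- The sum of `F` over the integers `-N, …, N`. -/
def zsum (N : ℕ) (F : ℤ → ℝ) : ℝ := ∑ i ∈ Finset.range (2 * N + 1), F ((i : ℤ) - N)

lemma zsum_add (N : ℕ) (F G : ℤ → ℝ) : zsum N (fun k => F k + G k) = zsum N F + zsum N G := by
  simp [zsum, Finset.sum_add_distrib]

lemma zsum_sub (N : ℕ) (F G : ℤ → ℝ) : zsum N (fun k => F k - G k) = zsum N F - zsum N G := by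
  simp [zsum, Finset.sum_sub_distrib]

lemma zsum_const_mul (N : ℕ) (c : ℝ) (F : ℤ → ℝ) : zsum N (fun k => c * F k) = c * zsum N F := by
  simp [zsum, Finset.mul_sum]

lemma zsum_mono {N : ℕ} {F G : ℤ → ℝ} (h : ∀ k, F k ≤ G k) : zsum N F ≤ zsum N G :=
  Finset.sum_le_sum fun _ _ => h _

lemma zsum_nonneg {N : ℕ} {F : ℤ → ℝ} (h : ∀ k, 0 ≤ F k) : 0 ≤ zsum N F :=
  Finset.sum_nonneg fun _ _ => h _

lemma zsum_telescope (N : ℕ) (T : ℤ → ℝ) :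
    zsum N (fun k => T (k + 1) - T k) = T (N + 1) - T (-N) := by
  have := Finset.sum_range_sub (fun i : ℕ => T ((i : ℤ) - N)) (2 * N + 1)
  simp only [zsum]
  push_cast at this
  rw [show (2 * (N : ℤ) + 1 - N) = N + 1 by ring, zero_sub] at this
  rw [← this]
  exact Finset.sum_congr rfl fun i _ => by ring_nf

lemma zsum_le_of_telescope {N : ℕ} {F G : ℤ → ℝ} (T : ℤ → ℝ) (h1 : T (N + 1) = 0)
    (h2 : T (-N) = 0) (h : ∀ k, F k ≤ G k + (T (k + 1) - T k)) : zsum N F ≤ zsum N G := by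
  have := zsum_mono (N := N) h
  rwa [zsum_add, zsum_telescope, h1, h2, sub_zero, add_zero] at this

lemma zsum_eq_of_telescope {N : ℕ} {F G : ℤ → ℝ} (T : ℤ → ℝ) (h1 : T (N + 1) = 0)
    (h2 : T (-N) = 0) (h : ∀ k, F k = G k + (T (k + 1) - T k)) : zsum N F = zsum N G := by
  rw [show F = fun k => G k + (T (k + 1) - T k) from funext h, zsum_add, zsum_telescope, h1, h2,
    sub_zero, add_zero]

/-- `ψ` vanishes outside of `-N+3, …, N-3`. -/
def SuppIn (N : ℕ) (ψ : ℤ → ℝ) : Prop := ∀ k : ℤ, (N : ℤ) ≤ |k| + 3 → ψ k = 0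

/-- The potential well `2 - 2 cos (θ + h k)`. -/
def well (θ h : ℝ) (k : ℤ) : ℝ := 2 - 2 * Real.cos (θ + h * k)

/-- The discrete Laplacian `2 ψ k - ψ (k+1) - ψ (k-1)`. -/
def lap (ψ : ℤ → ℝ) (k : ℤ) : ℝ := 2 * ψ k - ψ (k + 1) - ψ (k - 1)

/-- The almost Mathieu operator `α² lap + well`. -/
def mathieu (α θ h : ℝ) (ψ : ℤ → ℝ) (k : ℤ) : ℝ := α ^ 2 * lap ψ k + well θ h k * ψ k

lemma SuppIn.eq_zero {N : ℕ} {ψ : ℤ → ℝ} (hψ : SuppIn N ψ) {k : ℤ}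
    (hk : (N : ℤ) ≤ k + 3 ∨ k ≤ 3 - N) : ψ k = 0 := by
  apply hψ
  rcases hk with hk | hk
  · linarith [le_abs_self k]
  · linarith [neg_abs_le k]

lemma well_nonneg (θ h : ℝ) (k : ℤ) : 0 ≤ well θ h k := by
  unfold well; linarith [Real.cos_le_one (θ + h * k)]

lemma well_le (θ h : ℝ) (k : ℤ) : well θ h k ≤ 4 := by
  unfold well; linarith [Real.neg_one_le_cos (θ + h * k)]

/-- Summation by parts for `V ψ · lap ψ`. -/
lemma zsum_mul_lap {N : ℕ} {ψ : ℤ → ℝ} (hψ : SuppIn N ψ) (V : ℤ → ℝ) :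
    zsum N (fun k => V k * ψ k * lap ψ k) =
      zsum N (fun k => (V k + V (k + 1)) / 2 * (ψ (k + 1) - ψ k) ^ 2
        - (V (k + 1) + V (k - 1) - 2 * V k) / 2 * ψ k ^ 2) := by
  refine zsum_eq_of_telescope (fun k => -(V (k - 1) + V k) / 2 * ψ k ^ 2
    + V k * ψ (k - 1) * ψ k) ?_ ?_ ?_
  · simp [hψ.eq_zero (k := N + 1) (by left; omega)]
  · simp [hψ.eq_zero (k := -N) (by right; omega)]
  · intro k
    simp only [lap, add_sub_cancel_right]
    ring

/-- The chord length `2 |sin (t / 2)|`, whose square is `2 - 2 cos t`. -/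
def chord (t : ℝ) : ℝ := 2 * |Real.sin (t / 2)|

lemma chord_nonneg (t : ℝ) : 0 ≤ chord t := by unfold chord; positivity

lemma chord_sq (t : ℝ) : chord t ^ 2 = 2 - 2 * Real.cos t := by
  have h := Real.cos_two_mul (t / 2)
  rw [show 2 * (t / 2) = t by ring] at h
  have h2 := Real.sin_sq_add_cos_sq (t / 2)
  unfold chord
  rw [mul_pow, sq_abs]
  linarith

lemma chord_le_two (t : ℝ) : chord t ≤ 2 := by
  unfold chord; linarith [Real.abs_sin_le_one (t / 2)]

lemma abs_sin_sub_sin_le (a b : ℝ) : |Real.sin a - Real.sin b| ≤ |a - b| := by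
  have := (Real.lipschitzWith_sin.dist_le_mul a b)
  simpa [Real.dist_eq] using this

lemma chord_le_add (t u : ℝ) : chord u ≤ chord t + |u - t| := by
  have h := abs_sin_sub_sin_le (u / 2) (t / 2)
  have h2 := abs_sub_abs_le_abs_sub (Real.sin (u / 2)) (Real.sin (t / 2))
  have h3 : |u / 2 - t / 2| = |u - t| / 2 := by
    rw [← sub_div, abs_div, abs_two]
  unfold chord
  linarith

lemma abs_sin_le_chord (t : ℝ) : |Real.sin t| ≤ chord t := by
  have h := Real.sin_two_mul (t / 2)
  rw [show 2 * (t / 2) = t by ring] at h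
  rw [h, abs_mul, abs_mul, abs_two]
  unfold chord
  nlinarith [Real.abs_cos_le_one (t / 2), abs_nonneg (Real.sin (t / 2))]

/-- Half of the square root of the quartic part of the superpotential. -/
def superRoot (α t : ℝ) : ℝ := √((Real.sin t / 2) ^ 2 + α ^ 2)

lemma superRoot_sq (α t : ℝ) : superRoot α t ^ 2 = (Real.sin t / 2) ^ 2 + α ^ 2 :=
  Real.sq_sqrt (by positivity)

lemma superRoot_pos {α : ℝ} (hα : 0 < α) (t : ℝ) : 0 < superRoot α t :=
  Real.sqrt_pos.2 (by positivity)

lemma superRoot_ge (α t : ℝ) : α ≤ superRoot α t :=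
  Real.le_sqrt_of_sq_le (by nlinarith [sq_nonneg (Real.sin t / 2)])

lemma superRoot_le {α : ℝ} (hα : 0 < α) (t : ℝ) : superRoot α t ≤ |Real.sin t / 2| + α := by
  apply Real.sqrt_le_iff.2 ⟨by positivity, ?_⟩
  nlinarith [sq_abs (Real.sin t / 2), abs_nonneg (Real.sin t / 2)]

/-- The function `sin t · √(sin² t / 4 + α²)`. -/
def superProd (α t : ℝ) : ℝ := Real.sin t * superRoot α t

lemma hasDerivAt_superProd {α : ℝ} (hα : 0 < α) (t : ℝ) :
    HasDerivAt (superProd α)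
      (Real.cos t * (superRoot α t + (Real.sin t / 2) ^ 2 / superRoot α t)) t := by
  have h1 : HasDerivAt (fun t => (Real.sin t / 2) ^ 2 + α ^ 2)
      (2 * (Real.sin t / 2) * (Real.cos t / 2)) t := by
    have := ((Real.hasDerivAt_sin t).div_const 2).pow 2
    simpa using this.add_const (α ^ 2)
  have hp := superRoot_pos hα t
  have h2 := h1.sqrt (by positivity)
  have h3 := (Real.hasDerivAt_sin t).mul h2
  refine h3.congr_deriv ?_
  change Real.cos t * superRoot α t + Real.sin t * (_ / (2 * superRoot α t)) = _
  field_simp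

lemma abs_deriv_superProd_sub_le {α : ℝ} (hα : 0 < α) (t : ℝ) :
    |Real.cos t * (superRoot α t + (Real.sin t / 2) ^ 2 / superRoot α t) - α|
      ≤ (2 + α) * chord t := by
  have hp := superRoot_pos hα t
  have hge := superRoot_ge α t
  have hle := superRoot_le hα t
  have hs : |Real.sin t / 2| ≤ chord t / 2 := by
    rw [abs_div, abs_two]; linarith [abs_sin_le_chord t]
  have hc := chord_nonneg t
  have hc2 := chord_le_two t
  have hcs := chord_sq t
  have h1 : (Real.sin t / 2) ^ 2 / superRoot α t ≤ chord t / 2 := by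
    rw [div_le_iff₀ hp]
    have : |Real.sin t / 2| ≤ superRoot α t := by
      apply Real.abs_le_sqrt; nlinarith
    rw [← sq_abs]
    nlinarith [abs_nonneg (Real.sin t / 2)]
  have h0 : 0 ≤ (Real.sin t / 2) ^ 2 / superRoot α t := by positivity
  set X := superRoot α t + (Real.sin t / 2) ^ 2 / superRoot α t
  have hX1 : α ≤ X := by linarith
  have hX2 : X ≤ α + chord t := by linarith
  have hcos := Real.cos_le_one t
  rw [show Real.cos t * X - α = (X - α) - (1 - Real.cos t) * X by ring]
  have h5 : (1 - Real.cos t) * X ≤ chord t * (α + 2) := by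
    have : 1 - Real.cos t ≤ chord t := by nlinarith
    have := mul_le_mul this hX2 (by linarith) hc
    nlinarith
  have h6 : 0 ≤ (1 - Real.cos t) * X := mul_nonneg (by linarith) (by linarith)
  rw [abs_le]
  constructor <;> nlinarith

lemma abs_superProd_sub_le {α : ℝ} (hα : 0 < α) (t u v : ℝ) {h : ℝ} (hu : |u - t| ≤ h)
    (hv : |v - t| ≤ h) :
    |superProd α u - superProd α v - α * (u - v)| ≤ (2 + α) * (chord t + h) * |u - v| := by
  have key := (convex_Icc (t - h) (t + h)).norm_image_sub_le_of_norm_hasDerivWithin_le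
    (f := fun x => superProd α x - α * x)
    (f' := fun t => Real.cos t * (superRoot α t + (Real.sin t / 2) ^ 2 / superRoot α t) - α)
    (C := (2 + α) * (chord t + h)) (x := v) (y := u) ?_ ?_ ?_ ?_
  · rw [Real.norm_eq_abs, Real.norm_eq_abs] at key
    convert key using 2
    ring
  · intro x _
    have := (hasDerivAt_superProd hα x).sub ((hasDerivAt_id x).const_mul α)
    rw [mul_one] at this
    exact this.hasDerivWithinAt
  · intro x hx
    rw [Real.norm_eq_abs]
    refine (abs_deriv_superProd_sub_le hα x).trans ?_
    have h1 : |x - t| ≤ h := by rw [abs_le]; constructor <;> linarith [hx.1, hx.2]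
    have := chord_le_add t x
    gcongr
    linarith
  · rw [abs_le] at hv; constructor <;> linarith
  · rw [abs_le] at hu; constructor <;> linarith

lemma well_add_one (θ h : ℝ) (k : ℤ) : well θ h (k + 1) = 2 - 2 * Real.cos (θ + h * k + h) := by
  unfold well; push_cast; ring_nf

lemma well_sub_one (θ h : ℝ) (k : ℤ) : well θ h (k - 1) = 2 - 2 * Real.cos (θ + h * k - h) := by
  unfold well; push_cast; ring_nf

lemma one_sub_cos_nonneg (h : ℝ) : 0 ≤ 1 - Real.cos h := by linarith [Real.cos_le_one h]

lemma one_sub_cos_le (h : ℝ) : 1 - Real.cos h ≤ h ^ 2 / 2 := by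
  linarith [Real.one_sub_sq_div_two_le_cos (x := h)]

lemma well_second_difference (θ h : ℝ) (k : ℤ) :
    well θ h (k + 1) + well θ h (k - 1) - 2 * well θ h k
      = 4 * (1 - Real.cos h) * Real.cos (θ + h * k) := by
  rw [well_add_one, well_sub_one, Real.cos_add (θ + h * k), Real.cos_sub (θ + h * k)]
  unfold well
  ring

/-- The quadratic form `Σ (M ψ)² + h² Σ ψ²`. -/
def energy (N : ℕ) (α θ h : ℝ) (ψ : ℤ → ℝ) : ℝ :=
  zsum N (fun k => mathieu α θ h ψ k ^ 2) + h ^ 2 * zsum N (fun k => ψ k ^ 2)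

lemma sq_mul_le_energy (N : ℕ) (α θ h : ℝ) (ψ : ℤ → ℝ) :
    h ^ 2 * zsum N (fun k => ψ k ^ 2) ≤ energy N α θ h ψ := by
  have : 0 ≤ zsum N (fun k => mathieu α θ h ψ k ^ 2) := zsum_nonneg fun _ => sq_nonneg _
  unfold energy; linarith

lemma energy_nonneg (N : ℕ) (α θ h : ℝ) (ψ : ℤ → ℝ) : 0 ≤ energy N α θ h ψ :=
  le_trans (mul_nonneg (sq_nonneg h) (zsum_nonneg fun _ => sq_nonneg _)) (sq_mul_le_energy ..)

lemma quartic_le_energy {N : ℕ} {ψ : ℤ → ℝ} (hψ : SuppIn N ψ) (α θ h : ℝ) :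
    zsum N (fun k => (well θ h k * ψ k) ^ 2)
      + α ^ 2 * zsum N (fun k => well θ h k * (ψ (k + 1) - ψ k) ^ 2)
      ≤ (1 + 2 * α ^ 2) * energy N α θ h ψ := by
  have h1 : zsum N (fun k => (well θ h k * ψ k) ^ 2) + α ^ 2 * (2 *
      zsum N (fun k => well θ h k * ψ k * lap ψ k)) ≤
      zsum N (fun k => mathieu α θ h ψ k ^ 2) := by
    rw [← mul_assoc, ← zsum_const_mul, ← zsum_add]
    refine zsum_mono fun k => ?_
    unfold mathieu
    nlinarith [sq_nonneg (α ^ 2 * lap ψ k)]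
  have h2 : zsum N (fun k => well θ h k * (ψ (k + 1) - ψ k) ^ 2)
      - 2 * h ^ 2 * zsum N (fun k => ψ k ^ 2) ≤
      2 * zsum N (fun k => well θ h k * ψ k * lap ψ k) := by
    rw [zsum_mul_lap hψ, ← zsum_const_mul, ← zsum_const_mul, ← zsum_sub]
    refine zsum_mono fun k => ?_
    rw [well_second_difference]
    have := well_nonneg θ h (k + 1)
    have h3 : (1 - Real.cos h) * Real.cos (θ + h * k) ≤ h ^ 2 / 2 := by
      nlinarith [one_sub_cos_nonneg h, one_sub_cos_le h, Real.cos_le_one (θ + h * k)]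
    nlinarith [mul_nonneg this (sq_nonneg (ψ (k + 1) - ψ k)),
      mul_le_mul_of_nonneg_right h3 (sq_nonneg (ψ k))]
  have h3 := sq_mul_le_energy N α θ h ψ
  have h4 : zsum N (fun k => mathieu α θ h ψ k ^ 2) ≤ energy N α θ h ψ := by
    have : 0 ≤ h ^ 2 * zsum N (fun k => ψ k ^ 2) :=
      mul_nonneg (sq_nonneg h) (zsum_nonneg fun _ => sq_nonneg _)
    unfold energy; linarith
  nlinarith [mul_le_mul_of_nonneg_left h2 (sq_nonneg α), mul_le_mul_of_nonneg_left h3 (sq_nonneg α)]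

lemma zsum_mul_mathieu {N : ℕ} {ψ : ℤ → ℝ} (hψ : SuppIn N ψ) (α θ h : ℝ) :
    zsum N (fun k => ψ k * mathieu α θ h ψ k) =
      α ^ 2 * zsum N (fun k => (ψ (k + 1) - ψ k) ^ 2) + zsum N (fun k => well θ h k * ψ k ^ 2) := by
  have := zsum_mul_lap hψ (fun _ => 1)
  norm_num at this
  rw [← this, ← zsum_const_mul, ← zsum_add]
  congr 1; ext k; unfold mathieu; ring

lemma form_le_energy {N : ℕ} {ψ : ℤ → ℝ} (hψ : SuppIn N ψ) (α θ h : ℝ) :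
    2 * h * (α ^ 2 * zsum N (fun k => (ψ (k + 1) - ψ k) ^ 2)
      + zsum N (fun k => well θ h k * ψ k ^ 2)) ≤ energy N α θ h ψ := by
  unfold energy
  rw [← zsum_mul_mathieu hψ, ← zsum_const_mul, ← zsum_const_mul, ← zsum_add]
  refine zsum_mono fun k => ?_
  nlinarith [sq_nonneg (mathieu α θ h ψ k - h * ψ k)]

/-- The creation operator `p k ψ (k+1) - q k ψ k`. -/
def ladder (p q ψ : ℤ → ℝ) (k : ℤ) : ℝ := p k * ψ (k + 1) - q k * ψ k

/-- The factorized operator, the ladder operator composed with its adjoint. -/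
def factored (p q ψ : ℤ → ℝ) (k : ℤ) : ℝ :=
  p (k - 1) * ladder p q ψ (k - 1) - q k * ladder p q ψ k

lemma zsum_ladder_sq {N : ℕ} {ψ : ℤ → ℝ} (hψ : SuppIn N ψ) (p q : ℤ → ℝ) :
    zsum N (fun k => ladder p q ψ k ^ 2) = zsum N (fun k => ψ k * factored p q ψ k) := by
  refine zsum_eq_of_telescope (fun k => p (k - 1) ^ 2 * ψ k ^ 2
    - p (k - 1) * q (k - 1) * ψ (k - 1) * ψ k) ?_ ?_ ?_
  · simp [hψ.eq_zero (k := N + 1) (by left; omega)]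
  · simp [hψ.eq_zero (k := -N) (by right; omega)]
  · intro k
    simp only [factored, ladder, add_sub_cancel_right, sub_add_cancel]
    ring

lemma zsum_factored_sq_ge {N : ℕ} {ψ : ℤ → ℝ} (hψ : SuppIn N ψ) (p q : ℤ → ℝ) :
    zsum N (fun k => (p k ^ 2 - q (k + 1) ^ 2 - (p (k - 1) ^ 2 - q k ^ 2)) * ladder p q ψ k ^ 2)
      ≤ zsum N (fun k => factored p q ψ k ^ 2) := by
  refine zsum_le_of_telescope
    (fun k => (p (k - 1) ^ 2 - q k ^ 2) * ladder p q ψ (k - 1) ^ 2) ?_ ?_ ?_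
  · simp [ladder, hψ.eq_zero (k := N + 1) (by left; omega),
      hψ.eq_zero (k := N) (by left; omega)]
  · simp [ladder, hψ.eq_zero (k := -N) (by right; omega),
      hψ.eq_zero (k := -N - 1) (by right; omega)]
  · intro k
    simp only [factored, add_sub_cancel_right]
    nlinarith [sq_nonneg (q k * ladder p q ψ (k - 1) - p (k - 1) * ladder p q ψ k)]

/-- The upper coefficient of the ladder operator. -/
def superP (α θ h : ℝ) (k : ℤ) : ℝ := Real.sin (θ + h * k) / 2 + superRoot α (θ + h * k)

/-- The lower coefficient of the ladder operator. -/
def superQ (α θ h : ℝ) (k : ℤ) : ℝ := -(Real.sin (θ + h * k) / 2) + superRoot α (θ + h * k)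

lemma superP_mul_superQ (α θ h : ℝ) (k : ℤ) : superP α θ h k * superQ α θ h k = α ^ 2 := by
  have := superRoot_sq α (θ + h * k)
  unfold superP superQ
  linear_combination this

lemma superP_sq (α θ h : ℝ) (k : ℤ) : superP α θ h k ^ 2 =
    Real.sin (θ + h * k) ^ 2 / 2 + α ^ 2 + superProd α (θ + h * k) := by
  have := superRoot_sq α (θ + h * k)
  unfold superP superProd
  linear_combination this

lemma superQ_sq (α θ h : ℝ) (k : ℤ) : superQ α θ h k ^ 2 =
    Real.sin (θ + h * k) ^ 2 / 2 + α ^ 2 - superProd α (θ + h * k) := by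
  have := superRoot_sq α (θ + h * k)
  unfold superQ superProd
  linear_combination this

/-- The deviation of the factorized potential from its quadratic and quartic parts. -/
def superErr (α θ h : ℝ) (k : ℤ) : ℝ :=
  (Real.sin (θ + h * k) ^ 2 - Real.sin (θ + h * k - h) ^ 2) / 2
    + (superProd α (θ + h * k) - superProd α (θ + h * k - h) - α * h)

lemma factored_super (α θ h : ℝ) (ψ : ℤ → ℝ) (k : ℤ) :
    factored (superP α θ h) (superQ α θ h) ψ k =
      mathieu α θ h ψ k - (α * h + well θ h k ^ 2 / 4 + superErr α θ h k) * ψ k := by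
  have e1 := superP_mul_superQ α θ h k
  have e2 := superP_mul_superQ α θ h (k - 1)
  have e3 := superP_sq α θ h (k - 1)
  have e4 := superQ_sq α θ h k
  have e5 : θ + h * ((k - 1 : ℤ) : ℝ) = θ + h * k - h := by push_cast; ring
  rw [e5] at e3
  have e6 := Real.sin_sq_add_cos_sq (θ + h * k)
  unfold factored ladder mathieu lap well superErr
  rw [sub_add_cancel]
  linear_combination (-ψ (k + 1)) * e1 - ψ (k - 1) * e2 + ψ k * e3 + ψ k * e4
    + ψ k * e6

lemma chord_sq_eq_well (θ h : ℝ) (k : ℤ) : chord (θ + h * k) ^ 2 = well θ h k := chord_sq _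

lemma abs_sin_sq_sub_le (t h : ℝ) (hh : 0 ≤ h) :
    |Real.sin t ^ 2 - Real.sin (t - h) ^ 2| ≤ h * (2 * chord t + h) := by
  have h1 := abs_sin_sub_sin_le t (t - h)
  rw [sub_sub_cancel, abs_of_nonneg hh] at h1
  have h2 : |Real.sin t + Real.sin (t - h)| ≤ 2 * chord t + h := by
    have := abs_sin_le_chord t
    have h3 : Real.sin t + Real.sin (t - h) = 2 * Real.sin t - (Real.sin t - Real.sin (t - h)) := by
      ring
    rw [h3]
    refine (abs_sub _ _).trans ?_
    rw [abs_mul, abs_two]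
    linarith
  rw [sq_sub_sq, abs_mul, mul_comm]
  exact mul_le_mul h1 h2 (abs_nonneg _) hh

lemma abs_superErr_le {α h : ℝ} (hα : 0 < α) (hh : 0 ≤ h) (θ : ℝ) (k : ℤ) :
    |superErr α θ h k| ≤ (3 + α) * (h * (chord (θ + h * k) + h)) := by
  have h1 := abs_sin_sq_sub_le (θ + h * k) h hh
  have h2 := abs_superProd_sub_le hα (θ + h * k) (θ + h * k) (θ + h * k - h) (h := h)
    (by simpa using hh) (by simp [abs_of_nonneg hh])
  rw [sub_sub_cancel, abs_of_nonneg hh] at h2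
  unfold superErr
  refine (abs_add_le _ _).trans ?_
  rw [abs_div, abs_two]
  nlinarith [chord_nonneg (θ + h * k)]

lemma superErr_sq_le {α h : ℝ} (hα : 0 < α) (hh : 0 ≤ h) (θ : ℝ) (k : ℤ) :
    superErr α θ h k ^ 2 ≤ 2 * (3 + α) ^ 2 * h ^ 2 * (well θ h k + h ^ 2) := by
  rw [← sq_abs]
  have h0 := chord_nonneg (θ + h * k)
  refine (pow_le_pow_left₀ (abs_nonneg _) (abs_superErr_le hα hh θ k) 2).trans ?_
  rw [← chord_sq_eq_well]
  have : (chord (θ + h * k) + h) ^ 2 ≤ 2 * (chord (θ + h * k) ^ 2 + h ^ 2) := by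
    nlinarith [sq_nonneg (chord (θ + h * k) - h)]
  rw [mul_pow, mul_pow]
  have h3 : 0 ≤ (3 + α) ^ 2 * h ^ 2 := by positivity
  nlinarith [mul_le_mul_of_nonneg_left this h3]

lemma ladder_gain {α h : ℝ} (hα : 0 < α) (hh : 0 ≤ h) (θ : ℝ) (k : ℤ) :
    2 * (α * h) - (5 + 2 * α) * (h * (chord (θ + h * k) + h)) ≤
      superP α θ h k ^ 2 - superQ α θ h (k + 1) ^ 2
        - (superP α θ h (k - 1) ^ 2 - superQ α θ h k ^ 2) := by
  have h2 := abs_superProd_sub_le hα (θ + h * k) (θ + h * k + h) (θ + h * k - h) (h := h)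
    (by simp [abs_of_nonneg hh]) (by simp [abs_of_nonneg hh])
  rw [add_sub_sub_cancel, abs_of_nonneg (by linarith : (0 : ℝ) ≤ h + h)] at h2
  have h3 := (abs_le.1 h2).1
  have e5 : θ + h * ((k - 1 : ℤ) : ℝ) = θ + h * k - h := by push_cast; ring
  have e6 : θ + h * ((k + 1 : ℤ) : ℝ) = θ + h * k + h := by push_cast; ring
  simp only [superP_sq, superQ_sq, e5, e6]
  set t := θ + h * k
  have h4 : Real.sin (t + h) ^ 2 + Real.sin (t - h) ^ 2 - 2 * Real.sin t ^ 2 ≤ 2 * h ^ 2 := by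
    have a1 := Real.sin_sq_add_cos_sq t
    have a2 := Real.sin_sq_add_cos_sq h
    have : Real.sin (t + h) ^ 2 + Real.sin (t - h) ^ 2 - 2 * Real.sin t ^ 2
        = 2 * Real.sin h ^ 2 * (Real.cos t ^ 2 - Real.sin t ^ 2) := by
      rw [Real.sin_add, Real.sin_sub]
      linear_combination (2 * Real.sin t ^ 2) * a2
    rw [this]
    have b1 : Real.sin h ^ 2 ≤ h ^ 2 := by
      rw [sq_le_sq]
      simpa using abs_sin_sub_sin_le h 0
    nlinarith [sq_nonneg (Real.sin h), sq_nonneg (Real.sin t), sq_nonneg (Real.cos t)]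
  have := chord_nonneg t
  nlinarith [mul_nonneg hh this]

lemma abs_superP_le {α : ℝ} (hα : 0 < α) (θ h : ℝ) (k : ℤ) : superP α θ h k ^ 2 ≤ (1 + α) ^ 2 := by
  have h1 := superRoot_le hα (θ + h * k)
  have h2 := superRoot_pos hα (θ + h * k)
  have h3 := Real.abs_sin_le_one (θ + h * k)
  rw [abs_div, abs_two] at h1
  rw [sq_le_sq, abs_of_pos (by linarith : 0 < 1 + α)]
  unfold superP
  refine (abs_add_le _ _).trans ?_
  rw [abs_div, abs_two, abs_of_pos h2]
  linarith

lemma sin_sq_le_well (θ h : ℝ) (k : ℤ) : Real.sin (θ + h * k) ^ 2 ≤ well θ h k := by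
  rw [← chord_sq_eq_well, ← sq_abs]
  exact pow_le_pow_left₀ (abs_nonneg _) (abs_sin_le_chord _) 2

lemma ladder_sq_le {α : ℝ} (hα : 0 < α) (θ h : ℝ) (ψ : ℤ → ℝ) (k : ℤ) :
    ladder (superP α θ h) (superQ α θ h) ψ k ^ 2 ≤
      2 * (1 + α) ^ 2 * (ψ (k + 1) - ψ k) ^ 2 + 2 * (well θ h k * ψ k ^ 2) := by
  have h1 := abs_superP_le hα θ h k
  have h2 := sin_sq_le_well θ h k
  have e : ladder (superP α θ h) (superQ α θ h) ψ k =
      superP α θ h k * (ψ (k + 1) - ψ k) + Real.sin (θ + h * k) * ψ k := by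
    unfold ladder superQ superP; ring
  rw [e]
  nlinarith [sq_nonneg (superP α θ h k * (ψ (k + 1) - ψ k) - Real.sin (θ + h * k) * ψ k),
    mul_le_mul_of_nonneg_right h1 (sq_nonneg (ψ (k + 1) - ψ k)),
    mul_le_mul_of_nonneg_right h2 (sq_nonneg (ψ k))]

/-- The basic sums controlled by the energy. -/
structure EnergyBounds (K : ℝ) (N : ℕ) (α θ h : ℝ) (ψ : ℤ → ℝ) : Prop where
  wellSq : zsum N (fun k => (well θ h k * ψ k) ^ 2) ≤ K * energy N α θ h ψ
  wellForm : h * zsum N (fun k => well θ h k * ψ k ^ 2) ≤ energy N α θ h ψ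
  mass : h ^ 2 * zsum N (fun k => ψ k ^ 2) ≤ energy N α θ h ψ
  ladderSq : h * zsum N (fun k => ladder (superP α θ h) (superQ α θ h) ψ k ^ 2)
    ≤ K * energy N α θ h ψ
  wellLadder : zsum N (fun k => well θ h k * ladder (superP α θ h) (superQ α θ h) ψ k ^ 2)
    ≤ K * energy N α θ h ψ
  factoredSq : zsum N (fun k => factored (superP α θ h) (superQ α θ h) ψ k ^ 2)
    ≤ K * energy N α θ h ψ

set_option maxHeartbeats 1000000 in
lemma exists_energyBounds {α : ℝ} (hα : 0 < α) : ∃ K : ℝ, 0 < K ∧ ∀ (h θ : ℝ) (N : ℕ) (ψ : ℤ → ℝ),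
    0 < h → h ≤ 1 → SuppIn N ψ → EnergyBounds K N α θ h ψ := by
  set A := 1 + 2 * α ^ 2 with hA
  set P := (1 + α) ^ 2 / α ^ 2 with hP
  set E := 2 * (3 + α) ^ 2 with hE
  have hA0 : 0 < A := by positivity
  have hP0 : 0 < P := by positivity
  have hE0 : 0 < E := by positivity
  have hPα : P * α ^ 2 = (1 + α) ^ 2 := by rw [hP]; field_simp
  refine ⟨A + P + 1 + (2 * P * A + 2 * A) + (4 + 4 * α ^ 2 + 4 * A + 8 * E), by positivity, ?_⟩
  intro h θ N ψ hh hh1 hψ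
  have b1 := quartic_le_energy hψ α θ h
  have b2 := form_le_energy hψ α θ h
  have b3 := sq_mul_le_energy N α θ h ψ
  have b0 := energy_nonneg N α θ h ψ
  have bM : zsum N (fun k => mathieu α θ h ψ k ^ 2) ≤ energy N α θ h ψ := by
    have : 0 ≤ h ^ 2 * zsum N (fun k => ψ k ^ 2) :=
      mul_nonneg (sq_nonneg h) (zsum_nonneg fun _ => sq_nonneg _)
    unfold energy; linarith
  have c1 : 0 ≤ zsum N (fun k => (well θ h k * ψ k) ^ 2) := zsum_nonneg fun _ => sq_nonneg _
  have c2 : 0 ≤ zsum N (fun k => well θ h k * (ψ (k + 1) - ψ k) ^ 2) :=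
    zsum_nonneg fun _ => mul_nonneg (well_nonneg ..) (sq_nonneg _)
  have c3 : 0 ≤ zsum N (fun k => (ψ (k + 1) - ψ k) ^ 2) := zsum_nonneg fun _ => sq_nonneg _
  have c4 : 0 ≤ zsum N (fun k => well θ h k * ψ k ^ 2) :=
    zsum_nonneg fun _ => mul_nonneg (well_nonneg ..) (sq_nonneg _)
  have c5 : 0 ≤ zsum N (fun k => ψ k ^ 2) := zsum_nonneg fun _ => sq_nonneg _
  have d1 : zsum N (fun k => (well θ h k * ψ k) ^ 2) ≤ A * energy N α θ h ψ := by
    nlinarith [sq_nonneg α]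
  have d2 : α ^ 2 * zsum N (fun k => well θ h k * (ψ (k + 1) - ψ k) ^ 2)
      ≤ A * energy N α θ h ψ := by linarith
  have d3 : h * zsum N (fun k => well θ h k * ψ k ^ 2) ≤ energy N α θ h ψ / 2 := by
    nlinarith [mul_nonneg hh.le (mul_nonneg (sq_nonneg α) c3)]
  have d4 : h * (α ^ 2 * zsum N (fun k => (ψ (k + 1) - ψ k) ^ 2)) ≤ energy N α θ h ψ / 2 := by
    nlinarith [mul_nonneg hh.le c4]
  have hS : ∀ x, x ≤ A + P + 1 + (2 * P * A + 2 * A) + (4 + 4 * α ^ 2 + 4 * A + 8 * E) →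
    x * energy N α θ h ψ ≤
      (A + P + 1 + (2 * P * A + 2 * A) + (4 + 4 * α ^ 2 + 4 * A + 8 * E)) * energy N α θ h ψ :=
    fun x hx => mul_le_mul_of_nonneg_right hx b0
  have hPA : 0 < P * A := by positivity
  refine ⟨d1.trans (hS _ (by nlinarith [sq_nonneg α])), by linarith, b3, ?_, ?_, ?_⟩
  · refine le_trans ?_ (hS (P + 1) (by nlinarith [sq_nonneg α]))
    have : zsum N (fun k => ladder (superP α θ h) (superQ α θ h) ψ k ^ 2) ≤
        2 * (1 + α) ^ 2 * zsum N (fun k => (ψ (k + 1) - ψ k) ^ 2)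
          + 2 * zsum N (fun k => well θ h k * ψ k ^ 2) := by
      rw [← zsum_const_mul, ← zsum_const_mul, ← zsum_add]
      exact zsum_mono (ladder_sq_le hα θ h ψ)
    rw [← hPα] at this
    nlinarith [mul_le_mul_of_nonneg_left this hh.le, mul_le_mul_of_nonneg_left d4 hP0.le]
  · refine le_trans ?_ (hS (2 * P * A + 2 * A) (by nlinarith [sq_nonneg α]))
    have : zsum N (fun k => well θ h k * ladder (superP α θ h) (superQ α θ h) ψ k ^ 2) ≤
        2 * (1 + α) ^ 2 * zsum N (fun k => well θ h k * (ψ (k + 1) - ψ k) ^ 2)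
          + 2 * zsum N (fun k => (well θ h k * ψ k) ^ 2) := by
      rw [← zsum_const_mul, ← zsum_const_mul, ← zsum_add]
      refine zsum_mono fun k => ?_
      have := mul_le_mul_of_nonneg_left (ladder_sq_le hα θ h ψ k) (well_nonneg θ h k)
      nlinarith
    rw [← hPα] at this
    nlinarith [mul_le_mul_of_nonneg_left d2 hP0.le]
  · refine le_trans ?_ (hS (4 + 4 * α ^ 2 + 4 * A + 8 * E) (by nlinarith [sq_nonneg α]))
    have : zsum N (fun k => factored (superP α θ h) (superQ α θ h) ψ k ^ 2) ≤
        4 * zsum N (fun k => mathieu α θ h ψ k ^ 2)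
        + 4 * α ^ 2 * (h ^ 2 * zsum N (fun k => ψ k ^ 2))
        + 4 * zsum N (fun k => (well θ h k * ψ k) ^ 2)
        + 4 * E * h ^ 2 * (zsum N (fun k => well θ h k * ψ k ^ 2)
          + h ^ 2 * zsum N (fun k => ψ k ^ 2)) := by
      simp only [← zsum_const_mul, ← zsum_add]
      refine zsum_mono fun k => ?_
      rw [factored_super]
      have f1 := superErr_sq_le hα hh.le θ k
      have f2 := well_nonneg θ h k
      have f3 := well_le θ h k
      have f4 : (well θ h k ^ 2 / 4) ^ 2 ≤ well θ h k ^ 2 := by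
        have f8 : well θ h k ^ 2 ≤ 16 := by nlinarith
        linarith [mul_le_mul_of_nonneg_left f8 (sq_nonneg (well θ h k))]
      have f5 := mul_le_mul_of_nonneg_right f1 (sq_nonneg (ψ k))
      have f6 := mul_le_mul_of_nonneg_right f4 (sq_nonneg (ψ k))
      set m := mathieu α θ h ψ k
      set w := well θ h k ^ 2 / 4
      set e := superErr α θ h k
      have f7 : (m - (α * h + w + e) * ψ k) ^ 2 ≤
          4 * (m ^ 2 + (α * h * ψ k) ^ 2 + (w * ψ k) ^ 2 + (e * ψ k) ^ 2) := by
        linarith [sq_nonneg (m + α * h * ψ k), sq_nonneg (m + w * ψ k), sq_nonneg (m + e * ψ k),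
          sq_nonneg (α * h * ψ k - w * ψ k), sq_nonneg (α * h * ψ k - e * ψ k),
          sq_nonneg (w * ψ k - e * ψ k)]
      refine f7.trans ?_
      rw [← hE] at f5
      nlinarith
    have g1 : h ^ 2 * zsum N (fun k => well θ h k * ψ k ^ 2) ≤ energy N α θ h ψ := by
      nlinarith [mul_nonneg hh.le c4]
    have g2 : h ^ 2 * (h ^ 2 * zsum N (fun k => ψ k ^ 2)) ≤ energy N α θ h ψ := by
      have g3 : h ^ 2 ≤ 1 := by nlinarith
      linarith [mul_le_mul_of_nonneg_right g3 (mul_nonneg (sq_nonneg h) c5)]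
    nlinarith [mul_le_mul_of_nonneg_left g1 hE0.le, mul_le_mul_of_nonneg_left g2 hE0.le,
      mul_le_mul_of_nonneg_left b3 (sq_nonneg α)]

lemma mul_chord_add_le {r h : ℝ} (hr : 0 < r) (hr1 : r ≤ 1) (hrh : r ^ 2 = h) (θ : ℝ) (k : ℤ) :
    h * (chord (θ + h * k) + h) ≤ r * (2 * h + well θ h k) := by
  rw [← chord_sq_eq_well]
  have h0 := chord_nonneg (θ + h * k)
  subst hrh
  have h1 : 0 ≤ r * ((r - chord (θ + r ^ 2 * k)) ^ 2) := by positivity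
  have h2 : r ^ 2 * r ^ 2 ≤ r * r ^ 2 := by nlinarith [pow_pos hr 3]
  nlinarith [mul_nonneg hr.le (sq_nonneg (chord (θ + r ^ 2 * k))), pow_pos hr 3]

lemma quartic_second_difference_le (θ h : ℝ) (k : ℤ) :
    (well θ h (k + 1) ^ 2 / 4 + well θ h (k - 1) ^ 2 / 4 - 2 * (well θ h k ^ 2 / 4)) / 2
      ≤ 2 * h ^ 2 * (well θ h k + h ^ 2) := by
  have hw := sin_sq_le_well θ h k
  have hw0 := well_nonneg θ h k
  rw [well_add_one, well_sub_one, Real.cos_add (θ + h * k), Real.cos_sub (θ + h * k)]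
  have e1 := Real.sin_sq_add_cos_sq (θ + h * k)
  have e2 := Real.sin_sq_add_cos_sq h
  have e3 : well θ h k = 2 - 2 * Real.cos (θ + h * k) := rfl
  have e4 := Real.cos_le_one (θ + h * k)
  have e5 := Real.neg_one_le_cos (θ + h * k)
  have e6 := one_sub_cos_nonneg h
  have e7 := one_sub_cos_le h
  set B := well θ h k
  set c := Real.cos h
  set s := Real.sin h
  set C := Real.cos (θ + h * k)
  set S := Real.sin (θ + h * k)
  have key : ((2 - 2 * (C * c - S * s)) ^ 2 / 4 + (2 - 2 * (C * c + S * s)) ^ 2 / 4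
      - 2 * (B ^ 2 / 4)) / 2 = (1 - c) * (2 * (C - (C ^ 2 - S ^ 2)) + (1 - c) * (C ^ 2 - S ^ 2)) := by
    rw [e3]
    have hS : S ^ 2 = 1 - C ^ 2 := by linarith
    have hs : s ^ 2 = 1 - c ^ 2 := by linarith
    ring_nf
    rw [hS, hs]
    ring
  rw [key]
  have f1 : C - (C ^ 2 - S ^ 2) ≤ 2 * B := by linarith
  have f2 : C ^ 2 - S ^ 2 ≤ 1 := by nlinarith
  have f3 : 2 * (C - (C ^ 2 - S ^ 2)) + (1 - c) * (C ^ 2 - S ^ 2) ≤ 4 * (B + h ^ 2) := by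
    nlinarith
  calc _ ≤ (1 - c) * (4 * (B + h ^ 2)) := mul_le_mul_of_nonneg_left f3 e6
    _ ≤ h ^ 2 / 2 * (4 * (B + h ^ 2)) := mul_le_mul_of_nonneg_right e7 (by positivity)
    _ = _ := by ring

lemma ladder_gain_sum {K α r h θ : ℝ} {N : ℕ} {ψ : ℤ → ℝ} (hα : 0 < α) (hr : 0 < r) (hr1 : r ≤ 1)
    (hrh : r ^ 2 = h) (hψ : SuppIn N ψ) (hb : EnergyBounds K N α θ h ψ) :
    2 * (α * h) * zsum N (fun k => ladder (superP α θ h) (superQ α θ h) ψ k ^ 2)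
      - (5 + 2 * α) * (3 * K) * r * energy N α θ h ψ
      ≤ zsum N (fun k => factored (superP α θ h) (superQ α θ h) ψ k ^ 2) := by
  have h0 : 0 < h := by rw [← hrh]; positivity
  have h1 := zsum_factored_sq_ge hψ (superP α θ h) (superQ α θ h)
  refine le_trans ?_ h1
  have h2 : 2 * (α * h) * zsum N (fun k => ladder (superP α θ h) (superQ α θ h) ψ k ^ 2)
      - (5 + 2 * α) * r * (2 * h *
        zsum N (fun k => ladder (superP α θ h) (superQ α θ h) ψ k ^ 2) +
        zsum N (fun k => well θ h k * ladder (superP α θ h) (superQ α θ h) ψ k ^ 2)) ≤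
      zsum N (fun k => (superP α θ h k ^ 2 - superQ α θ h (k + 1) ^ 2
        - (superP α θ h (k - 1) ^ 2 - superQ α θ h k ^ 2))
          * ladder (superP α θ h) (superQ α θ h) ψ k ^ 2) := by
    simp only [← zsum_const_mul, ← zsum_add, ← zsum_sub]
    refine zsum_mono fun k => ?_
    have a1 := ladder_gain hα h0.le θ k
    have a2 := mul_chord_add_le hr hr1 hrh θ k
    have a3 : 2 * (α * h) - (5 + 2 * α) * (r * (2 * h + well θ h k)) ≤
      superP α θ h k ^ 2 - superQ α θ h (k + 1) ^ 2
        - (superP α θ h (k - 1) ^ 2 - superQ α θ h k ^ 2) := by nlinarith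
    have a4 := mul_le_mul_of_nonneg_right a3
      (sq_nonneg (ladder (superP α θ h) (superQ α θ h) ψ k))
    linarith
  refine le_trans ?_ h2
  have a1 := hb.ladderSq
  have a2 := hb.wellLadder
  have a3 : 0 ≤ (5 + 2 * α) * r := by positivity
  nlinarith [mul_le_mul_of_nonneg_left a1 a3, mul_le_mul_of_nonneg_left a2 a3]

lemma neg_quartic_term_le {K α r h θ : ℝ} {N : ℕ} {ψ : ℤ → ℝ} (hK : 0 < K) (hα : 0 < α) (hr : 0 < r)
    (hr1 : r ≤ 1) (hrh : r ^ 2 = h) (hψ : SuppIn N ψ) (hb : EnergyBounds K N α θ h ψ) :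
    -zsum N (fun k => well θ h k ^ 2 / 4 * ψ k
        * factored (superP α θ h) (superQ α θ h) ψ k)
      ≤ (4 * α ^ 2 + (4 * α + 9) * K) * r * energy N α θ h ψ := by
  have h0 : 0 < h := by rw [← hrh]; positivity
  have h1 : h ≤ 1 := by nlinarith
  have hhr : h ≤ r := by nlinarith
  have hS := energy_nonneg N α θ h ψ
  have e1 := zsum_mul_lap hψ (fun k => well θ h k ^ 2 / 4)
  have e2 : -(2 * h ^ 2 * (zsum N (fun k => well θ h k * ψ k ^ 2)
      + h ^ 2 * zsum N (fun k => ψ k ^ 2))) ≤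
      zsum N (fun k => well θ h k ^ 2 / 4 * ψ k * lap ψ k) := by
    rw [e1, ← neg_mul]
    simp only [← zsum_const_mul, ← zsum_add]
    refine zsum_mono fun k => ?_
    have a1 := mul_le_mul_of_nonneg_right (quartic_second_difference_le θ h k) (sq_nonneg (ψ k))
    have a2 : 0 ≤ (well θ h k ^ 2 / 4 + well θ h (k + 1) ^ 2 / 4) / 2 * (ψ (k + 1) - ψ k) ^ 2 := by
      positivity
    linarith
  have e3 : α ^ 2 * zsum N (fun k => well θ h k ^ 2 / 4 * ψ k * lap ψ k)
      - (4 * α + 9) * h * zsum N (fun k => (well θ h k * ψ k) ^ 2) ≤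
      zsum N (fun k => well θ h k ^ 2 / 4 * ψ k
        * factored (superP α θ h) (superQ α θ h) ψ k) := by
    simp only [← zsum_const_mul, ← zsum_sub]
    refine zsum_mono fun k => ?_
    rw [factored_super]
    have a1 := (le_abs_self _).trans (abs_superErr_le hα h0.le θ k)
    have a2 := chord_le_two (θ + h * k)
    have a3 : superErr α θ h k ≤ (3 + α) * (3 * h) := by
      refine a1.trans (mul_le_mul_of_nonneg_left ?_ (by positivity))
      nlinarith
    have a4 : well θ h k ^ 2 / 4 ≤ well θ h k := by
      nlinarith [well_nonneg θ h k, well_le θ h k]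
    have a5 : 0 ≤ well θ h k ^ 2 * ψ k ^ 2 := by positivity
    have a6 : (4 * α + 9) * h ≥ (α * h + superErr α θ h k) / 4 := by nlinarith
    have a7 := mul_le_mul_of_nonneg_right a6 a5
    have a8 := mul_nonneg (sub_nonneg.2 a4) a5
    unfold mathieu
    nlinarith
  have f1 := hb.wellSq
  have f2 := hb.wellForm
  have f3 := hb.mass
  have g1 := mul_le_mul_of_nonneg_left f2 h0.le
  have g2 := mul_le_mul_of_nonneg_left f3 (sq_nonneg h)
  have g3 := mul_le_mul_of_nonneg_left f1 (by positivity : 0 ≤ (4 * α + 9) * h)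
  have g4 : h * energy N α θ h ψ ≤ r * energy N α θ h ψ := mul_le_mul_of_nonneg_right hhr hS
  have g5 : h ^ 2 * energy N α θ h ψ ≤ r * energy N α θ h ψ :=
    mul_le_mul_of_nonneg_right (by nlinarith) hS
  have g6 := mul_le_mul_of_nonneg_left g4 (by positivity : 0 ≤ (4 * α + 9) * K)
  have g7 : 2 * h ^ 2 * (zsum N (fun k => well θ h k * ψ k ^ 2)
      + h ^ 2 * zsum N (fun k => ψ k ^ 2)) ≤ 4 * (r * energy N α θ h ψ) := by
    linarith
  linarith [mul_le_mul_of_nonneg_left (neg_le.1 (e2.trans' (neg_le_neg g7))) (sq_nonneg α)]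

lemma neg_err_term_le {K α r h θ : ℝ} {N : ℕ} {ψ : ℤ → ℝ} (hα : 0 < α) (hr : 0 < r)
    (hr1 : r ≤ 1) (hrh : r ^ 2 = h) (hb : EnergyBounds K N α θ h ψ) :
    -zsum N (fun k => superErr α θ h k * ψ k * factored (superP α θ h) (superQ α θ h) ψ k)
      ≤ (K + 4 * (3 + α) ^ 2) * r * energy N α θ h ψ := by
  have h0 : 0 < h := by rw [← hrh]; positivity
  have h1 : h ≤ 1 := by nlinarith
  have hS := energy_nonneg N α θ h ψ
  have e1 : -1 * zsum N (fun k => superErr α θ h k * ψ k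
      * factored (superP α θ h) (superQ α θ h) ψ k) ≤
      r * zsum N (fun k => factored (superP α θ h) (superQ α θ h) ψ k ^ 2)
      + 2 * (3 + α) ^ 2 * r * (h * zsum N (fun k => well θ h k * ψ k ^ 2)
        + h * (h ^ 2 * zsum N (fun k => ψ k ^ 2))) := by
    simp only [← zsum_const_mul, ← zsum_add]
    refine zsum_mono fun k => ?_
    have a1 := mul_le_mul_of_nonneg_right (superErr_sq_le hα h0.le θ k) (sq_nonneg (ψ k))
    set L := factored (superP α θ h) (superQ α θ h) ψ k
    set e := superErr α θ h k
    have a2 : -1 * (e * ψ k * L) ≤ r * L ^ 2 + (e * ψ k) ^ 2 / r := by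
      have : 0 ≤ ((r * L) ^ 2 + (e * ψ k) ^ 2 + (r * L + e * ψ k) ^ 2) / (2 * r) := by positivity
      have h3 : ((r * L) ^ 2 + (e * ψ k) ^ 2 + (r * L + e * ψ k) ^ 2) / (2 * r) =
        r * L ^ 2 + (e * ψ k) ^ 2 / r + e * ψ k * L := by field_simp; ring
      linarith
    have a3 : (e * ψ k) ^ 2 / r ≤ 2 * (3 + α) ^ 2 * r * (h * (well θ h k * ψ k ^ 2)
        + h * (h ^ 2 * ψ k ^ 2)) := by
      rw [div_le_iff₀ hr]
      have : 2 * (3 + α) ^ 2 * r * (h * (well θ h k * ψ k ^ 2) + h * (h ^ 2 * ψ k ^ 2)) * r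
        = 2 * (3 + α) ^ 2 * r ^ 2 * (h * (well θ h k * ψ k ^ 2) + h * (h ^ 2 * ψ k ^ 2)) := by ring
      rw [this, hrh]
      linarith
    linarith
  rw [neg_one_mul] at e1
  refine e1.trans ?_
  have f1 := hb.factoredSq
  have f2 := hb.wellForm
  have f3 := hb.mass
  have f4 := mul_le_mul_of_nonneg_left f3 h0.le
  have f5 := mul_le_mul_of_nonneg_right h1 hS
  have f6 := mul_le_mul_of_nonneg_left f1 hr.le
  have f7 := mul_le_mul_of_nonneg_left (add_le_add f2 (f4.trans f5))
    (by positivity : 0 ≤ 2 * (3 + α) ^ 2 * r)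
  linarith

lemma factored_sum_le {K α r h θ G τ : ℝ} {N : ℕ} {ψ : ℤ → ℝ} (hK : 0 < K) (hα : 0 < α)
    (hr : 0 < r) (hr1 : r ≤ 1) (hrh : r ^ 2 = h) (hτ : 0 < τ) (hψ : SuppIn N ψ)
    (hb : EnergyBounds K N α θ h ψ) :
    zsum N (fun k => factored (superP α θ h) (superQ α θ h) ψ k ^ 2) ≤
      (G - α * h) * zsum N (fun k => ladder (superP α θ h) (superQ α θ h) ψ k ^ 2)
      + τ * (K * energy N α θ h ψ)
      + zsum N (fun k => (mathieu α θ h ψ k - G * ψ k) ^ 2) / τ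
      + ((4 * α ^ 2 + (4 * α + 9) * K) + (K + 4 * (3 + α) ^ 2)) * r * energy N α θ h ψ := by
  have e1 : zsum N (fun k => factored (superP α θ h) (superQ α θ h) ψ k ^ 2) ≤
      (G - α * h) * zsum N (fun k => ψ k * factored (superP α θ h) (superQ α θ h) ψ k)
      + τ * zsum N (fun k => factored (superP α θ h) (superQ α θ h) ψ k ^ 2)
      + 1 / τ * zsum N (fun k => (mathieu α θ h ψ k - G * ψ k) ^ 2)
      - zsum N (fun k => well θ h k ^ 2 / 4 * ψ k
        * factored (superP α θ h) (superQ α θ h) ψ k)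
      - zsum N (fun k => superErr α θ h k * ψ k
        * factored (superP α θ h) (superQ α θ h) ψ k) := by
    simp only [← zsum_const_mul, ← zsum_add, ← zsum_sub]
    refine zsum_mono fun k => ?_
    have a1 := factored_super α θ h ψ k
    set L := factored (superP α θ h) (superQ α θ h) ψ k
    set f := mathieu α θ h ψ k - G * ψ k with hf
    have a2 : L * f ≤ τ * L ^ 2 + 1 / τ * f ^ 2 := by
      have : 0 ≤ ((τ * L) ^ 2 + f ^ 2 + (τ * L - f) ^ 2) / (2 * τ) := by positivity
      have h3 : ((τ * L) ^ 2 + f ^ 2 + (τ * L - f) ^ 2) / (2 * τ) =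
        τ * L ^ 2 + 1 / τ * f ^ 2 - L * f := by field_simp; ring
      linarith
    have a3 : L ^ 2 = L * f + (G - α * h) * (ψ k * L) - well θ h k ^ 2 / 4 * ψ k * L
      - superErr α θ h k * ψ k * L := by
      have : L = f + G * ψ k - (α * h + well θ h k ^ 2 / 4 + superErr α θ h k) * ψ k := by
        rw [a1, hf]; ring
      linear_combination L * this
    linarith
  rw [← zsum_ladder_sq hψ] at e1
  have f1 := neg_quartic_term_le hK hα hr hr1 hrh hψ hb
  have f2 := neg_err_term_le hα hr hr1 hrh hb
  have f3 := mul_le_mul_of_nonneg_left hb.factoredSq hτ.le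
  rw [div_eq_inv_mul, ← one_div τ]
  linarith

lemma mass_le_ladder_sum {K α r h θ G τ : ℝ} {N : ℕ} {ψ : ℤ → ℝ} (hK : 0 < K) (hα : 0 < α)
    (hr : 0 < r) (hr1 : r ≤ 1) (hrh : r ^ 2 = h) (hτ : 0 < τ) (hψ : SuppIn N ψ)
    (hb : EnergyBounds K N α θ h ψ) :
    h * (G - α * h) * zsum N (fun k => ψ k ^ 2) ≤
      h * zsum N (fun k => ladder (superP α θ h) (superQ α θ h) ψ k ^ 2)
      + τ * energy N α θ h ψ
      + zsum N (fun k => (mathieu α θ h ψ k - G * ψ k) ^ 2) / τ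
      + (K + 3 * (3 + α)) * r * energy N α θ h ψ := by
  have h0 : 0 < h := by rw [← hrh]; positivity
  have hhr : h ≤ r := by nlinarith
  have hS := energy_nonneg N α θ h ψ
  rw [zsum_ladder_sq hψ]
  have e1 : h * (G - α * h) * zsum N (fun k => ψ k ^ 2) ≤
      h * zsum N (fun k => ψ k * factored (superP α θ h) (superQ α θ h) ψ k)
      + τ * (h ^ 2 * zsum N (fun k => ψ k ^ 2))
      + 1 / τ * zsum N (fun k => (mathieu α θ h ψ k - G * ψ k) ^ 2)
      + h * zsum N (fun k => (well θ h k * ψ k) ^ 2)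
      + (3 + α) * r * (2 * (h ^ 2 * zsum N (fun k => ψ k ^ 2))
        + h * zsum N (fun k => well θ h k * ψ k ^ 2)) := by
    simp only [← zsum_const_mul, ← zsum_add]
    refine zsum_mono fun k => ?_
    rw [factored_super]
    have a1 := (le_abs_self _).trans (abs_superErr_le hα h0.le θ k)
    have a2 := mul_chord_add_le hr hr1 hrh θ k
    have a3 : superErr α θ h k ≤ (3 + α) * (r * (2 * h + well θ h k)) :=
      a1.trans (mul_le_mul_of_nonneg_left a2 (by positivity))
    have a4 := mul_le_mul_of_nonneg_right a3 (by positivity : 0 ≤ h * ψ k ^ 2)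
    set f := mathieu α θ h ψ k - G * ψ k with hf
    have a5 : -(h * ψ k * f) ≤ τ * (h ^ 2 * ψ k ^ 2) + 1 / τ * f ^ 2 := by
      have : 0 ≤ ((τ * h * ψ k) ^ 2 + f ^ 2 + (τ * h * ψ k + f) ^ 2) / (2 * τ) := by positivity
      have h3 : ((τ * h * ψ k) ^ 2 + f ^ 2 + (τ * h * ψ k + f) ^ 2) / (2 * τ) =
        τ * (h ^ 2 * ψ k ^ 2) + 1 / τ * f ^ 2 + h * ψ k * f := by field_simp; ring
      linarith
    have a6 : mathieu α θ h ψ k = f + G * ψ k := by rw [hf]; ring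
    have a7 : 0 ≤ h * (well θ h k ^ 2 * ψ k ^ 2) := by positivity
    rw [a6]
    linarith
  have f1 := mul_le_mul_of_nonneg_left hb.wellSq h0.le
  have f2 := mul_le_mul_of_nonneg_left hb.mass hτ.le
  have f3 := mul_le_mul_of_nonneg_left hb.mass (by positivity : 0 ≤ (3 + α) * r)
  have f4 := mul_le_mul_of_nonneg_left hb.wellForm (by positivity : 0 ≤ (3 + α) * r)
  have f5 := mul_le_mul_of_nonneg_right hhr (mul_nonneg hK.le hS)
  rw [div_eq_inv_mul, ← one_div τ]
  linarith

/-- The energy `14/5 αh` lies in a gap of order `h` of the almost Mathieu operator. -/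
theorem exists_mathieu_gap {α : ℝ} (hα : 0 < α) : ∃ C h₀ : ℝ, 0 < C ∧ 0 < h₀ ∧ h₀ ≤ 1 ∧
    ∀ (h θ : ℝ) (N : ℕ) (ψ : ℤ → ℝ), 0 < h → h < h₀ → SuppIn N ψ →
      energy N α θ h ψ ≤
        C * zsum N (fun k => (mathieu α θ h ψ k - 14 / 5 * (α * h) * ψ k) ^ 2) := by
  obtain ⟨K, hK, hKb⟩ := exists_energyBounds hα
  set c1 := (4 * α ^ 2 + (4 * α + 9) * K) + (K + 4 * (3 + α) ^ 2) + (5 + 2 * α) * (3 * K) with hc1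
  have hc1p : 0 < c1 := by positivity
  set c2 := 5 * (K + c1 + 1) + α * (1 + K + 3 * (3 + α)) with hc2
  have hc2p : 0 < c2 := by positivity
  set c3 := (1 + 16 * α ^ 2) * c2 / α ^ 2 with hc3
  have hc3p : 0 < c3 := by positivity
  set c4 := (1 + 16 * α ^ 2) * (5 + α) / α ^ 2 with hc4
  have hc4p : 0 < c4 := by positivity
  set τ := 1 / (4 * (c3 + 1)) with hτ
  have hτp : 0 < τ := by positivity
  have hτ1 : τ ≤ 1 := by rw [hτ, div_le_one (by positivity)]; linarith
  have hτc : c3 * τ ≤ 1 / 4 := by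
    rw [hτ, mul_one_div, div_le_div_iff₀ (by positivity) (by norm_num)]; linarith
  refine ⟨4 + 2 * (c4 / τ), τ ^ 2, by positivity, by positivity, by nlinarith, ?_⟩
  intro h θ N ψ h0 hlt hψ
  set r := √h with hr
  have hrp : 0 < r := Real.sqrt_pos.2 h0
  have hrh : r ^ 2 = h := Real.sq_sqrt h0.le
  have hrτ : r < τ := by nlinarith
  have hr1 : r ≤ 1 := by linarith
  have hh1 : h ≤ 1 := by nlinarith
  have hb := hKb h θ N ψ h0 hh1 hψ
  have hS := energy_nonneg N α θ h ψ
  have hF : 0 ≤ zsum N (fun k => (mathieu α θ h ψ k - 14 / 5 * (α * h) * ψ k) ^ 2) :=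
    zsum_nonneg fun _ => sq_nonneg _
  have a1 := ladder_gain_sum hα hrp hr1 hrh hψ hb
  have a2 := factored_sum_le (G := 14 / 5 * (α * h)) hK hα hrp hr1 hrh hτp hψ hb
  have a3 := mass_le_ladder_sum (G := 14 / 5 * (α * h)) hK hα hrp hr1 hrh hτp hψ hb
  have a4 : energy N α θ h ψ ≤
      2 * zsum N (fun k => (mathieu α θ h ψ k - 14 / 5 * (α * h) * ψ k) ^ 2)
      + (1 + 16 * α ^ 2) * (h ^ 2 * zsum N (fun k => ψ k ^ 2)) := by
    unfold energy
    have : zsum N (fun k => mathieu α θ h ψ k ^ 2) ≤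
      2 * zsum N (fun k => (mathieu α θ h ψ k - 14 / 5 * (α * h) * ψ k) ^ 2)
      + 16 * α ^ 2 * h ^ 2 * zsum N (fun k => ψ k ^ 2) := by
      simp only [← zsum_const_mul, ← zsum_add]
      refine zsum_mono fun k => ?_
      nlinarith [sq_nonneg (mathieu α θ h ψ k - 2 * (14 / 5 * (α * h) * ψ k)),
        sq_nonneg (α * h * ψ k)]
    linarith
  set S := energy N α θ h ψ
  set F := zsum N (fun k => (mathieu α θ h ψ k - 14 / 5 * (α * h) * ψ k) ^ 2)
  set Φ := zsum N (fun k => ladder (superP α θ h) (superQ α θ h) ψ k ^ 2)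
  set Ψ := zsum N (fun k => ψ k ^ 2)
  have hrS : r * S ≤ τ * S := mul_le_mul_of_nonneg_right hrτ.le hS
  have b1 : α * h * Φ ≤ 5 * (τ * (K * S) + F / τ + c1 * (r * S)) := by
    rw [hc1]; linarith
  have b2 : α ^ 2 * (h ^ 2 * Ψ) ≤ c2 * (τ * S) + (5 + α) * (F / τ) := by
    have q1 : 9 / 5 * (α ^ 2 * (h ^ 2 * Ψ)) ≤
        α * h * Φ + α * (τ * S + F / τ + (K + 3 * (3 + α)) * r * S) := by
      nlinarith [mul_le_mul_of_nonneg_left a3 hα.le]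
    have q2 := mul_le_mul_of_nonneg_left hrS hc1p.le
    have q3 := mul_le_mul_of_nonneg_left hrS (by positivity : 0 ≤ α * (K + 3 * (3 + α)))
    have q4 : 0 ≤ α ^ 2 * (h ^ 2 * Ψ) :=
      mul_nonneg (sq_nonneg _) (mul_nonneg (sq_nonneg _) (zsum_nonneg fun _ => sq_nonneg _))
    have q5 : 0 ≤ τ * S := mul_nonneg hτp.le hS
    rw [hc2]
    linarith
  have b3 : (1 + 16 * α ^ 2) * (h ^ 2 * Ψ) ≤ c3 * τ * S + c4 / τ * F := by
    have q1 := mul_le_mul_of_nonneg_left b2 (by positivity : 0 ≤ (1 + 16 * α ^ 2) / α ^ 2)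
    have q2 : (1 + 16 * α ^ 2) / α ^ 2 * (α ^ 2 * (h ^ 2 * Ψ)) = (1 + 16 * α ^ 2) * (h ^ 2 * Ψ) := by
      field_simp
    have q3 : (1 + 16 * α ^ 2) / α ^ 2 * (c2 * (τ * S) + (5 + α) * (F / τ)) =
      c3 * τ * S + c4 / τ * F := by rw [hc3, hc4]; field_simp
    linarith
  have b4 := mul_le_mul_of_nonneg_right hτc hS
  have b5 : 0 ≤ c4 / τ * F := by positivity
  linarith

lemma zsum_shift {N : ℕ} {F : ℤ → ℝ} (h1 : F (N + 1) = 0) (h2 : F (-N) = 0) :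
    zsum N (fun k => F (k + 1)) = zsum N F :=
  zsum_eq_of_telescope F h1 h2 fun k => by ring

lemma zsum_shift_neg {N : ℕ} {F : ℤ → ℝ} (h1 : F N = 0) (h2 : F (-N - 1) = 0) :
    zsum N (fun k => F (k - 1)) = zsum N F :=
  zsum_eq_of_telescope (fun k => -F (k - 1)) (by simpa using h1) (by simpa using h2)
    fun k => by simp

/-- The almost Mathieu operator with a complex energy depending on the site. -/
def cmathieu (α θ h : ℝ) (e u : ℤ → ℂ) (k : ℤ) : ℂ :=
  α ^ 2 * (2 * u k - u (k + 1) - u (k - 1)) + (well θ h k - e k) * u k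

/-- The energies `G - 2 ch (1 - cos ζ_k) - 2 i sh sin ζ_k`. -/
def slowEnergy (G ch sh ζ η : ℝ) (k : ℤ) : ℂ :=
  ⟨G - 2 * ch * (1 - Real.cos (ζ + η * k)), -(2 * sh * Real.sin (ζ + η * k))⟩

lemma normSq_cmathieu (α θ h G ch sh ζ η : ℝ) (u : ℤ → ℂ) (k : ℤ) :
    Complex.normSq (cmathieu α θ h (slowEnergy G ch sh ζ η) u k) =
      (mathieu α θ h (fun k => (u k).re) k - G * (u k).re
        + 2 * ch * (1 - Real.cos (ζ + η * k)) * (u k).re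
        - 2 * sh * Real.sin (ζ + η * k) * (u k).im) ^ 2
      + (mathieu α θ h (fun k => (u k).im) k - G * (u k).im
        + 2 * ch * (1 - Real.cos (ζ + η * k)) * (u k).im
        + 2 * sh * Real.sin (ζ + η * k) * (u k).re) ^ 2 := by
  rw [Complex.normSq_apply, ← sq, ← sq]
  have e : (α : ℂ) ^ 2 = ((α ^ 2 : ℝ) : ℂ) := by push_cast; rfl
  congr 2
  · simp only [cmathieu, slowEnergy, mathieu, lap, e, Complex.add_re, Complex.mul_re,
      Complex.ofReal_re, Complex.ofReal_im, Complex.sub_re, Complex.sub_im, Complex.re_ofNat,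
      Complex.im_ofNat]
    ring
  · simp only [cmathieu, slowEnergy, mathieu, lap, e, Complex.add_im, Complex.mul_im,
      Complex.ofReal_re, Complex.ofReal_im, Complex.sub_re, Complex.sub_im, Complex.re_ofNat,
      Complex.im_ofNat]
    ring

lemma weighted_kinetic_ge {N : ℕ} {a : ℤ → ℝ} (ha : SuppIn N a) {ch : ℝ} (hch : 0 ≤ ch)
    (ζ η : ℝ) :
    -(ch * η ^ 2) * zsum N (fun k => a k ^ 2) ≤
      zsum N (fun k => 2 * ch * (1 - Real.cos (ζ + η * k)) * a k * lap a k) := by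
  have e : (fun k : ℤ => 2 * ch * (1 - Real.cos (ζ + η * k)) * a k * lap a k) =
      fun k => (ch * well ζ η k) * a k * lap a k := by
    funext k; unfold well; ring
  rw [e, zsum_mul_lap ha, ← zsum_const_mul]
  refine zsum_mono fun k => ?_
  have h1 : ch * well ζ η (k + 1) + ch * well ζ η (k - 1) - 2 * (ch * well ζ η k)
      = ch * (4 * (1 - Real.cos η) * Real.cos (ζ + η * k)) := by
    rw [← well_second_difference]; ring
  rw [h1]
  have h2 : (1 - Real.cos η) * Real.cos (ζ + η * k) ≤ η ^ 2 / 2 := by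
    nlinarith [one_sub_cos_nonneg η, one_sub_cos_le η, Real.cos_le_one (ζ + η * k)]
  have h3 : 0 ≤ (ch * well ζ η k + ch * well ζ η (k + 1)) / 2 * (a (k + 1) - a k) ^ 2 := by
    have := well_nonneg ζ η k
    have := well_nonneg ζ η (k + 1)
    positivity
  have h4 := mul_le_mul_of_nonneg_left h2 (by positivity : 0 ≤ ch * a k ^ 2)
  linarith

lemma current_ge {N : ℕ} {a b : ℤ → ℝ} (ha : SuppIn N a) (hb : SuppIn N b) {sh η : ℝ}
    (hsh : 0 ≤ sh) (hη : 0 ≤ η) (ζ : ℝ) :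
    -(2 * sh * η) * (zsum N (fun k => a k ^ 2) + zsum N (fun k => b k ^ 2)) ≤
      zsum N (fun k => 2 * sh * Real.sin (ζ + η * k) * (a k * lap b k - b k * lap a k)) := by
  have s1 : zsum N (fun k => a (k + 1) ^ 2) = zsum N (fun k => a k ^ 2) :=
    zsum_shift (F := fun k => a k ^ 2) (by simp [ha.eq_zero (k := N + 1) (by left; omega)])
      (by simp [ha.eq_zero (k := -N) (by right; omega)])
  have s2 : zsum N (fun k => b (k + 1) ^ 2) = zsum N (fun k => b k ^ 2) :=
    zsum_shift (F := fun k => b k ^ 2) (by simp [hb.eq_zero (k := N + 1) (by left; omega)])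
      (by simp [hb.eq_zero (k := -N) (by right; omega)])
  have s3 : -(2 * sh * η) * (zsum N (fun k => a k ^ 2) + zsum N (fun k => b k ^ 2)) =
      -(sh * η) * zsum N (fun k => a k ^ 2 + b k ^ 2 + a (k + 1) ^ 2 + b (k + 1) ^ 2) := by
    simp only [zsum_add, s1, s2]; ring
  rw [s3, ← zsum_const_mul]
  refine zsum_le_of_telescope
    (fun k => 2 * sh * Real.sin (ζ + η * k) * (a (k - 1) * b k - b (k - 1) * a k)) ?_ ?_ ?_
  · simp [ha.eq_zero (k := N + 1) (by left; omega), hb.eq_zero (k := N + 1) (by left; omega)]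
  · simp [ha.eq_zero (k := -N) (by right; omega), hb.eq_zero (k := -N) (by right; omega)]
  · intro k
    simp only [lap, add_sub_cancel_right]
    have h1 := abs_sin_sub_sin_le (ζ + η * ((k + 1 : ℤ) : ℝ)) (ζ + η * k)
    have h2 : ζ + η * ((k + 1 : ℤ) : ℝ) - (ζ + η * k) = η := by push_cast; ring
    rw [h2, abs_of_nonneg hη] at h1
    set s' := Real.sin (ζ + η * ((k + 1 : ℤ) : ℝ))
    set s := Real.sin (ζ + η * k)
    have h3 : |a k * b (k + 1) - b k * a (k + 1)| ≤
        (a k ^ 2 + b k ^ 2 + a (k + 1) ^ 2 + b (k + 1) ^ 2) / 2 := by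
      rw [abs_le]
      constructor <;> nlinarith [sq_nonneg (a k - b (k + 1)), sq_nonneg (b k - a (k + 1)),
        sq_nonneg (a k + b (k + 1)), sq_nonneg (b k + a (k + 1))]
    have h4 : |(s' - s) * (a k * b (k + 1) - b k * a (k + 1))| ≤
        η * ((a k ^ 2 + b k ^ 2 + a (k + 1) ^ 2 + b (k + 1) ^ 2) / 2) := by
      rw [abs_mul]; exact mul_le_mul h1 h3 (abs_nonneg _) hη
    have h5 := mul_le_mul_of_nonneg_left (abs_le.1 h4).1 hsh
    linarith

/-- Conditions on the parameters of a slowly varying complex energy. -/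
structure SlowParams (α h ch sh η : ℝ) : Prop where
  hη : 0 ≤ η
  hηh : η ≤ h ^ 3
  one_le : 1 ≤ ch
  le_two : ch ≤ 2
  hsh : 0 ≤ sh
  sq_sub : ch ^ 2 - sh ^ 2 = 1
  gap : 14 / 5 * (α * h) * ch ≤ 2 * ch ^ 2 - 2

lemma SuppIn.re {N : ℕ} {u : ℤ → ℂ} (hu : ∀ k : ℤ, (N : ℤ) ≤ |k| + 3 → u k = 0) :
    SuppIn N fun k => (u k).re := fun k hk => by simp [hu k hk]

lemma SuppIn.im {N : ℕ} {u : ℤ → ℂ} (hu : ∀ k : ℤ, (N : ℤ) ≤ |k| + 3 → u k = 0) :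
    SuppIn N fun k => (u k).im := fun k hk => by simp [hu k hk]

lemma zsum_normSq (N : ℕ) (u : ℤ → ℂ) : zsum N (fun k => Complex.normSq (u k)) =
    zsum N (fun k => (u k).re ^ 2) + zsum N (fun k => (u k).im ^ 2) := by
  rw [← zsum_add]; congr 1; ext k; rw [Complex.normSq_apply]; ring

lemma slow_potential_nonneg {α h ch sh η : ℝ} (hp : SlowParams α h ch sh η)
    (c s : ℝ) (hc : c ≤ 1) (hcs : s ^ 2 + c ^ 2 = 1) :
    0 ≤ (2 * ch * (1 - c)) ^ 2 - 2 * (14 / 5 * (α * h)) * (2 * ch * (1 - c)) + (2 * sh * s) ^ 2 := by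
  have h1 : (2 * ch * (1 - c)) ^ 2 - 2 * (14 / 5 * (α * h)) * (2 * ch * (1 - c))
      + (2 * sh * s) ^ 2 = 4 * (1 - c) * (2 * ch ^ 2 - 1 - c - 14 / 5 * (α * h) * ch) := by
    have e1 : s ^ 2 = 1 - c ^ 2 := by linarith
    have e2 : sh ^ 2 = ch ^ 2 - 1 := by linarith [hp.sq_sub]
    rw [mul_pow (2 * sh), mul_pow 2 sh, e1, e2]
    ring
  rw [h1]
  have := hp.gap
  exact mul_nonneg (by linarith) (by linarith)

lemma cmathieu_sum_ge {α h ch sh η : ℝ} (hp : SlowParams α h ch sh η)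
    (θ ζ : ℝ) {N : ℕ} {u : ℤ → ℂ} (hu : ∀ k : ℤ, (N : ℤ) ≤ |k| + 3 → u k = 0) :
    zsum N (fun k => (mathieu α θ h (fun k => (u k).re) k - 14 / 5 * (α * h) * (u k).re) ^ 2)
    + zsum N (fun k => (mathieu α θ h (fun k => (u k).im) k - 14 / 5 * (α * h) * (u k).im) ^ 2)
    - α ^ 2 * (2 * ch * η ^ 2 + 4 * sh * η) * zsum N (fun k => Complex.normSq (u k)) ≤
    zsum N (fun k => Complex.normSq
      (cmathieu α θ h (slowEnergy (14 / 5 * (α * h)) ch sh ζ η) u k)) := by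
  have ha := SuppIn.re hu
  have hb := SuppIn.im hu
  have hch : 0 ≤ ch := by linarith [hp.one_le]
  have k1 := weighted_kinetic_ge ha hch ζ η
  have k2 := weighted_kinetic_ge hb hch ζ η
  have k3 := current_ge ha hb hp.hsh hp.hη ζ
  have key : zsum N (fun k =>
      (mathieu α θ h (fun k => (u k).re) k - 14 / 5 * (α * h) * (u k).re) ^ 2)
    + zsum N (fun k => (mathieu α θ h (fun k => (u k).im) k - 14 / 5 * (α * h) * (u k).im) ^ 2)
    + 2 * α ^ 2 * zsum N (fun k => 2 * ch * (1 - Real.cos (ζ + η * k)) * (u k).re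
      * lap (fun k => (u k).re) k)
    + 2 * α ^ 2 * zsum N (fun k => 2 * ch * (1 - Real.cos (ζ + η * k)) * (u k).im
      * lap (fun k => (u k).im) k)
    + 2 * α ^ 2 * zsum N (fun k => 2 * sh * Real.sin (ζ + η * k) *
      ((u k).re * lap (fun k => (u k).im) k - (u k).im * lap (fun k => (u k).re) k)) ≤
    zsum N (fun k => Complex.normSq
      (cmathieu α θ h (slowEnergy (14 / 5 * (α * h)) ch sh ζ η) u k)) := by
    simp only [← zsum_const_mul, ← zsum_add]
    refine zsum_mono fun k => ?_
    rw [normSq_cmathieu]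
    have c1 := Real.cos_le_one (ζ + η * k)
    have q := slow_potential_nonneg hp _ _ c1
      (Real.sin_sq_add_cos_sq (ζ + η * k))
    have q1 := mul_nonneg q (add_nonneg (sq_nonneg (u k).re) (sq_nonneg (u k).im))
    have q2 : 0 ≤ 2 * ch * (1 - Real.cos (ζ + η * k)) * (well θ h k) *
        ((u k).re ^ 2 + (u k).im ^ 2) := by
      have := well_nonneg θ h k
      have : 0 ≤ 1 - Real.cos (ζ + η * k) := by linarith
      positivity
    simp only [mathieu]
    linarith
  rw [zsum_normSq]
  nlinarith [mul_le_mul_of_nonneg_left k1 (sq_nonneg α), mul_le_mul_of_nonneg_left k2 (sq_nonneg α),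
    mul_le_mul_of_nonneg_left k3 (sq_nonneg α)]

/-- The energy of a complex sequence. -/
def cenergy (N : ℕ) (α θ h : ℝ) (u : ℤ → ℂ) : ℝ :=
  energy N α θ h (fun k => (u k).re) + energy N α θ h (fun k => (u k).im)

lemma sq_mul_le_cenergy (N : ℕ) (α θ h : ℝ) (u : ℤ → ℂ) :
    h ^ 2 * zsum N (fun k => Complex.normSq (u k)) ≤ cenergy N α θ h u := by
  rw [zsum_normSq, mul_add]
  exact add_le_add (sq_mul_le_energy ..) (sq_mul_le_energy ..)

theorem exists_cmathieu_gap {α : ℝ} (hα : 0 < α) : ∃ C h₀ : ℝ, 0 < C ∧ 0 < h₀ ∧ h₀ ≤ 1 ∧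
    ∀ (h θ ζ ch sh η : ℝ) (N : ℕ) (u : ℤ → ℂ), 0 < h → h < h₀ → SlowParams α h ch sh η →
      (∀ k : ℤ, (N : ℤ) ≤ |k| + 3 → u k = 0) →
      cenergy N α θ h u ≤ C * zsum N (fun k => Complex.normSq
        (cmathieu α θ h (slowEnergy (14 / 5 * (α * h)) ch sh ζ η) u k)) := by
  obtain ⟨C, h₀, hC, h₀p, h₀1, hgap⟩ := exists_mathieu_gap hα
  refine ⟨2 * C, min h₀ (1 / (2 * C * (12 * α ^ 2) + 1)), by positivity, by positivity,
    (min_le_left _ _).trans h₀1, ?_⟩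
  intro h θ ζ ch sh η N u hh hlt hp hu
  have hh0 := hlt.trans_le (min_le_left _ _)
  have hh1 := hlt.trans_le (min_le_right _ _)
  rw [lt_div_iff₀ (by positivity)] at hh1
  have h1 : h ≤ 1 := by linarith
  have ga := hgap h θ N _ hh hh0 (SuppIn.re hu)
  have gb := hgap h θ N _ hh hh0 (SuppIn.im hu)
  have gs := cmathieu_sum_ge hp θ ζ hu
  have gm := sq_mul_le_cenergy N α θ h u
  have hΨ : 0 ≤ zsum N (fun k => Complex.normSq (u k)) := zsum_nonneg fun _ => Complex.normSq_nonneg _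
  set Ψ := zsum N (fun k => Complex.normSq (u k))
  have hsh2 : sh ≤ 2 := by nlinarith [hp.sq_sub, hp.le_two, hp.one_le, hp.hsh]
  have hη1 : η ≤ 1 := hp.hηh.trans (pow_le_one₀ hh.le h1)
  have e1 : 2 * ch * η ^ 2 + 4 * sh * η ≤ 12 * h ^ 3 := by
    have : η ^ 2 ≤ η := by nlinarith [hp.hη]
    nlinarith [mul_le_mul_of_nonneg_left this (by linarith [hp.one_le] : 0 ≤ ch),
      mul_le_mul_of_nonneg_right hp.le_two hp.hη, mul_le_mul_of_nonneg_right hsh2 hp.hη, hp.hηh]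
  have e2 : α ^ 2 * (2 * ch * η ^ 2 + 4 * sh * η) * Ψ ≤ 12 * α ^ 2 * h * cenergy N α θ h u := by
    have q1 := mul_le_mul_of_nonneg_right e1 (mul_nonneg (sq_nonneg α) hΨ)
    have q2 := mul_le_mul_of_nonneg_left gm (by positivity : 0 ≤ 12 * α ^ 2 * h)
    linarith
  have hce : 0 ≤ cenergy N α θ h u := add_nonneg (energy_nonneg ..) (energy_nonneg ..)
  have e3 : C * (12 * α ^ 2 * h) * cenergy N α θ h u ≤ 1 / 2 * cenergy N α θ h u :=
    mul_le_mul_of_nonneg_right (by linarith) hce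
  have e4 := mul_le_mul_of_nonneg_left gs hC.le
  have e5 := mul_le_mul_of_nonneg_left e2 hC.le
  unfold cenergy at *
  linarith

lemma well_sq_le_shift {h : ℝ} (hh : 0 ≤ h) (θ : ℝ) (k : ℤ) :
    well θ h k ^ 2 ≤ 8 * well θ h (k + 1) ^ 2 + 8 * h ^ 4 := by
  have h1 := chord_le_add (θ + h * ((k + 1 : ℤ) : ℝ)) (θ + h * k)
  have h2 : θ + h * k - (θ + h * ((k + 1 : ℤ) : ℝ)) = -h := by push_cast; ring
  rw [h2, abs_neg, abs_of_nonneg hh] at h1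
  have h3 := chord_nonneg (θ + h * k)
  have h4 := chord_sq_eq_well θ h k
  have h5 := chord_sq_eq_well θ h (k + 1)
  have h6 : well θ h k ≤ 2 * well θ h (k + 1) + 2 * h ^ 2 := by
    rw [← h4, ← h5]
    nlinarith [sq_nonneg (chord (θ + h * ((k + 1 : ℤ) : ℝ)) - h)]
  have h7 := well_nonneg θ h k
  have h8 := well_nonneg θ h (k + 1)
  nlinarith [sq_nonneg (well θ h (k + 1) - h ^ 2), sq_nonneg h]

lemma zsum_well_sq_normSq_le {N : ℕ} {u : ℤ → ℂ} (hu : ∀ k : ℤ, (N : ℤ) ≤ |k| + 3 → u k = 0)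
    (α θ h : ℝ) : zsum N (fun k => well θ h k ^ 2 * Complex.normSq (u k)) ≤
      (1 + 2 * α ^ 2) * cenergy N α θ h u := by
  have key : ∀ ψ : ℤ → ℝ, SuppIn N ψ → zsum N (fun k => (well θ h k * ψ k) ^ 2) ≤
      (1 + 2 * α ^ 2) * energy N α θ h ψ := by
    intro ψ hψ
    have h1 := quartic_le_energy hψ α θ h
    have h2 : 0 ≤ α ^ 2 * zsum N (fun k => well θ h k * (ψ (k + 1) - ψ k) ^ 2) :=
      mul_nonneg (sq_nonneg _) (zsum_nonneg fun _ => mul_nonneg (well_nonneg ..) (sq_nonneg _))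
    linarith
  have e : zsum N (fun k => well θ h k ^ 2 * Complex.normSq (u k)) =
      zsum N (fun k => (well θ h k * (u k).re) ^ 2) +
      zsum N (fun k => (well θ h k * (u k).im) ^ 2) := by
    rw [← zsum_add]; congr 1; ext k; rw [Complex.normSq_apply]; ring
  rw [e, cenergy, mul_add]
  exact add_le_add (key _ (SuppIn.re hu)) (key _ (SuppIn.im hu))

lemma normSq_add_le (z w : ℂ) :
    Complex.normSq (z + w) ≤ 2 * Complex.normSq z + 2 * Complex.normSq w := by
  simp only [Complex.normSq_apply, Complex.add_re, Complex.add_im]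
  nlinarith [sq_nonneg (z.re - w.re), sq_nonneg (z.im - w.im)]

lemma normSq_ofReal_mul (a : ℝ) (z : ℂ) :
    Complex.normSq ((a : ℂ) * z) = a ^ 2 * Complex.normSq z := by
  rw [Complex.normSq_mul, Complex.normSq_ofReal, sq]

lemma exp_sub_one_sq_le {x b : ℝ} (hx : |x| ≤ b) (hb : b ≤ 1) :
    (Real.exp x - 1) ^ 2 ≤ 4 * b ^ 2 := by
  have h1 := Real.abs_exp_sub_one_le (hx.trans hb)
  have h2 : |Real.exp x - 1| ≤ 2 * b := by linarith
  rw [← sq_abs]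
  nlinarith [abs_nonneg (Real.exp x - 1)]

lemma normSq_conjugation_le {s : ℝ} (hs4 : 4 * s ≤ 1) {h : ℝ} (hs : 0 ≤ s) {θ : ℝ} {φ : ℤ → ℝ}
    (hφ : ∀ k, |φ (k + 1) - φ k| ≤ s * well θ h k) (α : ℝ) (e v : ℤ → ℂ) (k : ℤ) :
    Complex.normSq (cmathieu α θ h e (fun k => (Real.exp (φ k) : ℂ) * v k) k) ≤
      2 * (Real.exp (2 * φ k) * Complex.normSq (cmathieu α θ h e v k))
      + 16 * α ^ 4 * s ^ 2 * (well θ h k ^ 2 *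
          Complex.normSq ((Real.exp (φ (k + 1)) : ℂ) * v (k + 1))
        + well θ h (k - 1) ^ 2 * Complex.normSq ((Real.exp (φ (k - 1)) : ℂ) * v (k - 1))) := by
  have h1 : cmathieu α θ h e (fun k => (Real.exp (φ k) : ℂ) * v k) k =
      (Real.exp (φ k) : ℂ) * cmathieu α θ h e v k + ((α ^ 2 : ℝ) : ℂ) *
      (((Real.exp (φ k - φ (k + 1)) - 1 : ℝ) : ℂ) * ((Real.exp (φ (k + 1)) : ℂ) * v (k + 1))
      + ((Real.exp (φ k - φ (k - 1)) - 1 : ℝ) : ℂ) * ((Real.exp (φ (k - 1)) : ℂ) * v (k - 1))) := by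
    have e1 : (Real.exp (φ k) : ℂ) = Real.exp (φ k - φ (k + 1)) * Real.exp (φ (k + 1)) := by
      rw [← Complex.ofReal_mul, ← Real.exp_add, sub_add_cancel]
    have e2 : (Real.exp (φ k) : ℂ) = Real.exp (φ k - φ (k - 1)) * Real.exp (φ (k - 1)) := by
      rw [← Complex.ofReal_mul, ← Real.exp_add, sub_add_cancel]
    simp only [cmathieu, Complex.ofReal_sub (Real.exp _), Complex.ofReal_one, Complex.ofReal_pow]
    linear_combination (α : ℂ) ^ 2 * v (k + 1) * e1 + (α : ℂ) ^ 2 * v (k - 1) * e2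
  rw [h1]
  refine (normSq_add_le _ _).trans ?_
  have h0 : Real.exp (φ k) ^ 2 = Real.exp (2 * φ k) := by rw [← Real.exp_nat_mul]; norm_num
  rw [normSq_ofReal_mul, normSq_ofReal_mul, h0]
  have h2 := normSq_add_le (((Real.exp (φ k - φ (k + 1)) - 1 : ℝ) : ℂ) *
    ((Real.exp (φ (k + 1)) : ℂ) * v (k + 1)))
    (((Real.exp (φ k - φ (k - 1)) - 1 : ℝ) : ℂ) * ((Real.exp (φ (k - 1)) : ℂ) * v (k - 1)))
  rw [normSq_ofReal_mul (_ - 1), normSq_ofReal_mul (_ - 1)] at h2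
  set U := Complex.normSq ((Real.exp (φ (k + 1)) : ℂ) * v (k + 1)) with hU
  set V := Complex.normSq ((Real.exp (φ (k - 1)) : ℂ) * v (k - 1)) with hV
  have hU0 : 0 ≤ U := Complex.normSq_nonneg _
  have hV0 : 0 ≤ V := Complex.normSq_nonneg _
  have b1 : (Real.exp (φ k - φ (k + 1)) - 1) ^ 2 ≤ 4 * (s * well θ h k) ^ 2 := by
    apply exp_sub_one_sq_le
    · rw [abs_sub_comm]; exact hφ k
    · nlinarith [well_nonneg θ h k, well_le θ h k]
  have b2 : (Real.exp (φ k - φ (k - 1)) - 1) ^ 2 ≤ 4 * (s * well θ h (k - 1)) ^ 2 := by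
    apply exp_sub_one_sq_le
    · simpa using hφ (k - 1)
    · nlinarith [well_nonneg θ h (k - 1), well_le θ h (k - 1)]
  have b3 := mul_le_mul_of_nonneg_right b1 hU0
  have b4 := mul_le_mul_of_nonneg_right b2 hV0
  have b5 := mul_le_mul_of_nonneg_left (h2.trans (add_le_add
    (mul_le_mul_of_nonneg_left b3 zero_le_two) (mul_le_mul_of_nonneg_left b4 zero_le_two)))
    (by positivity : 0 ≤ 2 * (α ^ 2) ^ 2)
  linarith

/-- The resolvent estimate at slowly varying complex energies survives conjugation by weights whose
increments are dominated by a small multiple of the well. -/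
theorem exists_weighted_gap {α : ℝ} (hα : 0 < α) : ∃ s C h₀ : ℝ, 0 < s ∧ 0 < C ∧ 0 < h₀ ∧ h₀ ≤ 1 ∧
    ∀ (h θ ζ ch sh η : ℝ) (N : ℕ) (v : ℤ → ℂ) (φ : ℤ → ℝ), 0 < h → h < h₀ →
      SlowParams α h ch sh η → (∀ k : ℤ, (N : ℤ) ≤ |k| + 3 → v k = 0) →
      (∀ k, |φ (k + 1) - φ k| ≤ s * well θ h k) →
      h ^ 2 * zsum N (fun k => Real.exp (2 * φ k) * Complex.normSq (v k)) ≤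
        C * zsum N (fun k => Real.exp (2 * φ k) * Complex.normSq
          (cmathieu α θ h (slowEnergy (14 / 5 * (α * h)) ch sh ζ η) v k)) := by
  obtain ⟨C, h₀, hC, h₀p, h₀1, hgap⟩ := exists_cmathieu_gap hα
  set D := 16 * α ^ 4 * (9 * (1 + 2 * α ^ 2) + 8) with hD
  have hDp : 0 < D := by positivity
  set s := min (1 / 4) (1 / (2 * C * D)) with hs
  have hsp : 0 < s := by positivity
  have hs4 : 4 * s ≤ 1 := by linarith [min_le_left (1 / 4) (1 / (2 * C * D))]
  have hsD : s ^ 2 * (C * D) ≤ 1 / 2 := by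
    have h1 : s ≤ 1 / (2 * C * D) := min_le_right _ _
    rw [le_div_iff₀ (by positivity)] at h1
    have : 0 < s * (C * D) := by positivity
    nlinarith
  refine ⟨s, 4 * C, h₀, hsp, by positivity, h₀p, h₀1, ?_⟩
  intro h θ ζ ch sh η N v φ hh hlt hp hv hφ
  set e := slowEnergy (14 / 5 * (α * h)) ch sh ζ η
  set u : ℤ → ℂ := fun k => (Real.exp (φ k) : ℂ) * v k with hu
  have hus : ∀ k : ℤ, (N : ℤ) ≤ |k| + 3 → u k = 0 := fun k hk => by simp [hu, hv k hk]
  have g := hgap h θ ζ ch sh η N u hh hlt hp hus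
  have gm := sq_mul_le_cenergy N α θ h u
  have gw := zsum_well_sq_normSq_le hus α θ h
  have hsum : zsum N (fun k => Complex.normSq (u k)) =
      zsum N (fun k => Real.exp (2 * φ k) * Complex.normSq (v k)) := by
    congr 1; ext k
    rw [hu, normSq_ofReal_mul, ← Real.exp_nat_mul]
    norm_num
  have z1 : u (N + 1) = 0 := hus _ (by linarith [le_abs_self ((N : ℤ) + 1)])
  have z2 : u (-N) = 0 := hus _ (by linarith [neg_abs_le (-(N : ℤ))])
  have z3 : u N = 0 := hus _ (by linarith [le_abs_self (N : ℤ)])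
  have z4 : u (-N - 1) = 0 := hus _ (by linarith [neg_abs_le (-(N : ℤ) - 1)])
  have t1 : zsum N (fun k => well θ h (k - 1) ^ 2 * Complex.normSq (u (k - 1))) =
      zsum N (fun k => well θ h k ^ 2 * Complex.normSq (u k)) :=
    zsum_shift_neg (F := fun k => well θ h k ^ 2 * Complex.normSq (u k)) (by simp [z3])
      (by simp [z4])
  have t2 : zsum N (fun k => well θ h k ^ 2 * Complex.normSq (u (k + 1))) ≤
      8 * zsum N (fun k => well θ h k ^ 2 * Complex.normSq (u k))
        + 8 * h ^ 4 * zsum N (fun k => Complex.normSq (u k)) := by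
    rw [← zsum_shift (F := fun k => well θ h k ^ 2 * Complex.normSq (u k)) (by simp [z1])
      (by simp [z2]), ← zsum_shift (F := fun k => Complex.normSq (u k)) (by simp [z1])
      (by simp [z2])]
    simp only [← zsum_const_mul, ← zsum_add]
    refine zsum_mono fun k => ?_
    have := mul_le_mul_of_nonneg_right (well_sq_le_shift hh.le θ k)
      (Complex.normSq_nonneg (u (k + 1)))
    linarith
  have t3 : zsum N (fun k => Complex.normSq (cmathieu α θ h e u k)) ≤
      2 * zsum N (fun k => Real.exp (2 * φ k) * Complex.normSq (cmathieu α θ h e v k))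
      + 16 * α ^ 4 * s ^ 2 * (zsum N (fun k => well θ h k ^ 2 * Complex.normSq (u (k + 1)))
        + zsum N (fun k => well θ h (k - 1) ^ 2 * Complex.normSq (u (k - 1)))) := by
    simp only [← zsum_const_mul, ← zsum_add]
    exact zsum_mono (normSq_conjugation_le hs4 hsp.le hφ α e v)
  have hS : 0 ≤ cenergy N α θ h u := add_nonneg (energy_nonneg ..) (energy_nonneg ..)
  rw [t1] at t3
  have h1 : h ≤ 1 := by linarith
  have hm : 8 * h ^ 4 * zsum N (fun k => Complex.normSq (u k)) ≤ 8 * cenergy N α θ h u := by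
    have : h ^ 2 ≤ 1 := pow_le_one₀ hh.le h1
    nlinarith [mul_le_mul_of_nonneg_right this hS, mul_le_mul_of_nonneg_left gm (sq_nonneg h)]
  have t4 : zsum N (fun k => well θ h k ^ 2 * Complex.normSq (u (k + 1)))
        + zsum N (fun k => well θ h k ^ 2 * Complex.normSq (u k)) ≤
      (9 * (1 + 2 * α ^ 2) + 8) * cenergy N α θ h u := by linarith
  have t5 := mul_le_mul_of_nonneg_left t4 (by positivity : 0 ≤ 16 * α ^ 4 * s ^ 2)
  have t6 := mul_le_mul_of_nonneg_right hsD hS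
  have t7 := mul_le_mul_of_nonneg_left (t3.trans (add_le_add_right t5 _)) hC.le
  rw [hsum] at gm
  rw [hD] at t6
  linarith

/-- The solution of `u (m + 2) = c m * u (m + 1) - u m` with `u 0 = a` and `u 1 = b`. -/
def sol (c : ℕ → ℂ) (a b : ℂ) : ℕ → ℂ
  | 0 => a
  | 1 => b
  | (m + 2) => c m * sol c a b (m + 1) - sol c a b m

/-- The entries of the transfer matrix after `n` steps. -/
def tvec (c : ℕ → ℂ) (n : ℕ) : Fin 4 → ℂ :=
  ![sol c 1 0 n, sol c 1 0 (n + 1), sol c 0 1 n, sol c 0 1 (n + 1)]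

/-- The two-sided solution with `w 0 = 1` and `w 1 = 0`. -/
def bisol (c : ℤ → ℂ) : ℤ → ℂ
  | Int.ofNat m => sol (fun j => c (j + 1)) 1 0 m
  | Int.negSucc m => sol (fun j => c (-j)) 0 1 (m + 2)

lemma bisol_natCast (c : ℤ → ℂ) (m : ℕ) : bisol c m = sol (fun j => c (j + 1)) 1 0 m := rfl

lemma bisol_one_sub (c : ℤ → ℂ) : ∀ m : ℕ, bisol c (1 - m) = sol (fun j => c (-j)) 0 1 m
  | 0 => rfl
  | 1 => rfl
  | (m + 2) => by
    have : (1 - ((m + 2 : ℕ) : ℤ)) = Int.negSucc m := by rw [Int.negSucc_eq]; push_cast; ring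
    rw [this]; rfl

lemma bisol_rec (c : ℤ → ℂ) (k : ℤ) : bisol c (k + 1) + bisol c (k - 1) = c k * bisol c k := by
  rcases le_or_gt 1 k with hk | hk
  · obtain ⟨m, rfl⟩ : ∃ m : ℕ, k = m + 1 := ⟨(k - 1).toNat, by omega⟩
    have h1 := bisol_natCast c (m + 2)
    have h2 := bisol_natCast c (m + 1)
    have h3 := bisol_natCast c m
    push_cast at h1 h2
    rw [show (m : ℤ) + 1 + 1 = m + 2 by ring, show (m : ℤ) + 1 - 1 = m by ring, h1, h2, h3, sol]
    ring
  · obtain ⟨m, rfl⟩ : ∃ m : ℕ, k = -m := ⟨(-k).toNat, by omega⟩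
    have h1 := bisol_one_sub c (m + 2)
    have h2 := bisol_one_sub c (m + 1)
    have h3 := bisol_one_sub c m
    push_cast at h1 h2
    rw [show -(m : ℤ) + 1 = 1 - m by ring, show -(m : ℤ) - 1 = 1 - (m + 2) by ring,
      show -(m : ℤ) = 1 - (m + 1) by ring, h1, h2, h3, sol]
    rw [show (1 - ((m : ℤ) + 1)) = -m by ring]
    ring

/-- The coefficient of the three-term recursion solved by null vectors of `cmathieu`. -/
def hill (α θ h : ℝ) (e : ℤ → ℂ) (k : ℤ) : ℂ := 2 + ((well θ h k : ℂ) - e k) / α ^ 2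

lemma cmathieu_eq {α : ℝ} (hα : α ≠ 0) (θ h : ℝ) (e u : ℤ → ℂ) (k : ℤ) :
    cmathieu α θ h e u k = α ^ 2 * (hill α θ h e k * u k - u (k + 1) - u (k - 1)) := by
  have : (α : ℂ) ≠ 0 := by exact_mod_cast hα
  unfold cmathieu hill
  field_simp
  ring

lemma cmathieu_bisol_truncate {α : ℝ} (hα : α ≠ 0) (θ h : ℝ) (e : ℤ → ℂ) {n : ℕ} (hn : 1 ≤ n)
    (k : ℤ) : cmathieu α θ h e (fun j => if |j| ≤ n then bisol (hill α θ h e) j else 0) k =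
      (α ^ 2 : ℂ) * ((if k = n then bisol (hill α θ h e) (n + 1) else 0)
      - (if k = n + 1 then bisol (hill α θ h e) n else 0)
      + (if k = -n then bisol (hill α θ h e) (-n - 1) else 0)
      - (if k = -n - 1 then bisol (hill α θ h e) (-n) else 0)) := by
  rw [cmathieu_eq hα]
  congr 1
  have hr := bisol_rec (hill α θ h e)
  set w := bisol (hill α θ h e)
  by_cases h1 : k = n
  · subst h1
    have := hr n
    simp only [show |(n : ℤ)| ≤ n by simp, show ¬ |(n : ℤ) + 1| ≤ n by rw [abs_of_nonneg] <;> omega,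
      show |(n : ℤ) - 1| ≤ n by rw [abs_of_nonneg] <;> omega, show ¬ (n : ℤ) = n + 1 by omega,
      show ¬ (n : ℤ) = -n by omega, show ¬ (n : ℤ) = -n - 1 by omega, if_true, if_false]
    linear_combination -this
  by_cases h2 : k = n + 1
  · subst h2
    simp only [show |(n : ℤ) + 1 - 1| ≤ n by simp,
      show ¬ |(n : ℤ) + 1| ≤ n by rw [abs_of_nonneg] <;> omega,
      show ¬ |(n : ℤ) + 1 + 1| ≤ n by rw [abs_of_nonneg] <;> omega, show ¬ (n : ℤ) + 1 = n by omega,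
      show ¬ (n : ℤ) + 1 = -n by omega, show ¬ (n : ℤ) + 1 = -n - 1 by omega, if_true, if_false]
    rw [show (n : ℤ) + 1 - 1 = n by ring]
    ring
  by_cases h3 : k = -n
  · subst h3
    have := hr (-n)
    simp only [show |-(n : ℤ)| ≤ n by simp, show |-(n : ℤ) + 1| ≤ n by rw [abs_of_nonpos] <;> omega,
      show ¬ |-(n : ℤ) - 1| ≤ n by rw [abs_of_nonpos] <;> omega, show ¬ -(n : ℤ) = n + 1 by omega,
      show ¬ -(n : ℤ) = n by omega, show ¬ -(n : ℤ) = -n - 1 by omega, if_true, if_false]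
    linear_combination -this
  by_cases h4 : k = -n - 1
  · subst h4
    simp only [show |-(n : ℤ) - 1 + 1| ≤ n by simp,
      show ¬ |-(n : ℤ) - 1| ≤ n by rw [abs_of_nonpos] <;> omega,
      show ¬ |-(n : ℤ) - 1 - 1| ≤ n by rw [abs_of_nonpos] <;> omega,
      show ¬ -(n : ℤ) - 1 = n by omega,
      show ¬ -(n : ℤ) - 1 = n + 1 by omega, show ¬ -(n : ℤ) - 1 = -n by omega, if_true, if_false]
    rw [show -(n : ℤ) - 1 + 1 = -n by ring]
    ring
  simp only [h1, h2, h3, h4, if_false]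
  by_cases h5 : |k| ≤ n
  · have h6 := abs_le.1 h5
    rw [if_pos h5, if_pos (abs_le.2 ⟨by omega, by omega⟩), if_pos (abs_le.2 ⟨by omega, by omega⟩)]
    linear_combination -(hr k)
  · have h6 : (n : ℤ) < k ∨ k < -n := by
      by_contra! h; exact h5 (abs_le.2 ⟨h.2, h.1⟩)
    rw [if_neg h5, if_neg (fun h => by have := abs_le.1 h; omega),
      if_neg (fun h => by have := abs_le.1 h; omega)]
    ring

lemma sum_well_ge {h : ℝ} (hh : 0 < h) (h1 : h ≤ 1) (θ : ℝ) (n : ℕ) :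
    2 * n - 2 / Real.sin (h / 2) ≤ ∑ j ∈ Finset.range n, (2 - 2 * Real.cos (θ + h * j)) := by
  have hs : 0 < Real.sin (h / 2) := Real.sin_pos_of_pos_of_lt_pi (by linarith)
    (by linarith [Real.pi_gt_three])
  have ht : Real.sin (h / 2) * ∑ j ∈ Finset.range n, 2 * Real.cos (θ + h * j) ≤ 2 := by
    have := Finset.sum_range_sub (fun j : ℕ => Real.sin (θ + h * j - h / 2)) n
    rw [Finset.mul_sum]
    calc _ = ∑ j ∈ Finset.range n, (Real.sin (θ + h * ((j + 1 : ℕ) : ℝ) - h / 2)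
          - Real.sin (θ + h * j - h / 2)) := by
          refine Finset.sum_congr rfl fun j _ => ?_
          rw [show θ + h * ((j + 1 : ℕ) : ℝ) - h / 2 = (θ + h * j) + h / 2 by push_cast; ring,
            Real.sin_add, Real.sin_sub]
          ring
      _ ≤ 2 := by
          rw [this]
          linarith [Real.sin_le_one (θ + h * n - h / 2),
            Real.neg_one_le_sin (θ + h * ((0 : ℕ) : ℝ) - h / 2)]
  rw [Finset.sum_sub_distrib]
  have h3 : ∑ j ∈ Finset.range n, 2 * Real.cos (θ + h * j) ≤ 2 / Real.sin (h / 2) := by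
    rw [le_div_iff₀ hs]; linarith
  simp only [Finset.sum_const, Finset.card_range, nsmul_eq_mul]
  linarith

/-- A weight decaying away from the origin at a rate proportional to the well. -/
def agmon (s θ h : ℝ) : ℤ → ℝ
  | Int.ofNat m => -s * ∑ j ∈ Finset.range m, well θ h j
  | Int.negSucc m => -s * ∑ j ∈ Finset.range (m + 1), well θ h (-1 - j)

lemma agmon_neg (s θ h : ℝ) : ∀ m : ℕ, agmon s θ h (-m) =
    -s * ∑ j ∈ Finset.range m, well θ h (-1 - j)
  | 0 => by simp [agmon]
  | (m + 1) => by
    rw [show (-((m + 1 : ℕ) : ℤ)) = Int.negSucc m by rw [Int.negSucc_eq]; push_cast; ring]; rfl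

lemma agmon_natCast (s θ h : ℝ) (m : ℕ) : agmon s θ h m =
    -s * ∑ j ∈ Finset.range m, well θ h j := rfl

lemma abs_agmon_sub_le {s : ℝ} (hs : 0 ≤ s) (θ h : ℝ) (k : ℤ) :
    |agmon s θ h (k + 1) - agmon s θ h k| ≤ s * well θ h k := by
  rcases le_or_gt 0 k with hk | hk
  · obtain ⟨m, rfl⟩ : ∃ m : ℕ, k = m := ⟨k.toNat, by omega⟩
    have h1 := agmon_natCast s θ h (m + 1)
    push_cast at h1
    rw [h1, agmon_natCast, Finset.sum_range_succ,
      show ∀ a b : ℝ, -s * (a + b) - -s * a = -(s * b) by intros; ring, abs_neg,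
      abs_of_nonneg (mul_nonneg hs (well_nonneg ..))]
  · obtain ⟨m, rfl⟩ : ∃ m : ℕ, k = -(m + 1) := ⟨(-k - 1).toNat, by omega⟩
    have h1 := agmon_neg s θ h (m + 1)
    push_cast at h1
    rw [show -((m : ℤ) + 1) + 1 = -m by ring, agmon_neg, h1, Finset.sum_range_succ,
      show ∀ a b : ℝ, -s * a - -s * (a + b) = s * b by intros; ring,
      show -1 - (m : ℤ) = -(m + 1) by ring,
      abs_of_nonneg (mul_nonneg hs (well_nonneg ..))]

lemma agmon_natCast_le {s h : ℝ} (hs : 0 ≤ s) (hh : 0 < h) (h1 : h ≤ 1) (θ : ℝ) (m : ℕ) :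
    agmon s θ h m ≤ -s * (2 * m - 2 / Real.sin (h / 2)) := by
  have := mul_le_mul_of_nonneg_left (sum_well_ge hh h1 θ m) hs
  rw [agmon_natCast]
  have e : ∑ j ∈ Finset.range m, well θ h j = ∑ j ∈ Finset.range m, (2 - 2 * Real.cos (θ + h * j)) :=
    Finset.sum_congr rfl fun j _ => by simp [well]
  rw [e]
  linarith

lemma agmon_neg_le {s h : ℝ} (hs : 0 ≤ s) (hh : 0 < h) (h1 : h ≤ 1) (θ : ℝ) (m : ℕ) :
    agmon s θ h (-m) ≤ -s * (2 * m - 2 / Real.sin (h / 2)) := by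
  have := mul_le_mul_of_nonneg_left (sum_well_ge hh h1 (h - θ) m) hs
  rw [agmon_neg]
  have e : ∑ j ∈ Finset.range m, well θ h (-1 - j) =
      ∑ j ∈ Finset.range m, (2 - 2 * Real.cos (h - θ + h * j)) :=
    Finset.sum_congr rfl fun j _ => by
      rw [well, ← Real.cos_neg]; push_cast; ring_nf
  rw [e]
  linarith

lemma zsum_single_le (N : ℕ) (p : ℤ) {a : ℝ} (ha : 0 ≤ a) :
    zsum N (fun k => if k = p then a else 0) ≤ a := by
  unfold zsum
  rw [← Finset.sum_filter, Finset.sum_const, nsmul_eq_mul]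
  have : (Finset.filter (fun i : ℕ => (i : ℤ) - N = p) (Finset.range (2 * N + 1))).card ≤ 1 := by
    rw [Finset.card_le_one]
    intro a ha b hb
    simp only [Finset.mem_filter] at ha hb
    omega
  have h2 : ((Finset.filter (fun i : ℕ => (i : ℤ) - N = p) (Finset.range (2 * N + 1))).card : ℝ) ≤ 1 := by
    exact_mod_cast this
  nlinarith

lemma single_le_zsum {N : ℕ} {F : ℤ → ℝ} (hF : ∀ k, 0 ≤ F k) : F 0 ≤ zsum N F := by
  have := Finset.single_le_sum (f := fun i : ℕ => F ((i : ℤ) - N)) (s := Finset.range (2 * N + 1))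
    (fun i _ => hF _) (Finset.mem_range.2 (by omega : N < 2 * N + 1))
  simpa [zsum] using this

/-- Solutions at slowly varying complex energies grow exponentially, uniformly in the phases and at
a rate that does not depend on the frequency. -/
theorem exists_growth {α : ℝ} (hα : 0 < α) : ∃ s h₀ : ℝ, 0 < s ∧ 0 < h₀ ∧ h₀ ≤ 1 ∧
    ∀ h : ℝ, 0 < h → h < h₀ → ∃ c : ℝ, 0 < c ∧ ∀ (θ ζ ch sh η : ℝ) (n : ℕ),
      SlowParams α h ch sh η → 1 ≤ n →
      c * Real.exp (4 * s * n) ≤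
        ‖tvec (fun j => hill α θ h (slowEnergy (14 / 5 * (α * h)) ch sh ζ η) (j + 1)) n‖ ^ 2 +
        ‖tvec (fun j => hill α θ h (slowEnergy (14 / 5 * (α * h)) ch sh ζ η) (-j)) (n + 1)‖ ^ 2 := by
  obtain ⟨s, C, h₀, hs, hC, h₀p, h₀1, hgap⟩ := exists_weighted_gap hα
  refine ⟨s, h₀, hs, h₀p, h₀1, fun h hh hlt => ?_⟩
  set K := 2 / Real.sin (h / 2) with hK
  refine ⟨h ^ 2 / (2 * C * α ^ 4 * Real.exp (2 * s * K)), by positivity, ?_⟩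
  intro θ ζ ch sh η n hp hn
  set e := slowEnergy (14 / 5 * (α * h)) ch sh ζ η
  set w := bisol (hill α θ h e) with hw
  set v : ℤ → ℂ := fun j => if |j| ≤ n then w j else 0 with hv
  have hvs : ∀ k : ℤ, ((n + 4 : ℕ) : ℤ) ≤ |k| + 3 → v k = 0 := fun k hk => by
    simp only [hv]; rw [if_neg]; push_cast at hk; omega
  have g := hgap h θ ζ ch sh η (n + 4) v (agmon s θ h) hh hlt hp hvs (abs_agmon_sub_le hs.le θ h)
  have hlow : 1 ≤ zsum (n + 4) (fun k => Real.exp (2 * agmon s θ h k) * Complex.normSq (v k)) := by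
    have := single_le_zsum (N := n + 4)
      (F := fun k => Real.exp (2 * agmon s θ h k) * Complex.normSq (v k))
      (fun k => mul_nonneg (Real.exp_pos _).le (Complex.normSq_nonneg _))
    have h0 : w 0 = 1 := rfl
    have h1 : agmon s θ h 0 = 0 := by simpa using agmon_natCast s θ h 0
    simpa [hv, h0, h1] using this
  set Φ := Real.exp (2 * (-s * (2 * n - K))) with hΦ
  have hΦe : Φ * Real.exp (4 * s * n) = Real.exp (2 * s * K) := by
    rw [hΦ, ← Real.exp_add]; congr 1; ring
  have h1 : h ≤ 1 := by linarith
  have hup : ∀ k : ℤ, Real.exp (2 * agmon s θ h k) * Complex.normSq (cmathieu α θ h e v k) ≤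
      Φ * α ^ 4 * ((if k = n then Complex.normSq (w (n + 1)) else 0)
      + (if k = n + 1 then Complex.normSq (w n) else 0)
      + (if k = -n then Complex.normSq (w (-n - 1)) else 0)
      + (if k = -n - 1 then Complex.normSq (w (-n)) else 0)) := by
    intro k
    rw [hv, hw, cmathieu_bisol_truncate hα.ne' θ h e hn k, Complex.normSq_mul, ← Complex.ofReal_pow,
      Complex.normSq_ofReal]
    have b1 : agmon s θ h n ≤ -s * (2 * n - K) := agmon_natCast_le hs.le hh h1 θ n
    have b2 : agmon s θ h (n + 1) ≤ -s * (2 * n - K) := by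
      have := agmon_natCast_le hs.le hh h1 θ (n + 1)
      push_cast at this; linarith
    have b3 : agmon s θ h (-n) ≤ -s * (2 * n - K) := agmon_neg_le hs.le hh h1 θ n
    have b4 : agmon s θ h (-n - 1) ≤ -s * (2 * n - K) := by
      have := agmon_neg_le hs.le hh h1 θ (n + 1)
      push_cast at this; rw [neg_add, ← sub_eq_add_neg] at this; linarith
    have fin : ∀ x y : ℝ, 0 ≤ x → y ≤ -s * (2 * n - K) →
        Real.exp (2 * y) * (α ^ 2 * α ^ 2 * x) ≤ Φ * α ^ 4 * x := by
      intro x y hx hy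
      have : Real.exp (2 * y) ≤ Φ := Real.exp_le_exp.2 (by linarith)
      calc _ = Real.exp (2 * y) * (α ^ 4 * x) := by ring
        _ ≤ Φ * (α ^ 4 * x) := by gcongr
        _ = _ := by ring
    by_cases c1 : k = n
    · subst c1
      simpa [show ¬ (n : ℤ) = -n by omega, show ¬ (n : ℤ) = -n - 1 by omega] using
        fin _ _ (Complex.normSq_nonneg (bisol (hill α θ h e) (n + 1))) b1
    by_cases c2 : k = n + 1
    · subst c2
      simpa [show ¬ (n : ℤ) + 1 = -n by omega, show ¬ (n : ℤ) + 1 = -n - 1 by omega] using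
        fin _ _ (Complex.normSq_nonneg (bisol (hill α θ h e) n)) b2
    by_cases c3 : k = -n
    · subst c3
      simpa [show ¬ -(n : ℤ) = n by omega, show ¬ -(n : ℤ) = n + 1 by omega,
        show ¬ -(n : ℤ) = -n - 1 by omega] using
        fin _ _ (Complex.normSq_nonneg (bisol (hill α θ h e) (-n - 1))) b3
    by_cases c4 : k = -n - 1
    · subst c4
      simpa [show ¬ -(n : ℤ) - 1 = n by omega, show ¬ -(n : ℤ) - 1 = n + 1 by omega] using
        fin _ _ (Complex.normSq_nonneg (bisol (hill α θ h e) (-n))) b4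
    simp [c1, c2, c3, c4]
  have hsum := zsum_mono (N := n + 4) hup
  rw [zsum_const_mul, zsum_add, zsum_add, zsum_add] at hsum
  have z1 := zsum_single_le (n + 4) n (Complex.normSq_nonneg (w (n + 1)))
  have z2 := zsum_single_le (n + 4) (n + 1) (Complex.normSq_nonneg (w n))
  have z3 := zsum_single_le (n + 4) (-n) (Complex.normSq_nonneg (w (-n - 1)))
  have z4 := zsum_single_le (n + 4) (-n - 1) (Complex.normSq_nonneg (w (-n)))
  set P := tvec (fun j => hill α θ h e (j + 1)) n with hP
  set Q := tvec (fun j => hill α θ h e (-j)) (n + 1) with hQ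
  have sqb : ∀ (T : Fin 4 → ℂ) (i : Fin 4), Complex.normSq (T i) ≤ ‖T‖ ^ 2 := fun T i => by
    rw [Complex.normSq_eq_norm_sq]; gcongr; exact norm_le_pi_norm T i
  have t1 : Complex.normSq (w (n + 1)) ≤ ‖P‖ ^ 2 := sqb P 1
  have t2 : Complex.normSq (w n) ≤ ‖P‖ ^ 2 := sqb P 0
  have t3 : Complex.normSq (w (-n)) ≤ ‖Q‖ ^ 2 := by
    have := bisol_one_sub (hill α θ h e) (n + 1)
    rw [show 1 - ((n + 1 : ℕ) : ℤ) = -n by push_cast; ring] at this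
    rw [hw, this]; exact sqb Q 2
  have t4 : Complex.normSq (w (-n - 1)) ≤ ‖Q‖ ^ 2 := by
    have := bisol_one_sub (hill α θ h e) (n + 2)
    rw [show 1 - ((n + 2 : ℕ) : ℤ) = -n - 1 by push_cast; ring] at this
    rw [hw, this]; exact sqb Q 3
  rw [div_mul_eq_mul_div, div_le_iff₀ (by positivity), ← hΦe]
  have f1 : h ^ 2 ≤ C * (Φ * α ^ 4 * (2 * (‖P‖ ^ 2 + ‖Q‖ ^ 2))) := by
    calc h ^ 2 = h ^ 2 * 1 := by ring
      _ ≤ _ := mul_le_mul_of_nonneg_left hlow (sq_nonneg h)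
      _ ≤ _ := g
      _ ≤ _ := mul_le_mul_of_nonneg_left hsum hC.le
      _ ≤ _ := by gcongr; linarith
  calc h ^ 2 * Real.exp (4 * s * n) ≤ C * (Φ * α ^ 4 * (2 * (‖P‖ ^ 2 + ‖Q‖ ^ 2))) *
        Real.exp (4 * s * n) := by gcongr
    _ = _ := by ring

lemma log_norm_le_circleAverage {f : ℂ → ℂ} (hf : AnalyticOnNhd ℂ f (Metric.closedBall 0 1))
    (h0 : f 0 ≠ 0) : Real.log ‖f 0‖ ≤ Real.circleAverage (fun z => Real.log ‖f z‖) 0 1 := by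
  have hf' : AnalyticOnNhd ℂ f (Metric.closedBall 0 |1|) := by simpa using hf
  rw [AnalyticOnNhd.circleAverage_log_norm one_ne_zero hf' h0]
  refine le_add_of_nonneg_left (finsum_nonneg fun u => ?_)
  by_cases hu : u ∈ Metric.closedBall (0 : ℂ) |1|
  · refine mul_nonneg ?_ ?_
    · exact_mod_cast MeromorphicOn.AnalyticOnNhd.divisor_nonneg hf' u
    · have : ‖u‖ ≤ 1 := by simpa using hu
      rcases eq_or_ne u 0 with rfl | hu0
      · simp
      · refine Real.log_nonneg ?_
        rw [one_mul, zero_sub, norm_neg]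
        exact (one_le_inv₀ (norm_pos_iff.2 hu0)).2 this
  · rw [Function.locallyFinsuppWithin.apply_eq_zero_of_notMem _ hu]; simp

/-- The disc automorphism sending `0` to `ρ`. -/
def discShift (ρ : ℝ) (z : ℂ) : ℂ := (z + ρ) / (1 + ρ * z)

lemma one_add_mul_ne_zero {ρ : ℝ} (h0 : 0 ≤ ρ) (h1 : ρ < 1) {z : ℂ} (hz : ‖z‖ ≤ 1) :
    (1 + ρ * z : ℂ) ≠ 0 := by
  intro h
  have h2 : ‖(ρ * z : ℂ)‖ = 1 := by rw [show (ρ * z : ℂ) = -1 by linear_combination h]; simp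
  rw [norm_mul, Complex.norm_real, Real.norm_of_nonneg h0] at h2
  nlinarith [norm_nonneg z]

lemma norm_discShift {ρ : ℝ} (h0 : 0 ≤ ρ) (h1 : ρ < 1) {z : ℂ} (hz : ‖z‖ = 1) :
    ‖discShift ρ z‖ = 1 := by
  have hne := one_add_mul_ne_zero h0 h1 hz.le
  rw [discShift, norm_div, div_eq_one_iff_eq (norm_ne_zero_iff.2 hne)]
  have h2 : z.re ^ 2 + z.im ^ 2 = 1 := by
    have := Complex.sq_norm z; rw [hz, Complex.normSq_apply] at this; linarith
  rw [← sq_eq_sq₀ (norm_nonneg _) (norm_nonneg _), Complex.sq_norm, Complex.sq_norm,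
    Complex.normSq_apply, Complex.normSq_apply]
  simp
  linear_combination (1 - ρ ^ 2) * h2

/-- Circular means of `log ‖F‖` are monotone in the radius. -/
theorem integral_log_norm_le {ι : Type*} [Fintype ι] {F : ℂ → ι → ℂ} [Nonempty ι]
    (hF : ∀ i, Differentiable ℂ fun z => F z i) (h1 : ∀ z, ‖z‖ = 1 → 1 ≤ ‖F z‖) {ρ : ℝ} (hρ : 0 ≤ ρ)
    (hρ1 : ρ < 1) (hne : ∀ z, ‖z‖ = ρ → F z ≠ 0) :
    ∫ θ in 0..2 * Real.pi, Real.log ‖F (circleMap 0 ρ θ)‖ ≤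
      ∫ θ in 0..2 * Real.pi, Real.log ‖F (circleMap 0 1 θ)‖ := by
  have hcF : Continuous F := continuous_pi fun i => (hF i).continuous
  have hn : ∀ t, ‖circleMap 0 1 t‖ = 1 := fun t => by simp
  have hnm : ∀ θ t, ‖circleMap 0 1 θ * discShift ρ (circleMap 0 1 t)‖ = 1 := fun θ t => by
    rw [norm_mul, hn, norm_discShift hρ hρ1 (hn t), one_mul]
  have hcd : Continuous fun t => discShift ρ (circleMap 0 1 t) := by
    unfold discShift
    refine Continuous.div (by fun_prop) (by fun_prop) fun t => one_add_mul_ne_zero hρ hρ1 (hn t).le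
  have hcL : Continuous fun p : ℝ × ℝ =>
      Real.log ‖F (circleMap 0 1 p.1 * discShift ρ (circleMap 0 1 p.2))‖ := by
    refine Continuous.log ?_ fun p => by have := h1 _ (hnm p.1 p.2); positivity
    refine (hcF.comp (Continuous.mul ?_ ?_)).norm
    · exact (continuous_circleMap 0 1).comp continuous_fst
    · exact hcd.comp continuous_snd
  have hpt : ∀ θ, Real.log ‖F (circleMap 0 ρ θ)‖ ≤ (2 * Real.pi)⁻¹ * ∫ t in 0..2 * Real.pi,
      Real.log ‖F (circleMap 0 1 θ * discShift ρ (circleMap 0 1 t))‖ := by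
    intro θ
    obtain ⟨i, hi⟩ : ∃ i, ‖F (circleMap 0 ρ θ) i‖ = ‖F (circleMap 0 ρ θ)‖ := by
      obtain ⟨i, -, hi⟩ := Finset.exists_mem_eq_sup' (s := Finset.univ) Finset.univ_nonempty
        (fun i => ‖F (circleMap 0 ρ θ) i‖₊)
      refine ⟨i, ?_⟩
      rw [Pi.norm_def, ← Finset.sup'_eq_sup Finset.univ_nonempty, hi]; rfl
    set f : ℂ → ℂ := fun z => F (circleMap 0 1 θ * discShift ρ z) i with hf
    have hz0 : circleMap 0 1 θ * discShift ρ 0 = circleMap 0 ρ θ := by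
      simp [discShift, circleMap, mul_comm]
    have hf0 : f 0 = F (circleMap 0 ρ θ) i := by rw [hf]; simp only [hz0]
    have hfa : AnalyticOnNhd ℂ f (Metric.closedBall 0 1) := by
      intro z hz
      have hz1 : ‖z‖ ≤ 1 := by simpa using hz
      have a1 : AnalyticAt ℂ (fun z => circleMap 0 1 θ * discShift ρ z) z := by
        unfold discShift
        exact analyticAt_const.mul (AnalyticAt.div (by fun_prop) (by fun_prop)
          (one_add_mul_ne_zero hρ hρ1 hz1))
      exact ((hF i).analyticAt _).fun_comp a1
    have hnz : f 0 ≠ 0 := by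
      rw [hf0, ← norm_ne_zero_iff, hi, norm_ne_zero_iff]
      exact hne _ (by simp [abs_of_nonneg hρ])
    have hJ := log_norm_le_circleAverage hfa hnz
    rw [hf0, hi, Real.circleAverage_def, smul_eq_mul] at hJ
    refine hJ.trans (mul_le_mul_of_nonneg_left ?_ (by positivity))
    have hci : CircleIntegrable (fun z => Real.log ‖f z‖) 0 1 := by
      refine MeromorphicOn.circleIntegrable_log_norm fun z hz => (hfa z ?_).meromorphicAt
      simpa using Metric.sphere_subset_closedBall hz
    refine intervalIntegral.integral_mono (by positivity) hci
      ((hcL.comp (Continuous.prodMk_right θ)).intervalIntegrable _ _) fun t => ?_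
    have hb := h1 _ (hnm θ t)
    have hle : ‖f (circleMap 0 1 t)‖ ≤ ‖F (circleMap 0 1 θ * discShift ρ (circleMap 0 1 t))‖ :=
      norm_le_pi_norm (F (circleMap 0 1 θ * discShift ρ (circleMap 0 1 t))) i
    rcases eq_or_ne (f (circleMap 0 1 t)) 0 with h | h
    · simp only [h, norm_zero, Real.log_zero]; exact Real.log_nonneg hb
    · exact Real.log_le_log (norm_pos_iff.2 h) hle
  have hrot : ∀ t, ∫ θ in 0..2 * Real.pi,
      Real.log ‖F (circleMap 0 1 θ * discShift ρ (circleMap 0 1 t))‖ =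
      ∫ θ in 0..2 * Real.pi, Real.log ‖F (circleMap 0 1 θ)‖ := by
    intro t
    have hd := norm_discShift hρ hρ1 (hn t)
    set m := discShift ρ (circleMap 0 1 t)
    have hm : ∀ θ, circleMap 0 1 θ * m = circleMap 0 1 (θ + m.arg) := fun θ => by
      have := Complex.norm_mul_exp_arg_mul_I m
      rw [hd, Complex.ofReal_one, one_mul] at this
      conv_lhs => rw [← this]
      simp [circleMap, ← Complex.exp_add, add_mul]
    have e := Real.circleAverage_eq_integral_add (f := fun z => Real.log ‖F z‖) (c := 0) (R := 1) m.arg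
    rw [Real.circleAverage_def, smul_eq_mul, smul_eq_mul] at e
    simp only [hm]
    exact (mul_left_cancel₀ (by positivity) e).symm
  have hcρ : Continuous fun θ => Real.log ‖F (circleMap 0 ρ θ)‖ := by
    refine Continuous.log ((hcF.comp (continuous_circleMap 0 ρ)).norm) fun θ => ?_
    exact norm_ne_zero_iff.2 (hne _ (by simp [abs_of_nonneg hρ]))
  have hcI : Continuous fun θ => ∫ t in 0..2 * Real.pi,
      Real.log ‖F (circleMap 0 1 θ * discShift ρ (circleMap 0 1 t))‖ :=
    intervalIntegral.continuous_parametric_intervalIntegral_of_continuous' hcL _ _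
  calc _ ≤ ∫ θ in 0..2 * Real.pi, (2 * Real.pi)⁻¹ * ∫ t in 0..2 * Real.pi,
      Real.log ‖F (circleMap 0 1 θ * discShift ρ (circleMap 0 1 t))‖ :=
        intervalIntegral.integral_mono (by positivity) (hcρ.intervalIntegrable _ _)
          ((hcI.const_mul _).intervalIntegrable _ _) hpt
    _ = (2 * Real.pi)⁻¹ * ∫ t in 0..2 * Real.pi, ∫ θ in 0..2 * Real.pi,
      Real.log ‖F (circleMap 0 1 θ * discShift ρ (circleMap 0 1 t))‖ := by
        rw [intervalIntegral.integral_const_mul]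
        congr 1
        refine intervalIntegral_intervalIntegral_swap ?_
        exact (hcL.continuousOn.integrableOn_compact
          (isCompact_uIcc.prod isCompact_uIcc)).mono_set
            (Set.prod_mono Set.uIoc_subset_uIcc Set.uIoc_subset_uIcc)
    _ = _ := by
        simp only [hrot, intervalIntegral.integral_const, smul_eq_mul, sub_zero]
        field_simp

lemma sol_wronskian (c : ℕ → ℂ) (n : ℕ) :
    sol c 1 0 n * sol c 0 1 (n + 1) - sol c 1 0 (n + 1) * sol c 0 1 n = 1 := by
  induction n with
  | zero => simp [sol]
  | succ n ih => rw [sol, sol]; linear_combination ih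

lemma one_le_two_mul_norm_tvec_sq (c : ℕ → ℂ) (n : ℕ) : 1 ≤ 2 * ‖tvec c n‖ ^ 2 := by
  have h := sol_wronskian c n
  have b0 : ‖sol c 1 0 n‖ ≤ ‖tvec c n‖ := norm_le_pi_norm (tvec c n) 0
  have b1 : ‖sol c 1 0 (n + 1)‖ ≤ ‖tvec c n‖ := norm_le_pi_norm (tvec c n) 1
  have b2 : ‖sol c 0 1 n‖ ≤ ‖tvec c n‖ := norm_le_pi_norm (tvec c n) 2
  have b3 : ‖sol c 0 1 (n + 1)‖ ≤ ‖tvec c n‖ := norm_le_pi_norm (tvec c n) 3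
  calc (1 : ℝ) = ‖sol c 1 0 n * sol c 0 1 (n + 1) - sol c 1 0 (n + 1) * sol c 0 1 n‖ := by simp [h]
    _ ≤ ‖sol c 1 0 n‖ * ‖sol c 0 1 (n + 1)‖ + ‖sol c 1 0 (n + 1)‖ * ‖sol c 0 1 n‖ := by
      rw [← norm_mul, ← norm_mul]; exact norm_sub_le _ _
    _ ≤ ‖tvec c n‖ * ‖tvec c n‖ + ‖tvec c n‖ * ‖tvec c n‖ := by gcongr
    _ = _ := by ring

lemma norm_tvec_pos (c : ℕ → ℂ) (n : ℕ) : 0 < ‖tvec c n‖ := by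
  have := one_le_two_mul_norm_tvec_sq c n
  rcases (norm_nonneg (tvec c n)).eq_or_lt with h | h
  · rw [← h] at this; norm_num at this
  · exact h

lemma one_le_two_mul_norm_tvec (c : ℕ → ℂ) (n : ℕ) : 1 ≤ 2 * ‖tvec c n‖ := by
  nlinarith [one_le_two_mul_norm_tvec_sq c n, norm_tvec_pos c n]

/-- Polynomial normalization of the solution of a recursion with Laurent coefficients. -/
def laurentSol (A B B' : ℕ → ℂ) (a b : ℂ) : ℕ → ℂ → ℂ
  | 0, _ => a
  | 1, w => b * w
  | (m + 2), w => (A m * w + B m * w ^ 2 + B' m) * laurentSol A B B' a b (m + 1) w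
      - w ^ 2 * laurentSol A B B' a b m w

lemma laurentSol_eq (A B B' : ℕ → ℂ) (a b : ℂ) {w : ℂ} (hw : w ≠ 0) : ∀ n : ℕ,
    laurentSol A B B' a b n w = w ^ n * sol (fun m => A m + B m * w + B' m * w⁻¹) a b n ∧
    laurentSol A B B' a b (n + 1) w =
      w ^ (n + 1) * sol (fun m => A m + B m * w + B' m * w⁻¹) a b (n + 1)
  | 0 => by simp [laurentSol, sol, mul_comm]
  | (n + 1) => by
    obtain ⟨h1, h2⟩ := laurentSol_eq A B B' a b hw n
    refine ⟨h2, ?_⟩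
    rw [laurentSol, sol, h1, h2]
    field_simp
    ring

lemma differentiable_laurentSol (A B B' : ℕ → ℂ) (a b : ℂ) : ∀ n : ℕ,
    Differentiable ℂ (laurentSol A B B' a b n) ∧ Differentiable ℂ (laurentSol A B B' a b (n + 1))
  | 0 => by
    refine ⟨?_, ?_⟩
    · exact differentiable_const a
    · exact (differentiable_const b).mul differentiable_id
  | (n + 1) => by
    obtain ⟨h1, h2⟩ := differentiable_laurentSol A B B' a b n
    refine ⟨h2, ?_⟩
    change Differentiable ℂ (fun w => (A n * w + B n * w ^ 2 + B' n) *
      laurentSol A B B' a b (n + 1) w - w ^ 2 * laurentSol A B B' a b n w)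
    fun_prop

lemma integral_log_tvec_le (A B B' : ℕ → ℂ) (n : ℕ) {ρ : ℝ} (h0 : 0 < ρ) (h1 : ρ < 1) :
    ∫ θ in 0..2 * Real.pi, Real.log ‖tvec (fun m => A m + B m * circleMap 0 ρ θ
        + B' m * (circleMap 0 ρ θ)⁻¹) n‖ ≤
      (∫ θ in 0..2 * Real.pi, Real.log ‖tvec (fun m => A m + B m * circleMap 0 1 θ
        + B' m * (circleMap 0 1 θ)⁻¹) n‖) + 2 * Real.pi * ((n + 1) * Real.log (1 / ρ)) := by
  set F : ℂ → Fin 4 → ℂ := fun w => ![2 * w * laurentSol A B B' 1 0 n w,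
    2 * laurentSol A B B' 1 0 (n + 1) w, 2 * w * laurentSol A B B' 0 1 n w,
    2 * laurentSol A B B' 0 1 (n + 1) w] with hF
  have hd : ∀ i, Differentiable ℂ fun z => F z i := by
    have d1 := (differentiable_laurentSol A B B' 1 0 n).1
    have d2 := (differentiable_laurentSol A B B' 1 0 n).2
    have d3 := (differentiable_laurentSol A B B' 0 1 n).1
    have d4 := (differentiable_laurentSol A B B' 0 1 n).2
    intro i
    fin_cases i <;> simp only [hF] <;> simp <;> fun_prop
  have hFw : ∀ w : ℂ, w ≠ 0 → F w = (2 * w ^ (n + 1)) •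
      tvec (fun m => A m + B m * w + B' m * w⁻¹) n := fun w hw => by
    obtain ⟨a1, a2⟩ := laurentSol_eq A B B' 1 0 hw n
    obtain ⟨a3, a4⟩ := laurentSol_eq A B B' 0 1 hw n
    ext i
    fin_cases i <;> simp [hF, tvec, a1, a2, a3, a4] <;> ring
  have hnF : ∀ w : ℂ, w ≠ 0 → ‖F w‖ = 2 * ‖w‖ ^ (n + 1) *
      ‖tvec (fun m => A m + B m * w + B' m * w⁻¹) n‖ := fun w hw => by
    rw [hFw w hw, norm_smul]; simp
  have hne : ∀ z : ℂ, z ≠ 0 → F z ≠ 0 := fun z hz => by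
    have h := norm_tvec_pos (fun m => A m + B m * z + B' m * z⁻¹) n
    rw [← norm_ne_zero_iff, hnF z hz]
    have := norm_pos_iff.2 hz
    positivity
  have hint : ∀ r : ℝ, 0 < r →
      ∫ θ in 0..2 * Real.pi, Real.log ‖F (circleMap 0 r θ)‖ =
      2 * Real.pi * (Real.log 2 + (n + 1) * Real.log r) +
      ∫ θ in 0..2 * Real.pi, Real.log ‖tvec (fun m => A m + B m * circleMap 0 r θ
        + B' m * (circleMap 0 r θ)⁻¹) n‖ := by
    intro r hr
    have hz : ∀ θ, circleMap 0 r θ ≠ 0 := fun θ => by simp [hr.ne']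
    have e : ∀ θ, Real.log ‖tvec (fun m => A m + B m * circleMap 0 r θ
        + B' m * (circleMap 0 r θ)⁻¹) n‖ = Real.log ‖F (circleMap 0 r θ)‖ -
        (Real.log 2 + (n + 1) * Real.log r) := fun θ => by
      rw [hnF _ (hz θ), Real.log_mul _ (norm_tvec_pos _ _).ne',
        Real.log_mul two_ne_zero, Real.log_pow, norm_circleMap_zero, abs_of_pos hr]
      · push_cast; ring
      · have := norm_pos_iff.2 (hz θ); positivity
      · have := norm_pos_iff.2 (hz θ); positivity
    have hc : Continuous fun θ => Real.log ‖F (circleMap 0 r θ)‖ := by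
      have hcF : Continuous F := continuous_pi fun i => (hd i).continuous
      exact Continuous.log ((hcF.comp (continuous_circleMap 0 r)).norm)
        fun θ => norm_ne_zero_iff.2 (hne _ (hz θ))
    simp only [e]
    rw [intervalIntegral.integral_sub (hc.intervalIntegrable _ _)
      (continuous_const.intervalIntegrable _ _)]
    simp
    ring
  have hm := integral_log_norm_le hd (fun z hz => by
    have : z ≠ 0 := fun h => by simp [h] at hz
    rw [hnF z this, hz, one_pow, mul_one]
    exact one_le_two_mul_norm_tvec _ _) h0.le h1
    (fun z hz => hne z fun h => by simp [h] at hz; linarith)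
  rw [hint ρ h0, hint 1 one_pos] at hm
  rw [one_div, Real.log_inv]
  simp only [Real.log_one, mul_zero, add_zero] at hm
  linarith

lemma slowEnergy_eq {r : ℝ} (hr : 0 < r) (κ ζ η : ℝ) (k : ℤ) :
    slowEnergy (κ - 2 + (r + 1 / r)) ((r + 1 / r) / 2) ((1 / r - r) / 2) ζ η k =
      κ - 2 + Complex.exp ((η * k : ℝ) * Complex.I) * circleMap 0 r ζ
        + Complex.exp (-(η * k : ℝ) * Complex.I) * (circleMap 0 r ζ)⁻¹ := by
  have hr' : (r : ℂ) ≠ 0 := by exact_mod_cast hr.ne'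
  have e1 : Complex.exp ((η * k : ℝ) * Complex.I) * circleMap 0 r ζ =
      r * (Complex.cos ((ζ + η * k : ℝ)) + Complex.sin ((ζ + η * k : ℝ)) * Complex.I) := by
    rw [circleMap_zero, ← Complex.exp_mul_I, mul_left_comm, ← Complex.exp_add]
    congr 2; push_cast; ring
  have e2 : Complex.exp (-(η * k : ℝ) * Complex.I) * (circleMap 0 r ζ)⁻¹ =
      (r : ℂ)⁻¹ * (Complex.cos ((ζ + η * k : ℝ)) - Complex.sin ((ζ + η * k : ℝ)) * Complex.I) := by
    have : Complex.cos ((ζ + η * k : ℝ)) - Complex.sin ((ζ + η * k : ℝ)) * Complex.I =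
        Complex.exp (-((ζ + η * k : ℝ)) * Complex.I) := by
      rw [Complex.exp_mul_I, Complex.cos_neg, Complex.sin_neg]; ring
    rw [this, circleMap_zero, mul_inv, ← Complex.exp_neg, mul_left_comm, ← Complex.exp_add]
    congr 2; push_cast; ring
  rw [e1, e2, slowEnergy, Complex.mk_eq_add_mul_I]
  push_cast
  field_simp
  ring

lemma hill_slowEnergy_eq (α θ h : ℝ) {r : ℝ} (hr : 0 < r) (κ ζ η : ℝ) (k : ℤ) :
    hill α θ h (slowEnergy (κ - 2 + (r + 1 / r)) ((r + 1 / r) / 2) ((1 / r - r) / 2) ζ η) k =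
      (2 + (well θ h k - κ + 2) / α ^ 2)
        + -(Complex.exp ((η * k : ℝ) * Complex.I) / α ^ 2) * circleMap 0 r ζ
        + -(Complex.exp (-(η * k : ℝ) * Complex.I) / α ^ 2) * (circleMap 0 r ζ)⁻¹ := by
  rw [hill, slowEnergy_eq hr]
  ring

lemma hill_slowEnergy_one_eq (α θ h κ ζ η : ℝ) (k : ℤ) :
    hill α θ h (slowEnergy κ 1 0 ζ η) k =
      (2 + (well θ h k - κ + 2) / α ^ 2)
        + -(Complex.exp ((η * k : ℝ) * Complex.I) / α ^ 2) * circleMap 0 1 ζ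
        + -(Complex.exp (-(η * k : ℝ) * Complex.I) / α ^ 2) * (circleMap 0 1 ζ)⁻¹ := by
  have := hill_slowEnergy_eq α θ h one_pos κ ζ η k
  rw [← this]
  norm_num

lemma integral_log_tvec_hill_le (α θ h κ η : ℝ) (σ : ℕ → ℤ) (n : ℕ) {ρ : ℝ} (h0 : 0 < ρ)
    (h1 : ρ < 1) :
    ∫ ζ in 0..2 * Real.pi, Real.log ‖tvec (fun j => hill α θ h (slowEnergy (κ - 2 + (ρ + 1 / ρ))
        ((ρ + 1 / ρ) / 2) ((1 / ρ - ρ) / 2) ζ η) (σ j)) n‖ ≤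
      (∫ ζ in 0..2 * Real.pi, Real.log ‖tvec (fun j =>
        hill α θ h (slowEnergy κ 1 0 ζ η) (σ j)) n‖) +
        2 * Real.pi * ((n + 1) * Real.log (1 / ρ)) := by
  have := integral_log_tvec_le (fun j => 2 + ((well θ h (σ j) : ℂ) - κ + 2) / (α : ℂ) ^ 2)
    (fun j => -(Complex.exp ((η * (σ j) : ℝ) * Complex.I) / (α : ℂ) ^ 2))
    (fun j => -(Complex.exp (-(η * (σ j) : ℝ) * Complex.I) / (α : ℂ) ^ 2)) n h0 h1
  simpa only [hill_slowEnergy_eq _ _ _ h0, hill_slowEnergy_one_eq] using this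

lemma sol_congr_continuous {X : Type*} [TopologicalSpace X] {c : X → ℕ → ℂ}
    (hc : ∀ j, Continuous fun x => c x j) (a b : ℂ) : ∀ n : ℕ,
    (Continuous fun x => sol (c x) a b n) ∧ Continuous fun x => sol (c x) a b (n + 1)
  | 0 => ⟨continuous_const, continuous_const⟩
  | (n + 1) => by
    obtain ⟨h1, h2⟩ := sol_congr_continuous hc a b n
    exact ⟨h2, ((hc n).mul h2).sub h1⟩

lemma continuous_log_norm_tvec {X : Type*} [TopologicalSpace X] {c : X → ℕ → ℂ}
    (hc : ∀ j, Continuous fun x => c x j) (n : ℕ) :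
    Continuous fun x => Real.log ‖tvec (c x) n‖ := by
  refine Continuous.log (Continuous.norm (continuous_pi fun i => ?_))
    fun x => (norm_tvec_pos _ _).ne'
  have h1 := sol_congr_continuous hc 1 0 n
  have h2 := sol_congr_continuous hc 0 1 n
  fin_cases i
  · exact h1.1
  · exact h1.2
  · exact h2.1
  · exact h2.2

lemma continuous_hill_slowEnergy (α θ h G ch sh η : ℝ) (k : ℤ) :
    Continuous fun ζ => hill α θ h (slowEnergy G ch sh ζ η) k := by
  unfold hill slowEnergy
  simp only [Complex.mk_eq_add_mul_I]
  fun_prop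

lemma exists_slow_radius {α h s κ η : ℝ} (hα : 0 < α) (hh : 0 < h) (hs : 0 < s)
    (hg1 : α * h ≤ 1 / 10) (hg2 : α * h ≤ s / 8) (hg3 : α * h ≤ s ^ 2 / 80) (hκ : 0 ≤ κ)
    (hκ1 : κ ≤ 5 / 4 * (α * h)) (hη : 0 ≤ η) (hη1 : η ≤ h ^ 3) :
    ∃ ρ : ℝ, 0 < ρ ∧ ρ < 1 ∧ SlowParams α h ((ρ + 1 / ρ) / 2) ((1 / ρ - ρ) / 2) η ∧
      14 / 5 * (α * h) = κ - 2 + (ρ + 1 / ρ) ∧ Real.log (1 / ρ) ≤ s / 2 := by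
  have hg : 0 < α * h := mul_pos hα hh
  set g := α * h
  set x := (14 / 5 * g - κ) / 2 with hx
  have hx0 : 0 < x := by linarith
  have hx1 : x ≤ 7 / 5 * g := by linarith
  set t := √((1 + x) ^ 2 - 1) with ht
  have ht2 : t ^ 2 = (1 + x) ^ 2 - 1 := Real.sq_sqrt (by nlinarith)
  have ht0 : 0 < t := Real.sqrt_pos.2 (by nlinarith)
  have htx : t < 1 + x := by nlinarith
  have htx2 : x < t := by nlinarith
  have hinv : 1 / (1 + x - t) = 1 + x + t := by
    rw [div_eq_iff (by linarith)]; linarith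
  refine ⟨1 + x - t, by linarith, by linarith, ?_, ?_, ?_⟩
  · rw [hinv]
    refine ⟨hη, hη1, by linarith, by linarith, by linarith, ?_, ?_⟩
    · linarith
    · have e : (1 + x - t + (1 + x + t)) / 2 = 1 + x := by ring
      rw [e]
      nlinarith
  · rw [hinv]; linarith
  · rw [hinv]
    have h1 := Real.log_le_sub_one_of_pos (by linarith : 0 < 1 + x + t)
    have h2 : t ≤ s / 4 := by nlinarith
    linarith

/-- Averaged over the slow phase, the two-sided transfer matrices grow exponentially. -/
theorem exists_mean_growth {α : ℝ} (hα : 0 < α) : ∃ h₁ : ℝ, 0 < h₁ ∧ h₁ ≤ 1 ∧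
    ∀ h, 0 < h → h < h₁ → ∃ (γ : ℝ) (n₀ : ℕ), 0 < γ ∧ ∀ (κ η θ : ℝ) (n : ℕ), 0 ≤ κ →
      κ ≤ 5 / 4 * (α * h) → 0 ≤ η → η ≤ h ^ 3 → n₀ ≤ n →
      2 * Real.pi * (γ * n) ≤
        (∫ ζ in 0..2 * Real.pi, Real.log ‖tvec (fun j : ℕ =>
          hill α θ h (slowEnergy κ 1 0 ζ η) (j + 1)) n‖) +
        ∫ ζ in 0..2 * Real.pi, Real.log ‖tvec (fun j : ℕ =>
          hill α θ h (slowEnergy κ 1 0 ζ η) (-j)) (n + 1)‖ := by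
  obtain ⟨s, h₀, hs, h₀p, h₀1, hgrow⟩ := exists_growth hα
  set b := min (1 / 10) (min (s / 8) (s ^ 2 / 80)) with hb
  have hbp : 0 < b := by positivity
  refine ⟨min h₀ (b / α), by positivity, (min_le_left _ _).trans h₀1, fun h hh hlt => ?_⟩
  have hlt0 := hlt.trans_le (min_le_left _ _)
  have hg : α * h ≤ b := by
    have := (hlt.trans_le (min_le_right _ _)).le
    rwa [le_div_iff₀ hα, mul_comm] at this
  obtain ⟨c, hc, hgr⟩ := hgrow h hh hlt0
  obtain ⟨n₀, hn₀⟩ := exists_nat_gt ((3 * s / 2 - Real.log (c / 4) / 2) / (s / 2))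
  refine ⟨s / 2, n₀ + 1, by positivity, fun κ η θ n hκ hκ1 hη hη1 hn => ?_⟩
  obtain ⟨ρ, hρ, hρ1, hp, hG, hY⟩ := exists_slow_radius hα hh hs (hg.trans (min_le_left _ _))
    (hg.trans ((min_le_right _ _).trans (min_le_left _ _)))
    (hg.trans ((min_le_right _ _).trans (min_le_right _ _))) hκ hκ1 hη hη1
  have j1 := integral_log_tvec_hill_le α θ h κ η (fun j => (j : ℤ) + 1) n hρ hρ1
  have j2 := integral_log_tvec_hill_le α θ h κ η (fun j => -(j : ℤ)) (n + 1) hρ hρ1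
  rw [← hG] at j1 j2
  set ch := (ρ + 1 / ρ) / 2
  set sh := (1 / ρ - ρ) / 2
  set G := 14 / 5 * (α * h) with hGd
  have hlow : ∀ ζ, 2 * s * n + Real.log (c / 4) / 2 ≤
      Real.log ‖tvec (fun j : ℕ => hill α θ h (slowEnergy G ch sh ζ η) (j + 1)) n‖ +
      Real.log ‖tvec (fun j : ℕ => hill α θ h (slowEnergy G ch sh ζ η) (-j)) (n + 1)‖ := by
    intro ζ
    have g := hgr θ ζ ch sh η n hp (by omega)
    have p1 := norm_tvec_pos (fun j : ℕ => hill α θ h (slowEnergy G ch sh ζ η) (j + 1)) n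
    have p2 := norm_tvec_pos (fun j : ℕ => hill α θ h (slowEnergy G ch sh ζ η) (-j)) (n + 1)
    have q1 := one_le_two_mul_norm_tvec_sq
      (fun j : ℕ => hill α θ h (slowEnergy G ch sh ζ η) (j + 1)) n
    have q2 := one_le_two_mul_norm_tvec_sq
      (fun j : ℕ => hill α θ h (slowEnergy G ch sh ζ η) (-j)) (n + 1)
    set t1 := ‖tvec (fun j : ℕ => hill α θ h (slowEnergy G ch sh ζ η) (j + 1)) n‖
    set t2 := ‖tvec (fun j : ℕ => hill α θ h (slowEnergy G ch sh ζ η) (-j)) (n + 1)‖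
    have hprod : c / 4 * Real.exp (4 * s * n) ≤ (t1 * t2) ^ 2 := by
      rw [mul_pow]
      nlinarith [mul_nonneg (sub_nonneg.2 q1) (sub_nonneg.2 q2)]
    have hl := Real.log_le_log (by positivity) hprod
    rw [Real.log_mul (by positivity) (Real.exp_pos _).ne', Real.log_exp, Real.log_pow,
      Real.log_mul p1.ne' p2.ne'] at hl
    push_cast at hl
    linarith
  have c1 := continuous_log_norm_tvec (fun j : ℕ =>
    continuous_hill_slowEnergy α θ h G ch sh η ((j : ℤ) + 1)) n
  have c2 := continuous_log_norm_tvec (fun j : ℕ =>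
    continuous_hill_slowEnergy α θ h G ch sh η (-(j : ℤ))) (n + 1)
  have hI := intervalIntegral.integral_mono (μ := volume) (a := 0) (b := 2 * Real.pi) (by positivity)
    (continuous_const.intervalIntegrable _ _) ((c1.add c2).intervalIntegrable _ _) hlow
  rw [intervalIntegral.integral_const, smul_eq_mul, sub_zero,
    show ∀ f g : ℝ → ℝ, (∫ u in 0..2 * Real.pi, (f + g) u) = ∫ u in 0..2 * Real.pi, (f u + g u)
      from fun _ _ => rfl, intervalIntegral.integral_add (c1.intervalIntegrable _ _) (c2.intervalIntegrable _ _)] at hI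
  have hsum := hI.trans (add_le_add j1 j2)
  have hnn : (3 * s / 2 - Real.log (c / 4) / 2) ≤ n * (s / 2) := by
    rw [div_lt_iff₀ (by positivity)] at hn₀
    have : (n₀ : ℝ) ≤ n := by exact_mod_cast (by omega : n₀ ≤ n)
    nlinarith
  have hfin : s / 2 * n ≤ 2 * s * n + Real.log (c / 4) / 2 - ((n : ℝ) + 1) * Real.log (1 / ρ)
      - ((n : ℝ) + 1 + 1) * Real.log (1 / ρ) := by
    nlinarith [mul_le_mul_of_nonneg_left hY (by positivity : (0 : ℝ) ≤ 2 * n + 3)]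
  have := mul_le_mul_of_nonneg_left hfin (by positivity : 0 ≤ 2 * Real.pi)
  push_cast at hsum
  linarith

lemma exists_sol_ofReal (c : ℕ → ℝ) (a b : ℝ) : ∃ w : ℕ → ℝ, w 0 = a ∧ w 1 = b ∧
    (∀ m, w (m + 2) = c m * w (m + 1) - w m) ∧
    ∀ m, sol (fun j => (c j : ℂ)) a b m = (w m : ℂ) := by
  let w : ℕ → ℝ := fun m => (sol (fun j => (c j : ℂ)) a b m).re
  have key : ∀ m, sol (fun j => (c j : ℂ)) a b m = (w m : ℂ) ∧
      sol (fun j => (c j : ℂ)) a b (m + 1) = (w (m + 1) : ℂ) := by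
    intro m
    induction m with
    | zero => simp [w, sol]
    | succ m ih =>
      refine ⟨ih.2, ?_⟩
      have h : sol (fun j => (c j : ℂ)) a b (m + 2) = ((c m * w (m + 1) - w m : ℝ) : ℂ) := by
        rw [sol, ih.1, ih.2]; push_cast; ring
      change _ = (((sol (fun j => (c j : ℂ)) a b (m + 2)).re : ℝ) : ℂ)
      rw [show m + 1 + 1 = m + 2 from rfl, h, Complex.ofReal_re]
  refine ⟨w, by simp [w, sol], by simp [w, sol], fun m => ?_, fun m => (key m).1⟩
  have h : sol (fun j => (c j : ℂ)) a b (m + 2) = ((c m * w (m + 1) - w m : ℝ) : ℂ) := by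
    rw [sol, (key m).1, (key m).2]; push_cast; ring
  have := (key (m + 2)).1
  rw [h] at this
  exact_mod_cast this.symm

/-- A solution whose energy stays in `[M⁻¹, M]` controls every other solution. -/
lemma sq_le_of_comparison {c U w : ℕ → ℝ} {C M : ℝ} {n : ℕ} (hM : 1 ≤ M)
    (hc : ∀ j, |c j| ≤ C) (hU : ∀ m, U (m + 2) = c m * U (m + 1) - U m)
    (hw : ∀ m, w (m + 2) = c m * w (m + 1) - w m)
    (h0 : w 0 ^ 2 + w 1 ^ 2 = 1)
    (hlow : ∀ k ≤ n, 1 ≤ M * (U k ^ 2 + U (k + 1) ^ 2))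
    (hup : ∀ k ≤ n, U k ^ 2 + U (k + 1) ^ 2 ≤ M) :
    w n ^ 2 + w (n + 1) ^ 2 ≤ 2 * ((n + 1) * (2 + C)) ^ 2 * M ^ 10 := by
  have hC : 0 ≤ C := (abs_nonneg _).trans (hc 0)
  set A : ℕ → ℝ := fun k => U k ^ 2 + U (k + 1) ^ 2 with hA
  have hApos : ∀ k ≤ n, 0 < A k := fun k hk => by
    have := hlow k hk
    by_contra h
    have : M * A k ≤ 0 := mul_nonpos_of_nonneg_of_nonpos (by linarith) (not_lt.mp h)
    simp only [hA] at this
    linarith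
  set Wr : ℝ := U 0 * w 1 - U 1 * w 0 with hWr
  have hwr : ∀ k, U k * w (k + 1) - U (k + 1) * w k = Wr := by
    intro k
    induction k with
    | zero => rfl
    | succ k ih => rw [hU, hw]; linarith
  have hWr2 : Wr ^ 2 ≤ M := by
    have h1 : Wr ^ 2 + (U 0 * w 0 + U 1 * w 1) ^ 2 = A 0 * 1 := by
      rw [← h0]; simp only [hA, hWr]; ring
    have h2 := hup 0 (Nat.zero_le _)
    nlinarith [sq_nonneg (U 0 * w 0 + U 1 * w 1)]
  have hWrM : |Wr| ≤ M := abs_le_of_sq_le_sq (by nlinarith) (by linarith)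
  set a : ℕ → ℝ := fun k => (U k * w k + U (k + 1) * w (k + 1)) / A k with ha
  have ha0 : |a 0| ≤ M ^ 2 := by
    have h1 : (U 0 * w 0 + U 1 * w 1) ^ 2 ≤ A 0 := by
      have : Wr ^ 2 + (U 0 * w 0 + U 1 * w 1) ^ 2 = A 0 * 1 := by
        rw [← h0]; simp only [hA, hWr]; ring
      nlinarith [sq_nonneg Wr]
    have h2 := hApos 0 (Nat.zero_le _)
    have h3 := hlow 0 (Nat.zero_le _)
    have h4 : |U 0 * w 0 + U 1 * w 1| ≤ M :=
      abs_le_of_sq_le_sq (by nlinarith [hup 0 (Nat.zero_le _)]) (by linarith)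
    simp only [ha, zero_add]
    rw [abs_div, abs_of_pos h2, div_le_iff₀ h2]
    calc _ ≤ M * 1 := by linarith
      _ ≤ M * (M * A 0) := by gcongr
      _ = _ := by ring
  have hstep : ∀ k, k + 1 ≤ n → |a (k + 1) - a k| ≤ M ^ 4 * (2 + C) := by
    intro k hk
    have p0 := hApos k (by omega)
    have p1 := hApos (k + 1) hk
    have e : a (k + 1) - a k =
        Wr * (U k * U (k + 1) + U (k + 2) * (c k * U k + U (k + 1))) / (A k * A (k + 1)) := by
      rw [← hwr k]
      simp only [ha]
      rw [div_sub_div _ _ p1.ne' p0.ne', mul_comm (A (k + 1)) (A k), mul_comm (A (k + 1)),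
        show A k * A (k + 1) = A (k + 1) * A k from mul_comm _ _]
      congr 1
      simp only [hA, show k + 1 + 1 = k + 2 from rfl, hU, hw]
      ring
    have b : ∀ i j : ℕ, U i ^ 2 ≤ M → U j ^ 2 ≤ M → |U i * U j| ≤ M := fun i j hi hj => by
      rw [abs_le]; constructor <;> nlinarith [sq_nonneg (U i + U j), sq_nonneg (U i - U j)]
    have u0 : U k ^ 2 ≤ M := by nlinarith [hup k (by omega), sq_nonneg (U (k + 1))]
    have u1 : U (k + 1) ^ 2 ≤ M := by nlinarith [hup k (by omega), sq_nonneg (U k)]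
    have u2 : U (k + 2) ^ 2 ≤ M := by nlinarith [hup (k + 1) hk, sq_nonneg (U (k + 1))]
    have hnum : |U k * U (k + 1) + U (k + 2) * (c k * U k + U (k + 1))| ≤ M * (2 + C) := by
      calc _ = |U k * U (k + 1) + c k * (U (k + 2) * U k) + U (k + 2) * U (k + 1)| := by
            congr 1; ring
        _ ≤ |U k * U (k + 1)| + |c k| * |U (k + 2) * U k| + |U (k + 2) * U (k + 1)| := by
            rw [← abs_mul]; exact abs_add_three _ _ _
        _ ≤ M + C * M + M := by
            gcongr
            · exact b _ _ u0 u1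
            · exact hc k
            · exact b _ _ u2 u0
            · exact b _ _ u2 u1
        _ = _ := by ring
    rw [e, abs_div, abs_mul, abs_of_pos (mul_pos p0 p1), div_le_iff₀ (mul_pos p0 p1)]
    have h1 : 1 ≤ M ^ 2 * (A k * A (k + 1)) := by
      have := one_le_mul_of_one_le_of_one_le (hlow k (by omega)) (hlow (k + 1) hk)
      calc (1 : ℝ) ≤ _ := this
        _ = _ := by simp only [hA]; ring
    calc _ ≤ M * (M * (2 + C)) := by gcongr
      _ = M ^ 2 * (2 + C) * 1 := by ring
      _ ≤ M ^ 2 * (2 + C) * (M ^ 2 * (A k * A (k + 1))) := by gcongr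
      _ = _ := by ring
  have han : ∀ k ≤ n, |a k| ≤ (k + 1) * (M ^ 4 * (2 + C)) := by
    intro k
    induction k with
    | zero =>
      intro _
      have : M ^ 2 ≤ M ^ 4 := pow_le_pow_right₀ hM (by norm_num)
      have h4 : 0 ≤ M ^ 4 := by positivity
      norm_num
      nlinarith
    | succ k ih =>
      intro hk
      have h1 := ih (by omega)
      have h2 := hstep k hk
      have h3 : |a (k + 1)| ≤ |a k| + |a (k + 1) - a k| := by
        have := abs_add_le (a k) (a (k + 1) - a k)
        rwa [add_sub_cancel] at this
      push_cast
      linarith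
  have pn := hApos n le_rfl
  have hfin : w n ^ 2 + w (n + 1) ^ 2 = a n ^ 2 * A n + Wr ^ 2 / A n := by
    rw [← hwr n]
    simp only [ha]
    field_simp
    simp only [hA]
    ring
  have h1 : a n ^ 2 ≤ ((n + 1) * (M ^ 4 * (2 + C))) ^ 2 := by
    rw [← sq_abs]; gcongr; exact han n le_rfl
  have h2 : Wr ^ 2 / A n ≤ M ^ 2 := by
    rw [div_le_iff₀ pn]
    have := hlow n le_rfl
    calc Wr ^ 2 ≤ M * 1 := by linarith
      _ ≤ M * (M * A n) := by gcongr
      _ = _ := by ring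
  rw [hfin]
  have h3 : M ^ 2 ≤ ((n + 1) * (2 + C)) ^ 2 * M ^ 10 := by
    have : (1 : ℝ) ≤ (n + 1) * (2 + C) :=
      one_le_mul_of_one_le_of_one_le (by linarith [n.cast_nonneg (α := ℝ)]) (by linarith)
    calc M ^ 2 ≤ M ^ 10 := pow_le_pow_right₀ hM (by norm_num)
      _ = 1 * M ^ 10 := by ring
      _ ≤ _ := by gcongr; exact one_le_pow₀ this
  calc a n ^ 2 * A n + Wr ^ 2 / A n
      ≤ ((n + 1) * (M ^ 4 * (2 + C))) ^ 2 * M + M ^ 2 := by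
        gcongr; exact hup n le_rfl
    _ = ((n + 1) * (2 + C)) ^ 2 * M ^ 9 + M ^ 2 := by ring
    _ ≤ ((n + 1) * (2 + C)) ^ 2 * M ^ 10 + ((n + 1) * (2 + C)) ^ 2 * M ^ 10 := by
        gcongr
        norm_num
    _ = _ := by ring

lemma norm_tvec_le_of_comparison {c U : ℕ → ℝ} {C M : ℝ} {n : ℕ} (hM : 1 ≤ M)
    (hc : ∀ j, |c j| ≤ C) (hU : ∀ m, U (m + 2) = c m * U (m + 1) - U m)
    (hlow : ∀ k ≤ n, 1 ≤ M * (U k ^ 2 + U (k + 1) ^ 2))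
    (hup : ∀ k ≤ n, U k ^ 2 + U (k + 1) ^ 2 ≤ M) :
    ‖tvec (fun j => (c j : ℂ)) n‖ ≤ 2 * ((n + 1) * (2 + C)) * M ^ 5 := by
  have hC : 0 ≤ C := (abs_nonneg _).trans (hc 0)
  have key : ∀ a b : ℝ, a ^ 2 + b ^ 2 = 1 →
      ‖sol (fun j => (c j : ℂ)) a b n‖ ≤ 2 * ((n + 1) * (2 + C)) * M ^ 5 ∧
      ‖sol (fun j => (c j : ℂ)) a b (n + 1)‖ ≤ 2 * ((n + 1) * (2 + C)) * M ^ 5 := by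
    intro a b hab
    obtain ⟨w, w0, w1, hw, hs⟩ := exists_sol_ofReal c a b
    have h := sq_le_of_comparison hM hc hU hw (by rw [w0, w1, hab]) hlow hup
    have h2 : 2 * ((n + 1) * (2 + C)) ^ 2 * M ^ 10 ≤ (2 * ((n + 1) * (2 + C)) * M ^ 5) ^ 2 := by
      have : 0 ≤ ((n + 1) * (2 + C)) ^ 2 * M ^ 10 := by positivity
      calc _ = 2 * (((n + 1) * (2 + C)) ^ 2 * M ^ 10) := by ring
        _ ≤ 4 * (((n + 1) * (2 + C)) ^ 2 * M ^ 10) := by linarith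
        _ = _ := by ring
    rw [hs, hs, Complex.norm_real, Complex.norm_real, Real.norm_eq_abs, Real.norm_eq_abs]
    constructor <;> refine abs_le_of_sq_le_sq ?_ (by positivity)
    · nlinarith [sq_nonneg (w (n + 1))]
    · nlinarith [sq_nonneg (w n)]
  have k1 := key 1 0 (by norm_num)
  have k2 := key 0 1 (by norm_num)
  simp only [Complex.ofReal_one, Complex.ofReal_zero] at k1 k2
  refine (pi_norm_le_iff_of_nonneg (by positivity)).2 fun i => ?_
  fin_cases i
  exacts [k1.1, k1.2, k2.1, k2.2]

lemma norm_tvec_le_pow {c : ℕ → ℂ} {C : ℝ} (hc : ∀ j, ‖c j‖ ≤ C) (n : ℕ) :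
    ‖tvec c n‖ ≤ (C + 1) ^ n := by
  have hC : 0 ≤ C := (norm_nonneg _).trans (hc 0)
  have key : ∀ a b : ℂ, ‖a‖ ≤ 1 → ‖b‖ ≤ 1 → ∀ n,
      ‖sol c a b n‖ ≤ (C + 1) ^ n ∧ ‖sol c a b (n + 1)‖ ≤ (C + 1) ^ n := by
    intro a b ha hb n
    induction n with
    | zero => simpa [sol] using ⟨ha, hb⟩
    | succ n ih =>
      have hp : 0 ≤ (C + 1) ^ n := by positivity
      constructor
      · rw [pow_succ]; nlinarith
      · rw [sol, pow_succ]
        calc _ ≤ ‖c n‖ * ‖sol c a b (n + 1)‖ + ‖sol c a b n‖ := by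
              rw [← norm_mul]; exact norm_sub_le _ _
          _ ≤ C * (C + 1) ^ n + (C + 1) ^ n := by
              gcongr
              exacts [hc n, ih.2, ih.1]
          _ = _ := by ring
  have k1 := key 1 0 (by simp) (by simp) n
  have k2 := key 0 1 (by simp) (by simp) n
  refine (pi_norm_le_iff_of_nonneg (by positivity)).2 fun i => ?_
  fin_cases i
  exacts [k1.1, k1.2, k2.1, k2.2]

section Orbit
variable {X : Type*} [MeasurableSpace X] {μ : Measure X} {T : X → X}

/-- Along the orbit of a measure preserving map, a function with bounded increments is unlikely to
exceed `δ n` in the first `n` steps. -/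
lemma measure_large_orbit_le (hT : MeasurePreserving T μ μ) {L : X → ℝ} (hL : Measurable L)
    {C δ : ℝ} (hC : 0 < C) (hδ : 0 < δ) (hinc : ∀ᵐ x ∂μ, |L (T x) - L x| ≤ C) (n : ℕ) :
    μ {x | ∃ k ≤ n, δ * n < |L (T^[k] x)|} ≤
      ENNReal.ofReal (1 + 2 * C / δ) * μ {x | δ * n / 2 < |L x|} := by
  set S : Set X := {x | δ * n / 2 < |L x|} with hS
  have hSm : MeasurableSet S := measurableSet_lt measurable_const hL.abs
  set m : ℕ := ⌊δ * n / (2 * C)⌋₊ + 1 with hm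
  have hmC : ((m : ℝ) - 1) * C ≤ δ * n / 2 := by
    have : ((m : ℝ) - 1) ≤ δ * n / (2 * C) := by
      rw [hm]; push_cast; simpa using Nat.floor_le (by positivity : 0 ≤ δ * n / (2 * C))
    calc _ ≤ δ * n / (2 * C) * C := by gcongr
      _ = _ := by field_simp
  have hmn : ((n + m : ℕ) : ℝ) ≤ (1 + 2 * C / δ) * m := by
    have : δ * n / (2 * C) ≤ m := by rw [hm]; push_cast; exact (Nat.lt_floor_add_one _).le
    have h2 : (n : ℝ) ≤ 2 * C / δ * m := by
      calc (n : ℝ) = 2 * C / δ * (δ * n / (2 * C)) := by field_simp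
        _ ≤ _ := by gcongr
    push_cast; linarith
  have hae : ∀ᵐ x ∂μ, ∀ k, |L (T^[k + 1] x) - L (T^[k] x)| ≤ C := by
    rw [ae_all_iff]
    intro k
    have := (hT.iterate k).quasiMeasurePreserving.ae hinc
    filter_upwards [this] with x hx
    rwa [Function.iterate_succ_apply']
  set F : X → ENNReal := fun x => ∑ j ∈ Finset.range (n + m), S.indicator 1 (T^[j] x) with hF
  have hFm : Measurable F := Finset.measurable_fun_sum _ fun j _ =>
    (measurable_one.indicator hSm).comp (hT.iterate j).measurable
  have hFint : ∫⁻ x, F x ∂μ = (n + m : ℕ) * μ S := by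
    have hsum : ∫⁻ x, F x ∂μ =
        ∑ j ∈ Finset.range (n + m), ∫⁻ x, S.indicator 1 (T^[j] x) ∂μ :=
      lintegral_finsetSum _ fun j _ =>
        (measurable_one.indicator hSm).comp (hT.iterate j).measurable
    rw [hsum]
    have : ∀ j, ∫⁻ x, S.indicator 1 (T^[j] x) ∂μ = μ S := fun j => by
      rw [(hT.iterate j).lintegral_comp (measurable_one.indicator hSm), lintegral_indicator_one hSm]
    simp [this]
  have hsub : ∀ᵐ x ∂μ, x ∈ {x | ∃ k ≤ n, δ * n < |L (T^[k] x)|} → x ∈ {x | (m : ENNReal) ≤ F x} := by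
    filter_upwards [hae] with x hx
    rintro ⟨k, hk, hlt⟩
    have hrun : ∀ j, |L (T^[k + j] x) - L (T^[k] x)| ≤ j * C := by
      intro j
      induction j with
      | zero => simp
      | succ j ih =>
        have h1 := hx (k + j)
        have h2 := abs_sub_le (L (T^[k + (j + 1)] x)) (L (T^[k + j] x)) (L (T^[k] x))
        rw [← add_assoc] at h2 ⊢
        push_cast
        linarith
    have hin : ∀ j < m, T^[k + j] x ∈ S := by
      intro j hj
      have h1 := hrun j
      have h2 : (j : ℝ) * C ≤ δ * n / 2 := by
        refine le_trans ?_ hmC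
        gcongr
        have : (j : ℝ) + 1 ≤ m := by exact_mod_cast hj
        linarith
      have h3 := abs_sub_abs_le_abs_sub (L (T^[k] x)) (L (T^[k + j] x))
      rw [abs_sub_comm] at h3
      change δ * n / 2 < |L (T^[k + j] x)|
      linarith
    change (m : ENNReal) ≤ F x
    calc (m : ENNReal) = ∑ j ∈ Finset.range m, S.indicator 1 (T^[k + j] x) := by
          rw [Finset.sum_congr rfl fun j hj => by
            rw [Set.indicator_of_mem (hin j (Finset.mem_range.1 hj)), Pi.one_apply]]
          simp
      _ = ∑ j ∈ (Finset.range m).map (addLeftEmbedding k), S.indicator 1 (T^[j] x) := by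
          rw [Finset.sum_map]; rfl
      _ ≤ F x := by
          refine Finset.sum_le_sum_of_subset fun j hj => ?_
          simp only [Finset.mem_map, Finset.mem_range, addLeftEmbedding_apply] at hj ⊢
          omega
  have hmark : (m : ENNReal) * μ {x | ∃ k ≤ n, δ * n < |L (T^[k] x)|} ≤ (n + m : ℕ) * μ S := by
    rw [← hFint]
    refine le_trans ?_ (mul_meas_ge_le_lintegral hFm m)
    gcongr 1
    exact measure_mono_ae hsub
  have hm0 : (m : ENNReal) ≠ 0 := by simp [hm]
  have hmt : (m : ENNReal) ≠ ⊤ := ENNReal.natCast_ne_top m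
  rw [← ENNReal.mul_le_mul_iff_right hm0 hmt]
  refine hmark.trans ?_
  rw [← mul_assoc]
  gcongr 1
  rw [← ENNReal.ofReal_natCast, ← ENNReal.ofReal_natCast, ← ENNReal.ofReal_mul (by positivity)]
  exact ENNReal.ofReal_le_ofReal (by rw [mul_comm]; exact hmn)

lemma tendsto_measure_large_orbit [IsProbabilityMeasure μ] (hT : MeasurePreserving T μ μ) {L : X → ℝ} (hL : Measurable L)
    {C δ : ℝ} (hC : 0 < C) (hδ : 0 < δ) (hinc : ∀ᵐ x ∂μ, |L (T x) - L x| ≤ C) :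
    Tendsto (fun n : ℕ => μ.real {x | ∃ k ≤ n, δ * n < |L (T^[k] x)|}) atTop (nhds 0) := by
  have h1 : Tendsto (fun n : ℕ => μ {x | δ * n / 2 < |L x|}) atTop (nhds 0) := by
    have hanti : Antitone fun n : ℕ => {x | δ * n / 2 < |L x|} := by
      intro a b hab x hx
      have h2 : δ * a ≤ δ * b := by gcongr
      have h3 : δ * b / 2 < |L x| := hx
      change δ * a / 2 < |L x|
      linarith
    have := tendsto_measure_iInter_atTop (μ := μ)
      (fun n : ℕ => (measurableSet_lt (measurable_const (a := δ * n / 2)) hL.abs).nullMeasurableSet)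
      hanti ⟨0, measure_ne_top _ _⟩
    have hemp : ⋂ n : ℕ, {x | δ * n / 2 < |L x|} = ∅ := by
      rw [Set.eq_empty_iff_forall_notMem]
      intro x hx
      obtain ⟨n, hn⟩ := exists_nat_gt (|L x| / (δ / 2))
      have h2 := Set.mem_iInter.1 hx n
      rw [div_lt_iff₀ (by positivity)] at hn
      change δ * n / 2 < |L x| at h2
      linarith
    rw [hemp, measure_empty] at this
    exact this
  have h2 := ENNReal.Tendsto.const_mul (a := ENNReal.ofReal (1 + 2 * C / δ)) h1
    (Or.inr ENNReal.ofReal_ne_top)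
  rw [mul_zero] at h2
  have h3 := tendsto_of_tendsto_of_tendsto_of_le_of_le tendsto_const_nhds h2
    (fun _ => zero_le) (measure_large_orbit_le hT hL hC hδ hinc)
  exact (ENNReal.tendsto_toReal ENNReal.zero_ne_top).comp h3

/-- A nonvanishing square summable solution forces the transfer matrices to grow subexponentially
on average. -/
lemma integral_log_norm_tvec_le [IsProbabilityMeasure μ] (hT : MeasurePreserving T μ μ) {g c : X → ℝ} (hg : Measurable g)
    {C ε : ℝ} (hc : ∀ x, |c x| ≤ C) (hε : 0 < ε)
    (hrec : ∀ᵐ x ∂μ, g (T (T x)) = c (T x) * g (T x) - g x)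
    (hpos : ∀ᵐ x ∂μ, 0 < g x ^ 2 + g (T x) ^ 2) :
    ∀ᶠ n : ℕ in atTop,
      ∫ x, Real.log ‖tvec (fun j => ((c (T^[j + 1] x) : ℝ) : ℂ)) n‖ ∂μ ≤ ε * n := by
  obtain ⟨x₀⟩ : Nonempty X := μ.nonempty_of_neZero
  have hC : 0 ≤ C := (abs_nonneg _).trans (hc x₀)
  set A : X → ℝ := fun x => g x ^ 2 + g (T x) ^ 2 with hA
  have hAm : Measurable A := (hg.pow_const 2).add ((hg.comp hT.measurable).pow_const 2)
  set K : ℝ := 2 * C ^ 2 + 4 with hK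
  have hK1 : 1 < K := by nlinarith
  have hinc : ∀ᵐ x ∂μ, |Real.log (A (T x)) - Real.log (A x)| ≤ Real.log K := by
    filter_upwards [hrec, hpos, hT.quasiMeasurePreserving.ae hpos] with x h1 h2 h3
    have hcx : c (T x) ^ 2 ≤ C ^ 2 := sq_le_sq' (abs_le.1 (hc _)).1 (abs_le.1 (hc _)).2
    have e1 : A (T x) ≤ K * A x := by
      simp only [hA, h1, hK]
      nlinarith [sq_nonneg (c (T x) * g (T x) + g x), sq_nonneg (g x), sq_nonneg (g (T x)),
        mul_nonneg (sub_nonneg.2 hcx) (sq_nonneg (g (T x))), mul_nonneg (sq_nonneg C) (sq_nonneg (g x))]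
    have e2 : A x ≤ K * A (T x) := by
      have h4 : g x = c (T x) * g (T x) - g (T (T x)) := by linarith
      have : g x ^ 2 ≤ 2 * C ^ 2 * g (T x) ^ 2 + 2 * g (T (T x)) ^ 2 := by
        rw [h4]
        nlinarith [sq_nonneg (c (T x) * g (T x) + g (T (T x))),
          mul_nonneg (sub_nonneg.2 hcx) (sq_nonneg (g (T x)))]
      simp only [hA, hK]
      nlinarith [sq_nonneg (g (T x)), sq_nonneg (g (T (T x))),
        mul_nonneg (sq_nonneg C) (sq_nonneg (g (T (T x))))]
    rw [abs_le]
    have p : 0 < K := by linarith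
    constructor
    · have := Real.log_le_log h2 e2
      rw [Real.log_mul p.ne' (ne_of_gt h3)] at this
      linarith
    · have := Real.log_le_log h3 e1
      rw [Real.log_mul p.ne' (ne_of_gt h2)] at this
      linarith
  set δ : ℝ := ε / 20 with hδ
  have hδ0 : 0 < δ := by positivity
  have hbad := tendsto_measure_large_orbit hT hAm.log (Real.log_pos hK1) hδ0 hinc
  have hae : ∀ᵐ x ∂μ, ∀ k, g (T^[k + 2] x) = c (T^[k + 1] x) * g (T^[k + 1] x) - g (T^[k] x) ∧
      0 < A (T^[k] x) := by
    rw [ae_all_iff]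
    intro k
    filter_upwards [(hT.iterate k).quasiMeasurePreserving.ae hrec,
      (hT.iterate k).quasiMeasurePreserving.ae hpos] with x h1 h2
    refine ⟨?_, h2⟩
    simpa only [Function.iterate_succ_apply', Function.iterate_succ_apply'] using h1
  have hlogn : ∀ᶠ n : ℕ in atTop, Real.log (2 * ((n + 1) * (2 + C))) ≤ ε / 4 * n := by
    have h1 : Tendsto (fun n : ℕ => (2 * ((n + 1) * (2 + C))) * Real.exp (-(ε / 4) * n))
        atTop (nhds 0) := by
      have a := (tendsto_pow_const_mul_const_pow_of_abs_lt_one 1 (r := Real.exp (-(ε / 4)))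
        (by rw [Real.abs_exp, Real.exp_lt_one_iff]; linarith)).const_mul (2 * (2 + C))
      have b := (tendsto_pow_const_mul_const_pow_of_abs_lt_one 0 (r := Real.exp (-(ε / 4)))
        (by rw [Real.abs_exp, Real.exp_lt_one_iff]; linarith)).const_mul (2 * (2 + C))
      have := a.add b
      simp only [mul_zero, add_zero] at this
      refine this.congr fun n => ?_
      rw [mul_comm (-(ε / 4)), Real.exp_nat_mul]
      ring
    filter_upwards [h1.eventually (gt_mem_nhds one_pos)] with n hn
    rw [Real.log_le_iff_le_exp (by positivity)]
    rw [neg_mul, Real.exp_neg, ← div_eq_mul_inv, div_lt_one (Real.exp_pos _)] at hn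
    exact hn.le
  have hlogK : 0 ≤ Real.log (C + 1) := Real.log_nonneg (by linarith)
  filter_upwards [hlogn, hbad.eventually (gt_mem_nhds
    (show 0 < ε / 4 / (Real.log (C + 1) + 1) by positivity))] with n hn1 hn2
  by_cases hint : Integrable (fun x => Real.log ‖tvec (fun j => ((c (T^[j + 1] x) : ℝ) : ℂ)) n‖) μ
  swap
  · rw [integral_undef hint]; positivity
  set B : Set X := {x | ∃ k ≤ n, δ * n < |Real.log (A (T^[k] x))|} with hB
  have hBm : MeasurableSet B := by
    have : B = ⋃ k, ⋃ (_ : k ≤ n), {x | δ * n < |Real.log (A (T^[k] x))|} := by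
      ext x; simp [hB]
    rw [this]
    exact .iUnion fun k => .iUnion fun _ => measurableSet_lt measurable_const
      ((hAm.log.comp (hT.iterate k).measurable).abs)
  have hle : ∀ᵐ x ∂μ, Real.log ‖tvec (fun j => ((c (T^[j + 1] x) : ℝ) : ℂ)) n‖ ≤
      ε / 2 * n + B.indicator (fun _ => n * Real.log (C + 1)) x := by
    filter_upwards [hae] with x hx
    by_cases hxB : x ∈ B
    · rw [Set.indicator_of_mem hxB, ← Real.log_pow]
      have h1 := norm_tvec_le_pow (c := fun j => ((c (T^[j + 1] x) : ℝ) : ℂ)) (C := C)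
        (fun j => by simpa using hc _) n
      have h2 := Real.log_le_log (norm_tvec_pos _ n) h1
      have : 0 ≤ ε / 2 * n := by positivity
      linarith
    · rw [Set.indicator_of_notMem hxB, add_zero]
      have hk : ∀ k ≤ n, |Real.log (A (T^[k] x))| ≤ δ * n := fun k hk => by
        by_contra h
        exact hxB ⟨k, hk, not_le.1 h⟩
      have h1 := norm_tvec_le_of_comparison (c := fun j => c (T^[j + 1] x))
        (U := fun k => g (T^[k] x)) (C := C) (M := Real.exp (δ * n)) (n := n)
        (Real.one_le_exp (by positivity)) (fun j => hc _) (fun m => (hx m).1)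
        (fun k hkn => by
          have h2 := (abs_le.1 (hk k hkn)).1
          rw [Real.le_log_iff_exp_le (hx k).2, Real.exp_neg] at h2
          rw [Function.iterate_succ_apply']
          rwa [inv_le_iff_one_le_mul₀' (Real.exp_pos _)] at h2)
        (fun k hkn => by
          have h2 := (abs_le.1 (hk k hkn)).2
          rw [Real.log_le_iff_le_exp (hx k).2] at h2
          rwa [Function.iterate_succ_apply'])
      have h2 := Real.log_le_log (norm_tvec_pos _ n) h1
      rw [Real.log_mul (by positivity) (by positivity), ← Real.exp_nat_mul, Real.log_exp] at h2
      push_cast at h2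
      rw [hδ] at h2
      linarith
  have hi2 : Integrable (fun x => B.indicator (fun _ => n * Real.log (C + 1)) x) μ :=
    (integrable_const _).indicator hBm
  refine (integral_mono_ae hint ((integrable_const _).add hi2) hle).trans ?_
  simp only [Pi.add_apply]
  rw [integral_add (integrable_const _) hi2, integral_const, integral_indicator_const _ hBm]
  simp only [probReal_univ, smul_eq_mul, one_mul]
  have h5 : μ.real B * (Real.log (C + 1) + 1) ≤ ε / 4 := by
    rw [lt_div_iff₀ (by positivity)] at hn2
    exact hn2.le
  have h6 : 0 ≤ μ.real B := measureReal_nonneg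
  have : μ.real B * (n * Real.log (C + 1)) ≤ ε / 4 * n := by
    calc _ = (μ.real B * Real.log (C + 1)) * n := by ring
      _ ≤ _ := by gcongr; linarith
  have h7 : 0 ≤ ε * n := by positivity
  linarith

end Orbit

section Torus
open UnitAddTorus

/-- The circle carries its normalised Haar measure. -/
local instance circleMeasureSpace : MeasureSpace UnitAddCircle := ⟨AddCircle.haarAddCircle⟩

local instance circle_isAddHaarMeasure : Measure.IsAddHaarMeasure (volume : Measure UnitAddCircle) :=
  inferInstanceAs (Measure.IsAddHaarMeasure AddCircle.haarAddCircle)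

local instance circle_isProbabilityMeasure : IsProbabilityMeasure (volume : Measure UnitAddCircle) :=
  inferInstanceAs (IsProbabilityMeasure AddCircle.haarAddCircle)

variable {d : Type*} [Fintype d]

lemma mFourier_apply_add (n : d → ℤ) (x y : UnitAddTorus d) :
    mFourier n (x + y) = mFourier n x * mFourier n y := by
  simp only [mFourier, ContinuousMap.coe_mk, ← Finset.prod_mul_distrib]
  refine Finset.prod_congr rfl fun i _ => ?_
  simp [fourier_apply, smul_add, AddCircle.toCircle_add]

lemma mFourier_neg_apply_eq (n : d → ℤ) (x : UnitAddTorus d) :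
    mFourier n (-x) = mFourier (-n) x := by
  simp only [mFourier, ContinuousMap.coe_mk]
  refine Finset.prod_congr rfl fun i _ => ?_
  simp [fourier_apply]

lemma mFourierCoeff_comp_add (f : UnitAddTorus d → ℂ) (w : UnitAddTorus d) (n : d → ℤ) :
    mFourierCoeff (fun x => f (x + w)) n = mFourier n w * mFourierCoeff f n := by
  have h := integral_add_right_eq_self (μ := (volume : Measure (UnitAddTorus d)))
    (fun x => mFourier (-n) (x - w) • f x) w
  simp only [add_sub_cancel_right] at h
  rw [mFourierCoeff, mFourierCoeff, h, ← integral_const_mul]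
  congr 1 with x
  rw [sub_eq_add_neg, mFourier_apply_add, mFourier_neg_apply_eq, neg_neg, smul_eq_mul, smul_eq_mul]
  ring

lemma mFourierCoeff_mFourier_mul (f : UnitAddTorus d → ℂ) (m n : d → ℤ) :
    mFourierCoeff (fun x => mFourier m x * f x) n = mFourierCoeff f (n - m) := by
  rw [mFourierCoeff, mFourierCoeff]
  congr 1 with x
  rw [neg_sub, sub_eq_add_neg, mFourier_add, smul_eq_mul, smul_eq_mul]
  ring

lemma integrable_mFourier_mul {f : UnitAddTorus d → ℂ} (hf : Integrable f) (n : d → ℤ) :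
    Integrable fun x => mFourier n x * f x :=
  hf.bdd_mul (c := 1) (mFourier n).continuous.aestronglyMeasurable
    (Eventually.of_forall fun x => ((mFourier n).norm_coe_le_norm x).trans mFourier_norm.le)

lemma mFourierCoeff_add {f g : UnitAddTorus d → ℂ} (hf : Integrable f) (hg : Integrable g)
    (n : d → ℤ) :
    mFourierCoeff (fun x => f x + g x) n = mFourierCoeff f n + mFourierCoeff g n := by
  simp only [mFourierCoeff, smul_eq_mul, mul_add]
  exact integral_add (integrable_mFourier_mul hf _) (integrable_mFourier_mul hg _)

lemma mFourierCoeff_sub {f g : UnitAddTorus d → ℂ} (hf : Integrable f) (hg : Integrable g)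
    (n : d → ℤ) :
    mFourierCoeff (fun x => f x - g x) n = mFourierCoeff f n - mFourierCoeff g n := by
  simp only [mFourierCoeff, smul_eq_mul, mul_sub]
  exact integral_sub (integrable_mFourier_mul hf _) (integrable_mFourier_mul hg _)

lemma mFourierCoeff_const_mul (f : UnitAddTorus d → ℂ) (a : ℂ) (n : d → ℤ) :
    mFourierCoeff (fun x => a * f x) n = a * mFourierCoeff f n := by
  simp only [mFourierCoeff, smul_eq_mul, mul_left_comm _ a]
  exact integral_const_mul _ _

lemma ae_eq_zero_of_mFourierCoeff {f : UnitAddTorus d → ℂ} (hf : MemLp f 2)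
    (h : ∀ n, mFourierCoeff f n = 0) : f =ᵐ[volume] 0 := by
  have h0 : hf.toLp f = 0 := by
    apply mFourierBasis.repr.injective
    ext n
    rw [mFourierBasis_repr, map_zero]
    have : mFourierCoeff (hf.toLp f) n = mFourierCoeff f n := by
      refine integral_congr_ae ?_
      filter_upwards [hf.coeFn_toLp] with x hx
      rw [hx]
    rw [this, h n]; rfl
  have h1 := hf.coeFn_toLp
  rw [h0] at h1
  exact h1.symm.trans (Lp.coeFn_zero _ _ _)

/-- Ergodicity of a translation of the torus without resonances. -/
lemma measure_eq_zero_or_of_translation {w : UnitAddTorus d}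
    (hw : ∀ n : d → ℤ, n ≠ 0 → mFourier n w ≠ 1) {S : Set (UnitAddTorus d)}
    (hS : MeasurableSet S) (hinv : ∀ᵐ x : UnitAddTorus d, x + w ∈ S ↔ x ∈ S) :
    volume S = 0 ∨ volume Sᶜ = 0 := by
  classical
  set f : UnitAddTorus d → ℂ := S.indicator 1 with hf
  have hfm : MemLp f 2 := (memLp_const (1 : ℂ)).indicator hS
  set a : ℂ := mFourierCoeff f 0
  have hcoef : ∀ n, n ≠ 0 → mFourierCoeff f n = 0 := by
    intro n hn
    have h1 := mFourierCoeff_comp_add f w n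
    have h2 : mFourierCoeff (fun x => f (x + w)) n = mFourierCoeff f n := by
      refine integral_congr_ae ?_
      filter_upwards [hinv] with x hx
      simp only [hf, Set.indicator_apply, hx, Pi.one_apply]
    rw [h2] at h1
    have h3 : (mFourier n w - 1) * mFourierCoeff f n = 0 := by linear_combination -h1
    exact (mul_eq_zero.1 h3).resolve_left (sub_ne_zero.2 (hw n hn))
  have hone : ∀ n : d → ℤ, ∫ x : UnitAddTorus d, mFourier (-n) x = if n = 0 then 1 else 0 := by
    intro n
    split_ifs with hn
    · simp [hn, mFourier_zero]
    · have h := integral_add_right_eq_self (μ := (volume : Measure (UnitAddTorus d)))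
        (fun x => mFourier (-n) x) w
      simp only [mFourier_apply_add, integral_mul_const] at h
      have h3 : (mFourier (-n) w - 1) * ∫ x : UnitAddTorus d, mFourier (-n) x = 0 := by
        linear_combination h
      exact (mul_eq_zero.1 h3).resolve_left (sub_ne_zero.2 (hw _ (neg_ne_zero.2 hn)))
  have hz : (fun x => f x - a) =ᵐ[volume] 0 := by
    refine ae_eq_zero_of_mFourierCoeff (hfm.sub (memLp_const a)) fun n => ?_
    have : mFourierCoeff (fun x => f x - a) n =
        mFourierCoeff f n - (∫ x : UnitAddTorus d, mFourier (-n) x) * a := by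
      rw [mFourierCoeff_sub (hfm.integrable one_le_two) (integrable_const a),
        ← integral_mul_const]
      rfl
    rw [this, hone]
    split_ifs with hn
    · rw [hn, one_mul, sub_self]
    · rw [hcoef n hn, zero_mul, sub_zero]
  by_cases ha : a = 0
  · left
    refine measure_mono_null ?_ (ae_iff.1 hz)
    intro x hx
    change ¬ (f x - a = 0)
    simp [hf, hx, ha]
  · right
    refine measure_mono_null ?_ (ae_iff.1 hz)
    intro x hx
    change ¬ (f x - a = 0)
    simp only [hf, Set.indicator_of_notMem hx]
    simpa using ha

/-- The translations act without resonance as soon as `n • ω` is never an integer. -/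
lemma mFourier_coe (n : d → ℤ) (ω : d → ℝ) :
    mFourier n (fun i => (ω i : UnitAddCircle)) =
      Complex.exp (2 * Real.pi * Complex.I * ∑ i, (n i : ℂ) * ω i) := by
  simp only [mFourier, ContinuousMap.coe_mk, fourier_coe_apply]
  rw [← Complex.exp_sum, Finset.mul_sum]
  congr 1
  refine Finset.sum_congr rfl fun i _ => ?_
  push_cast
  ring

lemma mFourier_coe_ne_one {ω : d → ℝ} (hω : ∀ n : d → ℤ, n ≠ 0 → ∀ m : ℤ, ∑ i, (n i : ℝ) * ω i ≠ m)
    (n : d → ℤ) (hn : n ≠ 0) : mFourier n (fun i => (ω i : UnitAddCircle)) ≠ 1 := by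
  rw [mFourier_coe]
  intro h
  obtain ⟨m, hm⟩ := Complex.exp_eq_one_iff.1 h
  refine hω n hn m ?_
  have h2 : (2 * Real.pi * Complex.I : ℂ) ≠ 0 := by simp [Real.pi_ne_zero]
  have h3 : (∑ i, (n i : ℂ) * ω i) = m := by
    apply mul_left_cancel₀ h2
    rw [hm]; ring
  exact_mod_cast h3

lemma integral_torus_ge {F : UnitAddTorus (Fin 2) → ℝ} (hF : Continuous F) {m : ℝ}
    (h : ∀ θ : ℝ, 2 * Real.pi * m ≤ ∫ ζ in 0..2 * Real.pi,
      F ![((ζ / (2 * Real.pi) : ℝ) : UnitAddCircle), ((θ / (2 * Real.pi) : ℝ) : UnitAddCircle)]) :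
    m ≤ ∫ x, F x := by
  have e := (volume_preserving_finTwoArrow UnitAddCircle).symm.integral_comp
    (MeasurableEquiv.measurableEmbedding _) F
  have hc : Continuous fun p : UnitAddCircle × UnitAddCircle => F ![p.1, p.2] := by
    refine hF.comp (continuous_pi fun i => ?_)
    fin_cases i
    exacts [continuous_fst, continuous_snd]
  have hint : Integrable (fun p : UnitAddCircle × UnitAddCircle => F ![p.1, p.2])
      ((volume : Measure UnitAddCircle).prod volume) :=
    hc.integrable_of_hasCompactSupport (HasCompactSupport.of_compactSpace _)
  have hs : ∫ x, F x = ∫ y : UnitAddCircle, ∫ x : UnitAddCircle, F ![x, y] := by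
    rw [← e, ← integral_prod_symm _ hint]
    rfl
  rw [hs]
  have hin : ∀ y : UnitAddCircle, m ≤ ∫ x : UnitAddCircle, F ![x, y] := by
    intro y
    obtain ⟨t, rfl⟩ := QuotientAddGroup.mk_surjective y
    have h1 := h (2 * Real.pi * t)
    have hpi : 0 < 2 * Real.pi := by positivity
    rw [mul_div_cancel_left₀ _ hpi.ne'] at h1
    have h2 := intervalIntegral.integral_comp_div (a := 0) (b := 2 * Real.pi)
      (fun ζ : ℝ => F ![(ζ : UnitAddCircle), (t : UnitAddCircle)]) hpi.ne'
    rw [h2, zero_div, div_self hpi.ne', smul_eq_mul, mul_le_mul_iff_right₀ hpi] at h1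
    refine h1.trans (le_of_eq ?_)
    have h3 := AddCircle.intervalIntegral_preimage (1 : ℝ) 0
      (fun x : UnitAddCircle => F ![x, (t : UnitAddCircle)])
    rw [zero_add] at h3
    refine h3.trans ?_
    rw [AddCircle.volume_eq_smul_haarAddCircle, ENNReal.ofReal_one, one_smul]
    rfl
  calc m = ∫ _ : UnitAddCircle, m := by simp
    _ ≤ _ := integral_mono (integrable_const _) hint.integral_prod_right hin

/-- The Fourier multiplier of the lattice Laplacian. -/
def symbolFn (x : UnitAddTorus (Fin 2)) : ℝ := ∑ i, 2 * (fourier 1 (x i) : ℂ).re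

lemma continuous_symbolFn : Continuous symbolFn := by
  unfold symbolFn
  fun_prop

lemma ofReal_symbolFn (x : UnitAddTorus (Fin 2)) : (symbolFn x : ℂ) =
    ∑ i : Fin 2, (mFourier (Pi.single i 1) x + mFourier (-Pi.single i 1) x) := by
  rw [symbolFn, Complex.ofReal_sum]
  refine Finset.sum_congr rfl fun i _ => ?_
  rw [mFourier_neg, mFourier_single, Complex.add_conj]

lemma abs_symbolFn_le (x : UnitAddTorus (Fin 2)) : |symbolFn x| ≤ 4 := by
  have h : ∀ i, |2 * (fourier 1 (x i) : ℂ).re| ≤ 2 := fun i => by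
    have h1 := Complex.abs_re_le_norm (fourier 1 (x i) : ℂ)
    have h2 : ‖(fourier 1 (x i) : ℂ)‖ = 1 := by
      rw [fourier_apply, Circle.norm_coe]
    rw [abs_mul, abs_two]
    linarith
  rw [symbolFn, Fin.sum_univ_two]
  have := abs_add_le (2 * (fourier 1 (x 0) : ℂ).re) (2 * (fourier 1 (x 1) : ℂ).re)
  linarith [h 0, h 1]

lemma mFourier_add_neg_coe {d : Type*} [Fintype d] (n : d → ℤ) (ω : d → ℝ) :
    mFourier n (fun i => (ω i : UnitAddCircle)) + mFourier n (-fun i => (ω i : UnitAddCircle)) =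
      ((2 * Real.cos (2 * Real.pi * ∑ i, (n i : ℝ) * ω i) : ℝ) : ℂ) := by
  rw [mFourier_neg_apply_eq, mFourier_coe, mFourier_coe, Complex.ofReal_mul, Complex.ofReal_cos]
  push_cast
  rw [Complex.two_cos]
  congr 2
  · ring
  · simp only [Pi.neg_apply, Int.cast_neg, neg_mul, Finset.sum_neg_distrib]
    ring

/-- The dual equation satisfied by the Fourier transform of an eigenvector. -/
lemma exists_dual_solution {lam E : ℝ} {ω : Fin 2 → ℝ} {ψ : l2Z2} (hψ : ψ ≠ 0)
    (h : LatticeEigenEq (fun n => lam * Real.cos (2 * Real.pi * (∑ j, (n j : ℝ) * ω j))) (⇑ψ) E) :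
    ∃ g : UnitAddTorus (Fin 2) → ℝ, Measurable g ∧ ¬ (g =ᵐ[volume] 0) ∧ ∀ᵐ x : UnitAddTorus (Fin 2),
      symbolFn x * g x + lam / 2 * (g (x + fun i => (ω i : UnitAddCircle)) +
        g (x + -fun i => (ω i : UnitAddCircle))) = E * g x := by
  set w : UnitAddTorus (Fin 2) := fun i => (ω i : UnitAddCircle) with hw
  set F := (mFourierBasis (d := Fin 2)).repr.symm ψ with hF
  have hF0 : F ≠ 0 := by simpa [hF] using hψ
  set f : UnitAddTorus (Fin 2) → ℂ := ⇑F with hf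
  have hfm : MemLp f 2 volume := Lp.memLp F
  have hfi : Integrable f := hfm.integrable one_le_two
  have hco : ∀ n, mFourierCoeff f n = ψ n := fun n => by
    rw [hf, ← mFourierBasis_repr, hF, LinearIsometryEquiv.apply_symm_apply]
  have htr : ∀ u : UnitAddTorus (Fin 2), MemLp (fun x => f (x + u)) 2 volume := fun u =>
    hfm.comp_measurePreserving (measurePreserving_add_right volume u)
  have hmul : ∀ m : Fin 2 → ℤ, MemLp (fun x => mFourier m x * f x) 2 volume := fun m => by
    refine hfm.of_le_mul (c := 1)
      ((mFourier m).continuous.aestronglyMeasurable.mul hfm.aestronglyMeasurable) ?_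
    refine Eventually.of_forall fun x => ?_
    rw [norm_mul]
    gcongr
    exact ((mFourier m).norm_coe_le_norm x).trans mFourier_norm.le
  set G : UnitAddTorus (Fin 2) → ℂ := fun x =>
    ((mFourier (Pi.single 0 1) x * f x + mFourier (-Pi.single 0 1) x * f x) +
      (mFourier (Pi.single 1 1) x * f x + mFourier (-Pi.single 1 1) x * f x)) +
      ((lam / 2 : ℝ) : ℂ) * (f (x + w) + f (x + -w)) with hG
  have m0 : ∀ i : Fin 2, MemLp (fun x => mFourier (Pi.single i 1) x * f x +
      mFourier (-Pi.single i 1) x * f x) 2 volume := fun i =>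
    (hmul (Pi.single i 1)).add (hmul (-Pi.single i 1))
  have m12 : MemLp (fun x =>
      (mFourier (Pi.single 0 1) x * f x + mFourier (-Pi.single 0 1) x * f x) +
      (mFourier (Pi.single 1 1) x * f x + mFourier (-Pi.single 1 1) x * f x)) 2 volume :=
    (m0 0).add (m0 1)
  have m3 : MemLp (fun x => f (x + w) + f (x + -w)) 2 volume := (htr w).add (htr (-w))
  have m4 : MemLp (fun x => ((lam / 2 : ℝ) : ℂ) * (f (x + w) + f (x + -w))) 2 volume :=
    m3.const_mul _
  have hGm : MemLp G 2 volume := m12.add m4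
  have hEm : MemLp (fun x => (E : ℂ) * f x) 2 volume := hfm.const_mul _
  have hae : (fun x => G x - (E : ℂ) * f x) =ᵐ[volume] 0 := by
    refine ae_eq_zero_of_mFourierCoeff (hGm.sub hEm) fun n => ?_
    have i1 := one_le_two (α := ENNReal)
    rw [mFourierCoeff_sub (hGm.integrable i1) (hEm.integrable i1), mFourierCoeff_const_mul, hG]
    rw [mFourierCoeff_add (m12.integrable i1) (m4.integrable i1),
      mFourierCoeff_add ((m0 0).integrable i1) ((m0 1).integrable i1),
      mFourierCoeff_add ((hmul _).integrable i1) ((hmul _).integrable i1),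
      mFourierCoeff_add ((hmul _).integrable i1) ((hmul _).integrable i1),
      mFourierCoeff_const_mul, mFourierCoeff_add ((htr w).integrable i1) ((htr (-w)).integrable i1),
      mFourierCoeff_comp_add, mFourierCoeff_comp_add]
    simp only [mFourierCoeff_mFourier_mul, hco, sub_neg_eq_add]
    rw [← add_mul, hw, mFourier_add_neg_coe]
    have h1 := h n
    have hp : ∀ i, Function.update n i (n i + 1) = n + Pi.single i 1 := fun i => by
      ext j; by_cases hj : j = i
      · subst hj; simp
      · simp [hj]
    have hm : ∀ i, Function.update n i (n i - 1) = n - Pi.single i 1 := fun i => by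
      ext j; by_cases hj : j = i
      · subst hj; simp
      · simp [hj]
    simp only [hp, hm, Fin.sum_univ_two] at h1 ⊢
    push_cast at h1 ⊢
    linear_combination h1
  have hf0 : ¬ (f =ᵐ[volume] 0) := fun h0 => hF0 ((Lp.eq_zero_iff_ae_eq_zero).2 h0)
  have hae2 : ∀ᵐ x : UnitAddTorus (Fin 2), (symbolFn x : ℂ) * f x +
      ((lam / 2 : ℝ) : ℂ) * (f (x + w) + f (x + -w)) = (E : ℂ) * f x := by
    filter_upwards [hae] with x hx
    rw [ofReal_symbolFn, Fin.sum_univ_two]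
    simp only [hG, Pi.zero_apply] at hx
    linear_combination hx
  have hmeas : Measurable f := (Lp.stronglyMeasurable F).measurable
  by_cases hre : (fun x => (f x).re) =ᵐ[volume] 0
  · refine ⟨fun x => (f x).im, Complex.measurable_im.comp hmeas, fun him => hf0 ?_, ?_⟩
    · filter_upwards [hre, him] with x h1 h2
      exact Complex.ext h1 h2
    · filter_upwards [hae2] with x hx
      simpa using congrArg Complex.im hx
  · refine ⟨fun x => (f x).re, Complex.measurable_re.comp hmeas, hre, ?_⟩
    filter_upwards [hae2] with x hx
    simpa using congrArg Complex.re hx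

lemma symbolFn_coe (t : Fin 2 → ℝ) : symbolFn (fun i => (t i : UnitAddCircle)) =
    2 * Real.cos (2 * Real.pi * t 0) + 2 * Real.cos (2 * Real.pi * t 1) := by
  have h : ∀ s : ℝ, (fourier 1 (s : UnitAddCircle) : ℂ).re =
      Real.cos (2 * Real.pi * s) := fun s => by
    rw [fourier_coe_apply, show (2 * Real.pi * Complex.I * (1 : ℤ) * s / (1 : ℝ) : ℂ) =
      ((2 * Real.pi * s : ℝ) : ℂ) * Complex.I by push_cast; ring, Complex.exp_ofReal_mul_I_re]
  rw [symbolFn, Fin.sum_univ_two, h, h]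

lemma hill_slowEnergy_eq_symbolFn {α lam E : ℝ} (hα : α ^ 2 = lam / 2) (hlam : lam ≠ 0)
    (ω : Fin 2 → ℝ) (θ ζ : ℝ) (k : ℤ) :
    hill α θ (2 * Real.pi * ω 1) (slowEnergy (lam + 4 - E) 1 0 ζ (2 * Real.pi * ω 0)) k =
      (((E - symbolFn (![((ζ / (2 * Real.pi) : ℝ) : UnitAddCircle),
        ((θ / (2 * Real.pi) : ℝ) : UnitAddCircle)] + k • fun i => (ω i : UnitAddCircle))) /
          (lam / 2) : ℝ) : ℂ) := by
  have hp : (![((ζ / (2 * Real.pi) : ℝ) : UnitAddCircle),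
        ((θ / (2 * Real.pi) : ℝ) : UnitAddCircle)] + k • fun i => (ω i : UnitAddCircle)) =
      fun i => ((![ζ / (2 * Real.pi) + k * ω 0, θ / (2 * Real.pi) + k * ω 1] i : ℝ) :
        UnitAddCircle) := by
    ext i
    have h : ∀ a b : ℝ, (a : UnitAddCircle) + k • (b : UnitAddCircle) =
        ((a + k * b : ℝ) : UnitAddCircle) := fun a b => by
      rw [← zsmul_eq_mul, AddCircle.coe_add, AddCircle.coe_zsmul]
    fin_cases i
    exacts [h _ _, h _ _]
  rw [hp, symbolFn_coe]
  have hpi := Real.pi_ne_zero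
  have e1 : 2 * Real.pi * (ζ / (2 * Real.pi) + k * ω 0) = ζ + 2 * Real.pi * ω 0 * k := by
    field_simp
  have e2 : 2 * Real.pi * (θ / (2 * Real.pi) + k * ω 1) = θ + 2 * Real.pi * ω 1 * k := by
    field_simp
  simp only [Matrix.cons_val_zero, Matrix.cons_val_one]
  rw [e1, e2]
  have hs : slowEnergy (lam + 4 - E) 1 0 ζ (2 * Real.pi * ω 0) k =
      ((lam + 4 - E - 2 * 1 * (1 - Real.cos (ζ + 2 * Real.pi * ω 0 * k)) : ℝ) : ℂ) := by
    refine Complex.ext ?_ ?_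
    · rw [Complex.ofReal_re]; rfl
    · rw [Complex.ofReal_im]; simp [slowEnergy]
  rw [hill, hs, well]
  norm_cast
  rw [hα]
  field_simp
  ring

lemma iterate_add_const {G : Type*} [AddCommGroup G] (w x : G) (k : ℕ) :
    (fun y => y + w)^[k] x = x + (k : ℤ) • w := by
  induction k with
  | zero => simp
  | succ k ih => rw [Function.iterate_succ_apply', ih]; push_cast; rw [add_smul, one_smul]; abel

/-- There are no eigenvalues near the top of the spectrum at slow frequencies. -/
theorem no_eigenvalue_near_top {lam : ℝ} (hlam : 0 < lam) : ∃ h₁ : ℝ, 0 < h₁ ∧ h₁ ≤ 1 ∧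
    ∀ ω : Fin 2 → ℝ, 0 < 2 * Real.pi * ω 1 → 2 * Real.pi * ω 1 < h₁ → 0 ≤ 2 * Real.pi * ω 0 →
      2 * Real.pi * ω 0 ≤ (2 * Real.pi * ω 1) ^ 3 →
      (∀ n : Fin 2 → ℤ, n ≠ 0 → ∀ m : ℤ, ∑ i, (n i : ℝ) * ω i ≠ m) →
      ∀ (E : ℝ) (ψ : l2Z2), ψ ≠ 0 →
      LatticeEigenEq (fun n => lam * Real.cos (2 * Real.pi * (∑ j, (n j : ℝ) * ω j))) (⇑ψ) E →
      0 ≤ lam + 4 - E → 5 / 4 * (Real.sqrt (lam / 2) * (2 * Real.pi * ω 1)) < lam + 4 - E := by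
  obtain ⟨h₁, h0, hle, hmain⟩ := exists_mean_growth (α := Real.sqrt (lam / 2)) (by positivity)
  refine ⟨h₁, h0, hle, fun ω hω1 hω2 hω3 hω4 hres E ψ hψ heq hE => ?_⟩
  by_contra hcon
  rw [not_lt] at hcon
  obtain ⟨γ, n₀, hγ, hgrow⟩ := hmain _ hω1 hω2
  have hα : Real.sqrt (lam / 2) ^ 2 = lam / 2 := Real.sq_sqrt (by positivity)
  obtain ⟨g, hg, hg0, hdual⟩ := exists_dual_solution hψ heq
  set w : UnitAddTorus (Fin 2) := fun i => (ω i : UnitAddCircle) with hw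
  set c : UnitAddTorus (Fin 2) → ℝ := fun x => (E - symbolFn x) / (lam / 2) with hc
  have hcc : Continuous c := (continuous_const.sub continuous_symbolFn).div_const _
  have hcb : ∀ x, |c x| ≤ (|E| + 4) / (lam / 2) := fun x => by
    rw [hc, abs_div, abs_of_pos (by positivity : 0 < lam / 2)]
    gcongr
    exact (abs_sub _ _).trans (by gcongr; exact abs_symbolFn_le x)
  have hT : ∀ u : UnitAddTorus (Fin 2), MeasurePreserving (fun x => x + u) volume volume :=
    fun u => measurePreserving_add_right volume u
  have hrec0 : ∀ᵐ x : UnitAddTorus (Fin 2), g (x + w) + g (x + -w) = c x * g x := by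
    filter_upwards [hdual] with x hx
    simp only [hc]
    field_simp
    linarith
  have hrec : ∀ᵐ x : UnitAddTorus (Fin 2), g (x + w + w) = c (x + w) * g (x + w) - g x := by
    filter_upwards [(hT w).quasiMeasurePreserving.ae hrec0] with x hx
    rw [add_neg_cancel_right] at hx
    linarith
  have hrec' : ∀ᵐ x : UnitAddTorus (Fin 2),
      g (x + -w + -w) = c (x + -w) * g (x + -w) - g x := by
    filter_upwards [(hT (-w)).quasiMeasurePreserving.ae hrec0] with x hx
    rw [neg_add_cancel_right] at hx
    linarith
  have hpos : ∀ᵐ x : UnitAddTorus (Fin 2), 0 < g x ^ 2 + g (x + w) ^ 2 := by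
    have hgw : Measurable fun x => g (x + w) := hg.comp (hT w).measurable
    have hiff : ∀ a b : ℝ, ¬ 0 < a ^ 2 + b ^ 2 ↔ a = 0 ∧ b = 0 := fun a b => by
      constructor
      · intro h
        constructor <;> refine pow_eq_zero_iff (two_ne_zero) |>.1 ?_ <;>
          nlinarith [sq_nonneg a, sq_nonneg b]
      · rintro ⟨rfl, rfl⟩; norm_num
    set S : Set (UnitAddTorus (Fin 2)) := {x | ¬ 0 < g x ^ 2 + g (x + w) ^ 2} with hS
    have hSm : MeasurableSet S :=
      (measurableSet_lt measurable_const ((hg.pow_const 2).add (hgw.pow_const 2))).compl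
    rcases measure_eq_zero_or_of_translation (mFourier_coe_ne_one hres) hSm (by
      filter_upwards [hrec] with x hx
      change (¬ 0 < g (x + w) ^ 2 + g (x + w + w) ^ 2) ↔ ¬ 0 < g x ^ 2 + g (x + w) ^ 2
      rw [hiff, hiff, hx]
      constructor
      · rintro ⟨h1, h2⟩
        rw [h1] at h2 ⊢
        exact ⟨by linarith, rfl⟩
      · rintro ⟨h1, h2⟩
        rw [h1, h2]
        exact ⟨rfl, by ring⟩) with h | h
    · exact ae_iff.2 h
    · exfalso
      refine hg0 (ae_iff.2 (measure_mono_null ?_ h))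
      intro x hx hxS
      exact hx ((hiff _ _).1 hxS).1
  have hpos' : ∀ᵐ x : UnitAddTorus (Fin 2), 0 < g x ^ 2 + g (x + -w) ^ 2 := by
    filter_upwards [(hT (-w)).quasiMeasurePreserving.ae hpos] with x hx
    rw [neg_add_cancel_right] at hx
    linarith
  have up := integral_log_norm_tvec_le (hT w) hg hcb (ε := γ / 4) (by positivity) hrec hpos
  have down := integral_log_norm_tvec_le (hT (-w)) hg hcb (ε := γ / 4) (by positivity) hrec' hpos'
  obtain ⟨n, hn1, hn2, hn3, hn4⟩ := (up.and (((tendsto_add_atTop_nat 1).eventually down).and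
    ((eventually_ge_atTop n₀).and (eventually_ge_atTop 1)))).exists
  set F₁ : UnitAddTorus (Fin 2) → ℝ := fun x =>
    Real.log ‖tvec (fun j => ((c ((fun y => y + w)^[j + 1] x) : ℝ) : ℂ)) n‖ with hF₁
  set F₂ : UnitAddTorus (Fin 2) → ℝ := fun x =>
    Real.log ‖tvec (fun j => ((c ((fun y => y + -w)^[j + 1] x) : ℝ) : ℂ)) (n + 1)‖ with hF₂
  have hcont : ∀ (u : UnitAddTorus (Fin 2)) (m : ℕ), Continuous fun x : UnitAddTorus (Fin 2) =>
      Real.log ‖tvec (fun j => ((c ((fun y => y + u)^[j + 1] x) : ℝ) : ℂ)) m‖ := fun u m =>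
    continuous_log_norm_tvec (c := fun x j => ((c ((fun y => y + u)^[j + 1] x) : ℝ) : ℂ))
      (fun j => Complex.continuous_ofReal.comp
        (hcc.comp ((continuous_id.add continuous_const).iterate _))) m
  have hF₁c : Continuous F₁ := hcont w n
  have hF₂c : Continuous fun x => F₂ (x + w) :=
    (hcont (-w) (n + 1)).comp (continuous_id.add continuous_const)
  have hint : ∀ {F : UnitAddTorus (Fin 2) → ℝ}, Continuous F → Integrable F := fun hF =>
    hF.integrable_of_hasCompactSupport (HasCompactSupport.of_compactSpace _)
  have hge := integral_torus_ge (hF₁c.add hF₂c) (m := γ * n) (fun θ => by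
    refine (hgrow (lam + 4 - E) _ θ n hE hcon hω3 hω4 hn3).trans (le_of_eq ?_)
    have hcoe : Continuous fun ζ : ℝ => ![((ζ / (2 * Real.pi) : ℝ) : UnitAddCircle),
        ((θ / (2 * Real.pi) : ℝ) : UnitAddCircle)] := by
      refine continuous_pi fun i => ?_
      fin_cases i
      · exact (AddCircle.continuous_mk' 1).comp (continuous_id.div_const _)
      · exact continuous_const
    have hsum := intervalIntegral.integral_add (μ := volume)
      ((hF₁c.comp hcoe).intervalIntegrable 0 (2 * Real.pi))
      ((hF₂c.comp hcoe).intervalIntegrable 0 (2 * Real.pi))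
    refine Eq.trans ?_ hsum.symm
    congr 1
    · refine intervalIntegral.integral_congr fun ζ _ => ?_
      simp only [Function.comp_apply, hF₁]
      congr 3
      ext j
      rw [hill_slowEnergy_eq_symbolFn hα hlam.ne', iterate_add_const, hc]
      push_cast
      rfl
    · refine intervalIntegral.integral_congr fun ζ _ => ?_
      simp only [Function.comp_apply, hF₂]
      congr 3
      ext j
      rw [hill_slowEnergy_eq_symbolFn hα hlam.ne', iterate_add_const, hc]
      have : ∀ x : UnitAddTorus (Fin 2), x + w + ((j + 1 : ℕ) : ℤ) • -w = x + (-(j : ℤ)) • w := by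
        intro x
        push_cast
        rw [add_smul, one_smul, smul_neg, neg_smul]
        abel
      rw [this])
  have hsplit : ∫ x, (F₁ x + F₂ (x + w)) = (∫ x, F₁ x) + ∫ x, F₂ x := by
    rw [integral_add (hint hF₁c) (hint hF₂c), integral_add_right_eq_self F₂ w]
  change γ * n ≤ ∫ x, (F₁ x + F₂ (x + w)) at hge
  rw [hsplit] at hge
  push_cast at hn2
  have hn5 : (1 : ℝ) ≤ n := by exact_mod_cast hn4
  nlinarith

lemma finite_re_fourier_one_eq (c : ℝ) :
    {x : UnitAddCircle | (fourier 1 x : ℂ).re = c}.Finite := by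
  have hinj : Function.Injective fun x : UnitAddCircle => (fourier 1 x : ℂ) := fun x y hxy => by
    simp only [fourier_one] at hxy
    exact AddCircle.injective_toCircle one_ne_zero (Subtype.coe_injective hxy)
  refine Set.Finite.subset (Set.Finite.preimage hinj.injOn
    (Set.toFinite {(⟨c, √(1 - c ^ 2)⟩ : ℂ), ⟨c, -√(1 - c ^ 2)⟩})) fun x hx => ?_
  have h1 : ‖(fourier 1 x : ℂ)‖ = 1 := by rw [fourier_apply, Circle.norm_coe]
  have h2 := Complex.sq_norm (fourier 1 x : ℂ)
  rw [h1, Complex.normSq_apply, hx] at h2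
  have h3 : (fourier 1 x : ℂ).im ^ 2 = √(1 - c ^ 2) ^ 2 := by
    rw [Real.sq_sqrt (by nlinarith [mul_self_nonneg (fourier 1 x : ℂ).im])]
    linarith
  rcases sq_eq_sq_iff_eq_or_eq_neg.1 h3 with h | h
  · exact Or.inl (Complex.ext hx h)
  · exact Or.inr (Complex.ext hx h)

lemma nontrivial_unitAddCircle : Nontrivial UnitAddCircle := by
  refine ⟨⟨(AddCircle.equivIco 1 0).symm ⟨0, by simp⟩,
    (AddCircle.equivIco 1 0).symm ⟨1 / 2, by norm_num⟩, fun h => ?_⟩⟩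
  have := congrArg Subtype.val ((AddCircle.equivIco (1 : ℝ) 0).symm.injective h)
  norm_num at this

lemma volume_symbolFn_eq (E : ℝ) : volume {x : UnitAddTorus (Fin 2) | symbolFn x = E} = 0 := by
  have hm : MeasurableSet {p : UnitAddCircle × UnitAddCircle |
      2 * (fourier 1 p.1 : ℂ).re + 2 * (fourier 1 p.2 : ℂ).re = E} :=
    (isClosed_eq (by fun_prop) continuous_const).measurableSet
  have := nontrivial_unitAddCircle
  have : (nhdsWithin (0 : UnitAddCircle) {0}ᶜ).NeBot := inferInstance
  have h := (volume_preserving_finTwoArrow UnitAddCircle).measure_preimage hm.nullMeasurableSet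
  have h0 : (volume : Measure (UnitAddCircle × UnitAddCircle)) {p : UnitAddCircle × UnitAddCircle |
      2 * (fourier 1 p.1 : ℂ).re + 2 * (fourier 1 p.2 : ℂ).re = E} = 0 := by
    refine Measure.measure_prod_null_of_ae_null hm (Eventually.of_forall fun x => ?_)
    refine measure_mono_null (fun y hy => ?_)
      ((finite_re_fourier_one_eq (E / 2 - (fourier 1 x : ℂ).re)).measure_zero volume)
    change 2 * (fourier 1 x : ℂ).re + 2 * (fourier 1 y : ℂ).re = E at hy
    change (fourier 1 y : ℂ).re = _
    linarith
  rw [h0] at h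
  refine Eq.trans (congrArg _ (Set.ext fun x => ?_)) h
  change symbolFn x = E ↔ 2 * (fourier 1 (x 0) : ℂ).re + 2 * (fourier 1 (x 1) : ℂ).re = E
  rw [symbolFn, Fin.sum_univ_two]

/-- The free lattice Laplacian has no eigenvectors. -/
lemma eq_zero_of_latticeEigenEq_zero {E : ℝ} {ω : Fin 2 → ℝ} {ψ : l2Z2}
    (h : LatticeEigenEq (fun n => (0 : ℝ) * Real.cos (2 * Real.pi * (∑ j, (n j : ℝ) * ω j)))
      (⇑ψ) E) : ψ = 0 := by
  by_contra hψ
  obtain ⟨g, -, hg0, hg⟩ := exists_dual_solution hψ h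
  refine hg0 ?_
  have hne : ∀ᵐ x : UnitAddTorus (Fin 2), ¬ symbolFn x = E :=
    measure_eq_zero_iff_ae_notMem.1 (volume_symbolFn_eq E)
  filter_upwards [hg, hne] with x hx hx2
  have h3 : (symbolFn x - E) * g x = 0 := by
    rw [zero_div, zero_mul, add_zero] at hx
    linear_combination hx
  exact (mul_eq_zero.1 h3).resolve_left (sub_ne_zero.2 hx2)

end Torus

lemma closure_span_eigenvectors_zero_ne_top (ω : Fin 2 → ℝ) :
    (Submodule.span ℂ (eigenvectors 0 ω)).topologicalClosure ≠ ⊤ := by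
  have h : Submodule.span ℂ (eigenvectors 0 ω) = ⊥ :=
    Submodule.span_eq_bot.2 fun ψ ⟨_, hψ⟩ => eq_zero_of_latticeEigenEq_zero hψ
  have hne : lp.single 2 (0 : Fin 2 → ℤ) (1 : ℂ) ≠ (0 : l2Z2) := fun h0 => by
    have := lp.norm_single (E := fun _ : Fin 2 → ℤ => ℂ) (p := 2) two_pos 0 (1 : ℂ)
    rw [h0, norm_zero, norm_one] at this
    exact zero_ne_one this
  have : Nontrivial l2Z2 := ⟨⟨_, _, hne⟩⟩
  intro htop
  rw [h, Submodule.closed_of_finiteDimensional _ |>.submodule_topologicalClosure_eq] at htop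
  exact bot_ne_top htop

section Rayleigh
variable {F : Type*} [NormedAddCommGroup F] [InnerProductSpace ℂ F]

/-- If the eigenvectors of a bounded symmetric operator span a dense subspace, the quadratic form
is bounded by the supremum of the eigenvalues. -/
lemma re_inner_le_of_dense_eigenvectors (T : F →L[ℂ] F)
    (hT : ∀ x y, inner ℂ (T x) y = inner ℂ x (T y))
    (hd : (Submodule.span ℂ {x : F | ∃ E : ℝ, T x = (E : ℂ) • x}).topologicalClosure = ⊤) {c : ℝ}
    (hc : ∀ (E : ℝ) (x : F), x ≠ 0 → T x = (E : ℂ) • x → E ≤ c) (x : F) :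
    (inner ℂ x (T x)).re ≤ c * ‖x‖ ^ 2 := by
  set p : ℝ → Submodule ℂ F := fun E => LinearMap.ker ((T : F →ₗ[ℂ] F) - (E : ℂ) • LinearMap.id)
  have hp : ∀ E x, x ∈ p E ↔ T x = (E : ℂ) • x := fun E x => by
    simp [p, LinearMap.mem_ker, sub_eq_zero]
  have horth : ∀ E E' : ℝ, E ≠ E' → ∀ x ∈ p E, ∀ y ∈ p E', inner ℂ x y = 0 := by
    intro E E' hne x hx y hy
    have h := hT x y
    rw [(hp _ _).1 hx, (hp _ _).1 hy, inner_smul_left, inner_smul_right, Complex.conj_ofReal] at h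
    have h2 : ((E : ℂ) - E') * inner ℂ x y = 0 := by linear_combination h
    refine (mul_eq_zero.1 h2).resolve_left (sub_ne_zero.2 ?_)
    exact_mod_cast hne
  have hspan : ∀ x ∈ Submodule.span ℂ {x : F | ∃ E : ℝ, T x = (E : ℂ) • x},
      (inner ℂ x (T x)).re ≤ c * ‖x‖ ^ 2 := by
    intro x hx
    have hx2 : x ∈ ⨆ E, p E := by
      refine Submodule.span_le.2 ?_ hx
      rintro y ⟨E, hy⟩
      exact Submodule.mem_iSup_of_mem E ((hp _ _).2 hy)
    obtain ⟨f, hf, rfl⟩ := (Submodule.mem_iSup_iff_exists_finsupp p x).1 hx2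
    rw [Finsupp.sum]
    set s := f.support
    have h1 : inner ℂ (∑ i ∈ s, f i) (T (∑ i ∈ s, f i)) = ((∑ i ∈ s, i * ‖f i‖ ^ 2 : ℝ) : ℂ) := by
      rw [map_sum, sum_inner, Complex.ofReal_sum]
      refine Finset.sum_congr rfl fun i hi => ?_
      rw [inner_sum, Finset.sum_eq_single i]
      · rw [(hp _ _).1 (hf i), inner_smul_right, inner_self_eq_norm_sq_to_K]
        push_cast; rfl
      · intro j _ hj
        rw [(hp _ _).1 (hf j), inner_smul_right, horth i j hj.symm _ (hf i) _ (hf j), mul_zero]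
      · exact fun h => absurd hi h
    have h2 : ‖∑ i ∈ s, f i‖ ^ 2 = ∑ i ∈ s, ‖f i‖ ^ 2 := by
      have : inner ℂ (∑ i ∈ s, f i) (∑ i ∈ s, f i) = ((∑ i ∈ s, ‖f i‖ ^ 2 : ℝ) : ℂ) := by
        rw [sum_inner, Complex.ofReal_sum]
        refine Finset.sum_congr rfl fun i hi => ?_
        rw [inner_sum, Finset.sum_eq_single i]
        · rw [inner_self_eq_norm_sq_to_K]
          push_cast; rfl
        · intro j _ hj
          rw [horth i j hj.symm _ (hf i) _ (hf j)]
        · exact fun h => absurd hi h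
      rw [inner_self_eq_norm_sq_to_K] at this
      exact Complex.ofReal_injective ((Complex.ofReal_pow _ _).trans this)
    rw [h1, h2, Complex.ofReal_re, Finset.mul_sum]
    refine Finset.sum_le_sum fun i hi => ?_
    have := hc i (f i) (Finsupp.mem_support_iff.1 hi) ((hp _ _).1 (hf i))
    gcongr
  have hcl : IsClosed {x : F | (inner ℂ x (T x)).re ≤ c * ‖x‖ ^ 2} := by
    refine isClosed_le ?_ ?_
    · exact Complex.continuous_re.comp (continuous_id.inner T.continuous)
    · fun_prop
  have hx : x ∈ (Submodule.span ℂ {x : F | ∃ E : ℝ, T x = (E : ℂ) • x}).topologicalClosure := by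
    rw [hd]; trivial
  exact closure_minimal hspan hcl hx

end Rayleigh

section Lattice
variable {ι : Type*}

lemma two_toReal_pos : 0 < (2 : ENNReal).toReal := by norm_num

/-- Composition with a permutation of the index set, as an operator on `ℓ²`. -/
def permCLM (σ : ι ≃ ι) : lp (fun _ : ι => ℂ) 2 →L[ℂ] lp (fun _ : ι => ℂ) 2 :=
  LinearMap.mkContinuous
    { toFun := fun ψ => ⟨fun i => ψ (σ i), by
        have h := (lp.memℓp ψ).summable two_toReal_pos
        exact memℓp_gen ((Equiv.summable_iff σ).2 h)⟩
      map_add' := fun _ _ => rfl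
      map_smul' := fun _ _ => rfl } 1 (fun ψ => by
        rw [one_mul, lp.norm_eq_tsum_rpow two_toReal_pos, lp.norm_eq_tsum_rpow two_toReal_pos]
        refine le_of_eq ?_
        congr 1
        exact Equiv.tsum_eq σ fun i => ‖ψ i‖ ^ (2 : ENNReal).toReal)

lemma permCLM_apply (σ : ι ≃ ι) (ψ : lp (fun _ : ι => ℂ) 2) (i : ι) :
    permCLM σ ψ i = ψ (σ i) := rfl

lemma norm_permCLM_apply_le (σ : ι ≃ ι) (ψ : lp (fun _ : ι => ℂ) 2) : ‖permCLM σ ψ‖ ≤ ‖ψ‖ := by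
  have h := ContinuousLinearMap.le_of_opNorm_le (permCLM σ)
    (LinearMap.mkContinuous_norm_le _ zero_le_one _) ψ
  rwa [one_mul] at h

lemma inner_permCLM (σ : ι ≃ ι) (φ ψ : lp (fun _ : ι => ℂ) 2) :
    inner ℂ (permCLM σ φ) ψ = inner ℂ φ (permCLM σ.symm ψ) := by
  rw [lp.inner_eq_tsum, lp.inner_eq_tsum,
    ← Equiv.tsum_eq σ fun i => inner ℂ (φ i) (permCLM σ.symm ψ i)]
  simp only [permCLM_apply, Equiv.symm_apply_apply]

/-- Multiplication by a bounded real function, as an operator on `ℓ²`. -/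
def potentialCLM (V : ι → ℝ) (C : ℝ) (hV : ∀ i, |V i| ≤ |C|) :
    lp (fun _ : ι => ℂ) 2 →L[ℂ] lp (fun _ : ι => ℂ) 2 :=
  LinearMap.mkContinuous
    { toFun := fun ψ => ⟨fun i => (V i : ℂ) * ψ i,
        ((lp.memℓp ψ).norm.const_mul |C|).mono fun i => by
          rw [norm_mul, Complex.norm_real, Real.norm_eq_abs]
          exact mul_le_mul_of_nonneg_right (hV i) (norm_nonneg (ψ i))⟩
      map_add' := fun φ ψ => by ext i; exact mul_add _ _ _
      map_smul' := fun c ψ => by ext i; exact mul_left_comm _ _ _ } |C| (fun ψ => by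
        have h : ‖(C : ℂ) • ψ‖ = |C| * ‖ψ‖ := by rw [norm_smul, Complex.norm_real, Real.norm_eq_abs]
        rw [← h]
        refine lp.norm_mono two_ne_zero fun i => ?_
        change ‖(V i : ℂ) * ψ i‖ ≤ ‖(C : ℂ) * ψ i‖
        rw [norm_mul, norm_mul, Complex.norm_real, Complex.norm_real, Real.norm_eq_abs,
          Real.norm_eq_abs]
        exact mul_le_mul_of_nonneg_right (hV i) (norm_nonneg (ψ i)))

lemma potentialCLM_apply (V : ι → ℝ) (C : ℝ) (hV : ∀ i, |V i| ≤ |C|)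
    (ψ : lp (fun _ : ι => ℂ) 2) (i : ι) : potentialCLM V C hV ψ i = (V i : ℂ) * ψ i := rfl

lemma norm_potentialCLM_apply_le (V : ι → ℝ) (C : ℝ) (hV : ∀ i, |V i| ≤ |C|)
    (ψ : lp (fun _ : ι => ℂ) 2) : ‖potentialCLM V C hV ψ‖ ≤ |C| * ‖ψ‖ :=
  ContinuousLinearMap.le_of_opNorm_le (potentialCLM V C hV)
    (LinearMap.mkContinuous_norm_le _ (abs_nonneg C) _) ψ

lemma inner_potentialCLM (V : ι → ℝ) (C : ℝ) (hV : ∀ i, |V i| ≤ |C|)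
    (φ ψ : lp (fun _ : ι => ℂ) 2) :
    inner ℂ (potentialCLM V C hV φ) ψ = inner ℂ φ (potentialCLM V C hV ψ) := by
  rw [lp.inner_eq_tsum, lp.inner_eq_tsum]
  congr 1 with i
  rw [potentialCLM_apply, potentialCLM_apply, RCLike.inner_apply, RCLike.inner_apply, map_mul]
  simp only [Complex.conj_ofReal]
  ring

lemma abs_potential_le (lam : ℝ) (ω : Fin 2 → ℝ) (n : Fin 2 → ℤ) :
    |lam * Real.cos (2 * Real.pi * (∑ j, (n j : ℝ) * ω j))| ≤ |lam| := by
  rw [abs_mul]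
  exact mul_le_of_le_one_right (abs_nonneg _) (Real.abs_cos_le_one _)

/-- The operator `Δ + λ V` on `ℓ²(ℤ²)`. -/
def latticeCLM (lam : ℝ) (ω : Fin 2 → ℝ) : l2Z2 →L[ℂ] l2Z2 :=
  (∑ i : Fin 2, (permCLM (Equiv.addRight (Pi.single i 1 : Fin 2 → ℤ)) +
    permCLM (Equiv.addRight (Pi.single i 1 : Fin 2 → ℤ)).symm)) +
  potentialCLM (fun n : Fin 2 → ℤ => lam * Real.cos (2 * Real.pi * (∑ j, (n j : ℝ) * ω j))) lam
    (abs_potential_le lam ω)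

lemma latticeCLM_apply (lam : ℝ) (ω : Fin 2 → ℝ) (ψ : l2Z2) (n : Fin 2 → ℤ) :
    latticeCLM lam ω ψ n = (∑ i : Fin 2, (ψ (n + Pi.single i 1) + ψ (n - Pi.single i 1))) +
      ((lam * Real.cos (2 * Real.pi * (∑ j, (n j : ℝ) * ω j)) : ℝ) : ℂ) * ψ n := by
  rw [Fin.sum_univ_two, latticeCLM, Fin.sum_univ_two]
  rfl

lemma inner_latticeCLM (lam : ℝ) (ω : Fin 2 → ℝ) (φ ψ : l2Z2) :
    inner ℂ (latticeCLM lam ω φ) ψ = inner ℂ φ (latticeCLM lam ω ψ) := by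
  rw [latticeCLM, Fin.sum_univ_two]
  simp only [add_apply, inner_add_left, inner_add_right, inner_permCLM,
    inner_potentialCLM, Equiv.symm_symm]
  ring

lemma norm_latticeCLM_apply_le (lam : ℝ) (ω : Fin 2 → ℝ) (ψ : l2Z2) :
    ‖latticeCLM lam ω ψ‖ ≤ (4 + |lam|) * ‖ψ‖ := by
  rw [latticeCLM, Fin.sum_univ_two]
  simp only [add_apply]
  refine (norm_add_le _ _).trans ?_
  rw [add_mul]
  gcongr
  · refine (norm_add_le _ _).trans ?_
    have h := fun i : Fin 2 => (norm_add_le (permCLM (Equiv.addRight (Pi.single i 1 : Fin 2 → ℤ)) ψ)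
      (permCLM (Equiv.addRight (Pi.single i 1 : Fin 2 → ℤ)).symm ψ)).trans
      (add_le_add (norm_permCLM_apply_le _ ψ) (norm_permCLM_apply_le _ ψ))
    linarith [h 0, h 1]
  · exact norm_potentialCLM_apply_le _ _ _ _

lemma latticeCLM_eq_smul_iff (lam : ℝ) (ω : Fin 2 → ℝ) (ψ : l2Z2) (E : ℝ) :
    latticeCLM lam ω ψ = (E : ℂ) • ψ ↔
    LatticeEigenEq (fun n => lam * Real.cos (2 * Real.pi * (∑ j, (n j : ℝ) * ω j))) (⇑ψ) E := by
  have hp : ∀ (n : Fin 2 → ℤ) i, Function.update n i (n i + 1) = n + Pi.single i 1 := fun n i => by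
    ext j; by_cases hj : j = i
    · subst hj; simp
    · simp [hj]
  have hm : ∀ (n : Fin 2 → ℤ) i, Function.update n i (n i - 1) = n - Pi.single i 1 := fun n i => by
    ext j; by_cases hj : j = i
    · subst hj; simp
    · simp [hj]
  constructor
  · intro h n
    simp only [hp, hm]
    rw [← latticeCLM_apply, h]
    rfl
  · intro h
    ext n
    have := h n
    simp only [hp, hm] at this
    rw [latticeCLM_apply, this]
    rfl

/-- A dense span of eigenvectors bounds the quadratic form by the eigenvalues. -/
lemma re_inner_latticeCLM_le {lam : ℝ} {ω : Fin 2 → ℝ}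
    (hd : (Submodule.span ℂ (eigenvectors lam ω)).topologicalClosure = ⊤) {c : ℝ}
    (hc : ∀ (E : ℝ) (ψ : l2Z2), ψ ≠ 0 →
      LatticeEigenEq (fun n => lam * Real.cos (2 * Real.pi * (∑ j, (n j : ℝ) * ω j))) (⇑ψ) E →
      E ≤ 4 + |lam| → E ≤ c) (φ : l2Z2) :
    (inner ℂ φ (latticeCLM lam ω φ)).re ≤ c * ‖φ‖ ^ 2 := by
  refine re_inner_le_of_dense_eigenvectors _ (inner_latticeCLM lam ω) ?_ (fun E ψ hψ h => ?_) φ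
  · have : {ψ : l2Z2 | ∃ E : ℝ, latticeCLM lam ω ψ = (E : ℂ) • ψ} = eigenvectors lam ω :=
      Set.ext fun ψ => exists_congr fun E => latticeCLM_eq_smul_iff lam ω ψ E
    rwa [this]
  · refine hc E ψ hψ ((latticeCLM_eq_smul_iff lam ω ψ E).1 h) ?_
    have h1 := norm_latticeCLM_apply_le lam ω ψ
    rw [h, norm_smul, Complex.norm_real, Real.norm_eq_abs] at h1
    exact (le_abs_self E).trans (le_of_mul_le_mul_right h1 (norm_pos_iff.2 hψ))

end Lattice

section Tent

/-- The tent function of half-width `N`. -/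
def tent (N : ℕ) (k : ℤ) : ℝ := max ((N : ℝ) - |(k : ℝ)|) 0

lemma tent_even (N : ℕ) (k : ℤ) : tent N (-k) = tent N k := by
  simp [tent]

lemma tent_natCast {N k : ℕ} (h : k ≤ N) : tent N k = N - k := by
  have : (k : ℝ) ≤ N := by exact_mod_cast h
  rw [tent, Int.cast_natCast, Nat.abs_cast, max_eq_left (by linarith)]

lemma tent_eq_zero {N : ℕ} {k : ℤ} (hk : k ∉ Finset.Icc (-N : ℤ) N) : tent N k = 0 := by
  rw [Finset.mem_Icc, ← abs_le, not_le] at hk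
  have : (N : ℝ) < |(k : ℝ)| := by exact_mod_cast hk
  exact max_eq_right (by linarith)

lemma tent_mul_neg_laplacian {N : ℕ} (hN : 1 ≤ N) (k : ℤ) :
    tent N k * (2 * tent N k - tent N (k + 1) - tent N (k - 1)) =
      if k = 0 then 2 * (N : ℝ) else 0 := by
  wlog hk : 0 ≤ k generalizing k
  · have h := this (-k) (by omega)
    have h1 : -k + 1 = -(k - 1) := by ring
    have h2 : -k - 1 = -(k + 1) := by ring
    rw [h1, h2, tent_even, tent_even, tent_even] at h
    simp only [neg_eq_zero] at h
    rw [← h]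
    ring
  lift k to ℕ using hk
  rcases Nat.eq_zero_or_pos k with rfl | hk
  · have h0 := tent_natCast (Nat.zero_le N)
    have h1 := tent_natCast hN
    have h2 := tent_even N 1
    push_cast at h0 h1 ⊢
    rw [h2, h1, h0]
    ring
  · rw [if_neg (by omega)]
    rcases lt_or_ge k N with h | h
    · have h0 := tent_natCast h.le
      have h1 := tent_natCast (Nat.succ_le_of_lt h)
      have h2 := tent_natCast (Nat.sub_le_of_le_add (h.le.trans (Nat.le_add_right N 1)))
      have h3 : ((k - 1 : ℕ) : ℤ) = (k : ℤ) - 1 := by omega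
      have h4 : ((k - 1 : ℕ) : ℝ) = (k : ℝ) - 1 := by rw [Nat.cast_sub hk, Nat.cast_one]
      rw [h3, h4] at h2
      rw [h0, h2, show (k : ℤ) + 1 = ((k + 1 : ℕ) : ℤ) by push_cast; rfl, h1]
      push_cast
      ring
    · have h0 : tent N k = 0 := by
        have : (N : ℝ) ≤ k := by exact_mod_cast h
        rw [tent, Int.cast_natCast, Nat.abs_cast]
        exact max_eq_right (by linarith)
      rw [h0, zero_mul]

lemma sum_tent_mul_neg_laplacian {N : ℕ} (hN : 1 ≤ N) :
    ∑ k ∈ Finset.Icc (-N : ℤ) N, tent N k * (2 * tent N k - tent N (k + 1) - tent N (k - 1)) =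
      2 * N := by
  rw [Finset.sum_congr rfl fun k _ => tent_mul_neg_laplacian hN k, Finset.sum_ite_eq',
    if_pos (by simp)]

lemma sum_range_sub_sq (N : ℝ) (n : ℕ) : ∑ k ∈ Finset.range (n + 1), (N - k) ^ 2 =
    (n + 1) * N ^ 2 - n * (n + 1) * N + n * (n + 1) * (2 * n + 1) / 6 := by
  induction n with
  | zero => simp
  | succ n ih => rw [Finset.sum_range_succ, ih]; push_cast; ring

lemma sum_range_sq_mul_sub_sq (N : ℝ) (n : ℕ) :
    ∑ k ∈ Finset.range (n + 1), (k : ℝ) ^ 2 * (N - k) ^ 2 =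
    N ^ 2 * (n * (n + 1) * (2 * n + 1) / 6) - 2 * N * (n ^ 2 * (n + 1) ^ 2 / 4) +
      n * (n + 1) * (2 * n + 1) * (3 * n ^ 2 + 3 * n - 1) / 30 := by
  induction n with
  | zero => simp
  | succ n ih => rw [Finset.sum_range_succ, ih]; push_cast; ring

lemma sum_tent_sq (N : ℕ) :
    ∑ k ∈ Finset.Icc (-N : ℤ) N, tent N k ^ 2 = (2 * (N : ℝ) ^ 3 + N) / 3 := by
  rw [Finset.sum_Icc_of_even_eq_range (fun k => by rw [tent_even]),
    Finset.sum_congr rfl fun k hk => by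
      rw [tent_natCast (Nat.lt_succ_iff.1 (Finset.mem_range.1 hk))],
    sum_range_sub_sq]
  have := tent_natCast (Nat.zero_le N)
  push_cast at this
  rw [this, two_nsmul]
  ring

lemma sum_sq_mul_tent_sq (N : ℕ) :
    ∑ k ∈ Finset.Icc (-N : ℤ) N, (k : ℝ) ^ 2 * tent N k ^ 2 = ((N : ℝ) ^ 5 - N) / 15 := by
  rw [Finset.sum_Icc_of_even_eq_range (fun k => by rw [tent_even]; push_cast; ring),
    Finset.sum_congr rfl fun k hk => by
      rw [tent_natCast (Nat.lt_succ_iff.1 (Finset.mem_range.1 hk)), Int.cast_natCast],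
    sum_range_sq_mul_sub_sq]
  rw [two_nsmul]
  push_cast
  ring

lemma sum_mul_tent_sq (N : ℕ) :
    ∑ k ∈ Finset.Icc (-N : ℤ) N, (k : ℝ) * tent N k ^ 2 = 0 := by
  have h : ∑ k ∈ Finset.Icc (-N : ℤ) N, (k : ℝ) * tent N k ^ 2 =
      ∑ k ∈ Finset.Icc (-N : ℤ) N, -((k : ℝ) * tent N k ^ 2) :=
    Finset.sum_nbij' (fun k => -k) (fun k => -k)
      (fun k hk => by rw [Finset.mem_Icc] at hk ⊢; omega)
      (fun k hk => by rw [Finset.mem_Icc] at hk ⊢; omega)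
      (fun k _ => neg_neg k) (fun k _ => neg_neg k)
      (fun k _ => by rw [tent_even]; push_cast; ring)
  rw [Finset.sum_neg_distrib] at h
  linarith

lemma sum_piFinset_two_mul (t : Fin 2 → Finset ℤ) (f g : ℤ → ℝ) :
    ∑ n ∈ Fintype.piFinset t, f (n 0) * g (n 1) = (∑ k ∈ t 0, f k) * ∑ k ∈ t 1, g k := by
  have h := Finset.prod_univ_sum t ![f, g]
  simp only [Fin.prod_univ_two] at h
  exact h.symm

end Tent

section Trial

/-- The product of two tent functions. -/
def trialFn (N : Fin 2 → ℕ) (n : Fin 2 → ℤ) : ℝ := tent (N 0) (n 0) * tent (N 1) (n 1)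

/-- The box that supports `trialFn`. -/
def trialBox (N : Fin 2 → ℕ) : Finset (Fin 2 → ℤ) :=
  Fintype.piFinset fun i => Finset.Icc (-N i : ℤ) (N i)

lemma trialFn_eq_zero {N : Fin 2 → ℕ} {n : Fin 2 → ℤ} (hn : n ∉ trialBox N) :
    trialFn N n = 0 := by
  rw [trialBox, Fintype.mem_piFinset, Fin.forall_fin_two, not_and_or] at hn
  rcases hn with h | h <;> simp [trialFn, tent_eq_zero h]

/-- The product of two tent functions, as an element of `ℓ²(ℤ²)`. -/
def trial (N : Fin 2 → ℕ) : l2Z2 :=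
  ⟨fun n => (trialFn N n : ℂ), memℓp_gen (summable_of_ne_finset_zero (s := trialBox N)
    fun n hn => by simp [trialFn_eq_zero hn])⟩

lemma trial_apply (N : Fin 2 → ℕ) (n : Fin 2 → ℤ) : trial N n = (trialFn N n : ℂ) := rfl

lemma re_inner_trial (N : Fin 2 → ℕ) (ψ : l2Z2) (f : (Fin 2 → ℤ) → ℝ)
    (hf : ∀ n, ψ n = (f n : ℂ)) :
    (inner ℂ (trial N) ψ).re = ∑ n ∈ trialBox N, trialFn N n * f n := by
  rw [lp.inner_eq_tsum, tsum_eq_sum (s := trialBox N) (fun n hn => by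
    rw [trial_apply, trialFn_eq_zero hn, Complex.ofReal_zero, inner_zero_left]), Complex.re_sum]
  refine Finset.sum_congr rfl fun n _ => ?_
  rw [trial_apply, hf, RCLike.inner_apply, Complex.conj_ofReal, ← Complex.ofReal_mul,
    Complex.ofReal_re, mul_comm]

lemma norm_trial_sq (N : Fin 2 → ℕ) :
    ‖trial N‖ ^ 2 = (2 * (N 0 : ℝ) ^ 3 + N 0) / 3 * ((2 * (N 1 : ℝ) ^ 3 + N 1) / 3) := by
  have h := re_inner_trial N (trial N) (trialFn N) (trial_apply N)
  rw [inner_self_eq_norm_sq_to_K] at h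
  have h1 : ‖trial N‖ ^ 2 = ∑ n ∈ trialBox N, trialFn N n * trialFn N n := by
    rw [← h]; norm_cast
  rw [h1, ← sum_tent_sq, ← sum_tent_sq]
  refine Eq.trans (Finset.sum_congr rfl fun n _ => ?_) (sum_piFinset_two_mul _ _ _)
  rw [trialFn]
  ring

lemma one_sub_cos_le_sq (x : ℝ) : 1 - Real.cos x ≤ x ^ 2 / 2 := by
  linarith [Real.one_sub_sq_div_two_le_cos (x := x)]

lemma re_inner_trial_latticeCLM_ge {lam : ℝ} (hlam : 0 ≤ lam) (ω : Fin 2 → ℝ) (N : Fin 2 → ℕ)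
    (hN : ∀ i, 1 ≤ N i) :
    (lam + 4) * ‖trial N‖ ^ 2 - (inner ℂ (trial N) (latticeCLM lam ω (trial N))).re ≤
      2 * N 0 * ((2 * (N 1 : ℝ) ^ 3 + N 1) / 3) + (2 * (N 0 : ℝ) ^ 3 + N 0) / 3 * (2 * N 1) +
      lam / 2 * ((2 * Real.pi * ω 0) ^ 2 * (((N 0 : ℝ) ^ 5 - N 0) / 15 *
          ((2 * (N 1 : ℝ) ^ 3 + N 1) / 3)) +
        (2 * Real.pi * ω 1) ^ 2 * ((2 * (N 0 : ℝ) ^ 3 + N 0) / 3 *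
          (((N 1 : ℝ) ^ 5 - N 1) / 15))) := by
  have h1 := re_inner_trial N (trial N) (trialFn N) (trial_apply N)
  have h2 : ‖trial N‖ ^ 2 = ∑ n ∈ trialBox N, trialFn N n * trialFn N n := by
    rw [← h1, inner_self_eq_norm_sq_to_K]; norm_cast
  rw [re_inner_trial N (latticeCLM lam ω (trial N)) (fun n =>
      (∑ i : Fin 2, (trialFn N (n + Pi.single i 1) + trialFn N (n - Pi.single i 1))) +
        lam * Real.cos (2 * Real.pi * (∑ j, (n j : ℝ) * ω j)) * trialFn N n) (fun n => by
      rw [latticeCLM_apply]; simp only [trial_apply]; push_cast; rfl), h2, Finset.mul_sum,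
    ← Finset.sum_sub_distrib]
  have hS : ∀ f g : ℤ → ℝ, ∑ n ∈ trialBox N, f (n 0) * g (n 1) =
      (∑ k ∈ Finset.Icc (-N 0 : ℤ) (N 0), f k) * ∑ k ∈ Finset.Icc (-N 1 : ℤ) (N 1), g k :=
    fun f g => sum_piFinset_two_mul _ _ _
  set p := tent (N 0)
  set q := tent (N 1)
  calc _ ≤ ∑ n ∈ trialBox N, (
          (p (n 0) * (2 * p (n 0) - p (n 0 + 1) - p (n 0 - 1))) * q (n 1) ^ 2 +
          p (n 0) ^ 2 * (q (n 1) * (2 * q (n 1) - q (n 1 + 1) - q (n 1 - 1))) +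
          lam / 2 * ((2 * Real.pi * ω 0) ^ 2 * (((n 0 : ℝ) ^ 2 * p (n 0) ^ 2) * q (n 1) ^ 2) +
            (2 * Real.pi * ω 1) ^ 2 * (p (n 0) ^ 2 * ((n 1 : ℝ) ^ 2 * q (n 1) ^ 2)) +
            2 * (2 * Real.pi * ω 0) * (2 * Real.pi * ω 1) *
              (((n 0 : ℝ) * p (n 0) ^ 2) * ((n 1 : ℝ) * q (n 1) ^ 2)))) := by
        refine Finset.sum_le_sum fun n _ => ?_
        have hc := mul_le_mul_of_nonneg_left
          (one_sub_cos_le_sq (2 * Real.pi * (∑ j, (n j : ℝ) * ω j)))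
          (mul_nonneg hlam (sq_nonneg (trialFn N n)))
        simp only [Fin.sum_univ_two, trialFn, Pi.add_apply, Pi.sub_apply, Pi.single_apply] at hc ⊢
        simp only [Fin.isValue, if_true, one_ne_zero, zero_ne_one, if_false, add_zero, sub_zero]
        refine (sub_nonneg.1 (le_of_le_of_eq (sub_nonneg.2 hc) ?_))
        ring
    _ = _ := by
        simp only [Finset.sum_add_distrib, ← Finset.mul_sum]
        rw [hS (fun k => p k * (2 * p k - p (k + 1) - p (k - 1))) (fun k => q k ^ 2),
          hS (fun k => p k ^ 2) (fun k => q k * (2 * q k - q (k + 1) - q (k - 1))),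
          hS (fun k => (k : ℝ) ^ 2 * p k ^ 2) (fun k => q k ^ 2),
          hS (fun k => p k ^ 2) (fun k => (k : ℝ) ^ 2 * q k ^ 2),
          hS (fun k => (k : ℝ) * p k ^ 2) (fun k => (k : ℝ) * q k ^ 2),
          sum_tent_mul_neg_laplacian (hN 0), sum_tent_mul_neg_laplacian (hN 1), sum_tent_sq,
          sum_tent_sq, sum_sq_mul_tent_sq, sum_sq_mul_tent_sq, sum_mul_tent_sq]
        ring

end Trial

lemma ceil_inv_bounds {h : ℝ} (h0 : 0 < h) (h1 : h ≤ 1) :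
    1 ≤ ⌈1 / h⌉₊ ∧ 3 / (⌈1 / h⌉₊ : ℝ) ^ 2 ≤ 3 * h ^ 2 ∧ h ^ 2 * (⌈1 / h⌉₊ : ℝ) ^ 2 ≤ 4 := by
  have hpos : 0 < 1 / h := by positivity
  have hN := Nat.le_ceil (1 / h)
  have hN2 := (Nat.ceil_lt_add_one hpos.le).le
  have hN1 : 1 ≤ ⌈1 / h⌉₊ := Nat.one_le_ceil_iff.2 hpos
  set N : ℝ := (⌈1 / h⌉₊ : ℝ)
  have hle : 1 ≤ h * N := by
    have := mul_le_mul_of_nonneg_left hN h0.le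
    rwa [mul_one_div_cancel h0.ne'] at this
  have hge : h * N ≤ 2 := by
    have := mul_le_mul_of_nonneg_left hN2 h0.le
    rw [mul_add, mul_one_div_cancel h0.ne'] at this
    linarith
  have hNpos : 0 < N := hpos.trans_le hN
  refine ⟨hN1, ?_, ?_⟩
  · rw [div_le_iff₀ (by positivity)]
    nlinarith
  · nlinarith

lemma ceil_two_div_sqrt_bounds {g : ℝ} (h0 : 0 < g) (h1 : g ≤ 1 / 2) :
    1 ≤ ⌈2 / √g⌉₊ ∧ 3 / (⌈2 / √g⌉₊ : ℝ) ^ 2 + g ^ 2 * ((⌈2 / √g⌉₊ : ℝ) ^ 2 / 10) ≤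
      47 / 40 * g := by
  have hs : 0 < √g := Real.sqrt_pos.2 h0
  have hss : √g ^ 2 = g := Real.sq_sqrt h0.le
  have hpos : 0 < 2 / √g := by positivity
  have hN := Nat.le_ceil (2 / √g)
  have hN2 := (Nat.ceil_lt_add_one hpos.le).le
  have hN1 : 1 ≤ ⌈2 / √g⌉₊ := Nat.one_le_ceil_iff.2 hpos
  set N : ℝ := (⌈2 / √g⌉₊ : ℝ)
  have hNpos : 0 < N := hpos.trans_le hN
  have hle : 2 ≤ √g * N := by
    have := mul_le_mul_of_nonneg_left hN hs.le
    rwa [mul_div_cancel₀ _ hs.ne'] at this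
  have hge : √g * N ≤ 2 + √g := by
    have := mul_le_mul_of_nonneg_left hN2 hs.le
    rw [mul_add, mul_div_cancel₀ _ hs.ne'] at this
    linarith
  have hs2 : √g ≤ 71 / 100 := Real.sqrt_le_iff.2 ⟨by norm_num, by linarith⟩
  refine ⟨hN1, ?_⟩
  have hx4 : 4 ≤ g * N ^ 2 := by
    rw [← hss]; nlinarith
  have hx8 : g * N ^ 2 ≤ 8 := by
    rw [← hss]; nlinarith
  rw [← le_sub_iff_add_le, div_le_iff₀ (by positivity)]
  nlinarith [mul_nonneg (sub_nonneg.2 hx4) (sub_nonneg.2 hx8)]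

/-- For a nonresonant frequency in a thin cusp, the eigenvectors do not span a dense subspace: no
eigenvalue is close enough to the top of the spectrum. -/
lemma closure_span_eigenvectors_ne_top {lam : ℝ} (hlam : 0 < lam) : ∃ t, 0 < t ∧ t ≤ 1 ∧
    ∀ ω : Fin 2 → ℝ, 0 < 2 * Real.pi * ω 1 → 2 * Real.pi * ω 1 < t → 0 ≤ 2 * Real.pi * ω 0 →
      2 * Real.pi * ω 0 ≤ (2 * Real.pi * ω 1) ^ 3 →
      (∀ n : Fin 2 → ℤ, n ≠ 0 → ∀ m : ℤ, ∑ i, (n i : ℝ) * ω i ≠ m) →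
      (Submodule.span ℂ (eigenvectors lam ω)).topologicalClosure ≠ ⊤ := by
  obtain ⟨h₁, hh₁, hh₂, hno⟩ := no_eigenvalue_near_top hlam
  set α := √(lam / 2)
  have hα : 0 < α := Real.sqrt_pos.2 (by positivity)
  have hα2 : lam / 2 = α ^ 2 := (Real.sq_sqrt (by positivity)).symm
  refine ⟨min h₁ (7 / 100 * α / (3 + α ^ 2)), lt_min hh₁ (by positivity),
    (min_le_left _ _).trans hh₂, fun ω hω1 hω2 hω3 hω4 hres hd => ?_⟩
  have hb := re_inner_latticeCLM_le hd (c := lam + 4 - 5 / 4 * (α * (2 * Real.pi * ω 1)))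
    (fun E ψ hψ hE hEle => by
      rw [abs_of_pos hlam] at hEle
      have := hno ω hω1 (hω2.trans_le (min_le_left _ _)) hω3 hω4 hres E ψ hψ hE (by linarith)
      linarith)
  have hsmall := hω2.trans_le (min_le_right _ _)
  have hle1 : 2 * Real.pi * ω 1 ≤ 1 := (hω2.trans_le ((min_le_left _ _).trans hh₂)).le
  have htr := fun N hN => re_inner_trial_latticeCLM_ge hlam.le ω N hN
  rw [hα2] at htr
  set h := 2 * Real.pi * ω 1
  set η := 2 * Real.pi * ω 0
  rw [lt_div_iff₀ (by positivity)] at hsmall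
  have hg : α * h ≤ 1 / 2 := by nlinarith [mul_pos hα hω1]
  obtain ⟨hA1, hA2, hA3⟩ := ceil_inv_bounds hω1 hle1
  obtain ⟨hB1, hB2⟩ := ceil_two_div_sqrt_bounds (mul_pos hα hω1) hg
  have htr := htr ![⌈1 / h⌉₊, ⌈2 / √(α * h)⌉₊] (by
    intro i
    fin_cases i
    · exact hA1
    · exact hB1)
  specialize hb (trial ![⌈1 / h⌉₊, ⌈2 / √(α * h)⌉₊])
  rw [norm_trial_sq] at hb htr
  simp only [Matrix.cons_val_zero, Matrix.cons_val_one] at hb htr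
  have hA4 : (1 : ℝ) ≤ ⌈1 / h⌉₊ := by exact_mod_cast hA1
  have hB4 : (1 : ℝ) ≤ ⌈2 / √(α * h)⌉₊ := by exact_mod_cast hB1
  set A : ℝ := (⌈1 / h⌉₊ : ℝ)
  set B : ℝ := (⌈2 / √(α * h)⌉₊ : ℝ)
  have hD : ∀ N : ℝ, 1 ≤ N → 2 * N ≤ 3 / N ^ 2 * ((2 * N ^ 3 + N) / 3) := fun N hN => by
    have : 3 / N ^ 2 * ((2 * N ^ 3 + N) / 3) = 2 * N + 1 / N := by field_simp
    rw [this]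
    have : 0 < 1 / N := by positivity
    linarith
  have hM : ∀ N : ℝ, 1 ≤ N → (N ^ 5 - N) / 15 ≤ N ^ 2 / 10 * ((2 * N ^ 3 + N) / 3) :=
    fun N hN => by
      have : 0 ≤ N ^ 3 := by positivity
      nlinarith
  have hQ : ∀ N : ℝ, 1 ≤ N → 0 < (2 * N ^ 3 + N) / 3 := fun N hN => by positivity
  have hDA := hD A hA4
  have hDB := hD B hB4
  have hMA := hM A hA4
  have hMB := hM B hB4
  have hQA := hQ A hA4
  have hQB := hQ B hB4
  clear_value h η
  set QA := (2 * A ^ 3 + A) / 3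
  set QB := (2 * B ^ 3 + B) / 3
  have hη : η ^ 2 * (A ^ 2 / 10) ≤ h ^ 2 * (2 / 5) := by
    have h6 : η ^ 2 ≤ (h ^ 3) ^ 2 := pow_le_pow_left₀ hω3 hω4 2
    have h4 : (h ^ 3) ^ 2 ≤ h ^ 2 * h ^ 2 := by
      have : h ^ 6 ≤ h ^ 4 := pow_le_pow_of_le_one hω1.le hle1 (by norm_num)
      rwa [← pow_mul, ← pow_add]
    calc η ^ 2 * (A ^ 2 / 10) ≤ h ^ 2 * h ^ 2 * (A ^ 2 / 10) := by
          exact mul_le_mul_of_nonneg_right (h6.trans h4) (by positivity)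
      _ = h ^ 2 * (h ^ 2 * A ^ 2 / 10) := by ring
      _ ≤ h ^ 2 * (2 / 5) := by
          exact mul_le_mul_of_nonneg_left (by linarith) (sq_nonneg h)
  have hκ : 3 / A ^ 2 + 3 / B ^ 2 + α ^ 2 * (η ^ 2 * (A ^ 2 / 10) + h ^ 2 * (B ^ 2 / 10)) <
      5 / 4 * (α * h) := by
    have e1 : α ^ 2 * (η ^ 2 * (A ^ 2 / 10)) ≤ α ^ 2 * (h ^ 2 * (2 / 5)) := by gcongr
    have e2 : h * (h * (3 + α ^ 2)) < h * (7 / 100 * α) := by gcongr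
    have e3 := mul_nonneg (sq_nonneg α) (sq_nonneg h)
    have e4 := mul_pos hα hω1
    linarith [mul_pow α h 2]
  have k1 : 2 * A * QB ≤ 3 / A ^ 2 * QA * QB := by gcongr
  have k2 : QA * (2 * B) ≤ QA * (3 / B ^ 2 * QB) := by gcongr
  have k3 : η ^ 2 * ((A ^ 5 - A) / 15 * QB) ≤ η ^ 2 * (A ^ 2 / 10 * QA * QB) := by gcongr
  have k4 : h ^ 2 * (QA * ((B ^ 5 - B) / 15)) ≤ h ^ 2 * (QA * (B ^ 2 / 10 * QB)) := by gcongr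
  have k5 := mul_le_mul_of_nonneg_left (add_le_add k3 k4) (sq_nonneg α)
  have k6 := mul_lt_mul_of_pos_right hκ (mul_pos hQA hQB)
  linarith

section Gauge

/-- The parity sign `(-1) ^ (n₀ + n₁)`. -/
def paritySign (n : Fin 2 → ℤ) : ℝ := ((Int.negOnePow (n 0 + n 1) : ℤ) : ℝ)

lemma paritySign_mul_self (n : Fin 2 → ℤ) : paritySign n * paritySign n = 1 := by
  rw [paritySign, ← Int.cast_mul]
  rcases Int.units_eq_one_or (Int.negOnePow (n 0 + n 1)) with h | h <;> simp [h]

lemma abs_paritySign_le (n : Fin 2 → ℤ) : |paritySign n| ≤ |(1 : ℝ)| :=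
  sq_le_sq.1 (by rw [sq, paritySign_mul_self, one_pow])

lemma paritySign_add_single (n : Fin 2 → ℤ) (i : Fin 2) :
    paritySign (n + Pi.single i 1) = -paritySign n := by
  have h : (n + Pi.single i 1 : Fin 2 → ℤ) 0 + (n + Pi.single i 1 : Fin 2 → ℤ) 1 = n 0 + n 1 + 1 := by
    fin_cases i <;> simp <;> ring
  rw [paritySign, h, Int.negOnePow_succ, paritySign]
  push_cast
  rfl

lemma paritySign_sub_single (n : Fin 2 → ℤ) (i : Fin 2) :
    paritySign (n - Pi.single i 1) = -paritySign n := by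
  have h := paritySign_add_single (n - Pi.single i 1) i
  rw [sub_add_cancel] at h
  rw [h, neg_neg]

/-- The unitary that conjugates `Δ + λ V` to `-(Δ - λ V)`. -/
def parityCLM : l2Z2 →L[ℂ] l2Z2 := potentialCLM paritySign 1 abs_paritySign_le

lemma parityCLM_parityCLM (ψ : l2Z2) : parityCLM (parityCLM ψ) = ψ := by
  ext n
  rw [parityCLM, potentialCLM_apply, potentialCLM_apply, ← mul_assoc, ← Complex.ofReal_mul,
    paritySign_mul_self, Complex.ofReal_one, one_mul]

lemma latticeCLM_parityCLM (lam : ℝ) (ω : Fin 2 → ℝ) (ψ : l2Z2) :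
    latticeCLM (-lam) ω (parityCLM ψ) = -parityCLM (latticeCLM lam ω ψ) := by
  ext n
  rw [latticeCLM_apply, lp.coeFn_neg, Pi.neg_apply, parityCLM, potentialCLM_apply, potentialCLM_apply,
    latticeCLM_apply]
  simp only [potentialCLM_apply, paritySign_add_single, paritySign_sub_single, Fin.sum_univ_two]
  push_cast
  ring

lemma closure_span_eigenvectors_neg {lam : ℝ} {ω : Fin 2 → ℝ}
    (h : (Submodule.span ℂ (eigenvectors lam ω)).topologicalClosure = ⊤) :
    (Submodule.span ℂ (eigenvectors (-lam) ω)).topologicalClosure = ⊤ := by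
  have h1 := Submodule.topologicalClosure_map parityCLM (Submodule.span ℂ (eigenvectors lam ω))
  rw [h] at h1
  rw [eq_top_iff]
  refine le_trans (fun ψ _ => Submodule.mem_map.2
    ⟨parityCLM ψ, Submodule.mem_top, parityCLM_parityCLM ψ⟩) (h1.trans
    (Submodule.topologicalClosure_mono ?_))
  rw [Submodule.map_span]
  refine Submodule.span_mono ?_
  rintro _ ⟨ψ, ⟨E, hψ⟩, rfl⟩
  refine ⟨-E, (latticeCLM_eq_smul_iff (-lam) ω (parityCLM ψ) (-E)).1 ?_⟩
  rw [latticeCLM_parityCLM, (latticeCLM_eq_smul_iff lam ω ψ E).2 hψ, map_smul, Complex.ofReal_neg,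
    neg_smul]

end Gauge

section Frequencies

lemma volume_hyperplane_eq_zero {n : Fin 2 → ℤ} (hn : n ≠ 0) (m : ℤ) :
    volume {ω : Fin 2 → ℝ | ∑ i, (n i : ℝ) * ω i = m} = 0 := by
  rcases Set.eq_empty_or_nonempty {ω : Fin 2 → ℝ | ∑ i, (n i : ℝ) * ω i = m} with h | ⟨ω₀, h₀⟩
  · rw [h, measure_empty]
  set f : (Fin 2 → ℝ) →ₗ[ℝ] ℝ := Fintype.linearCombination ℝ fun i => (n i : ℝ)
  have hf : ∀ ω, f ω = ∑ i, (n i : ℝ) * ω i := fun ω => by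
    rw [Fintype.linearCombination_apply]
    exact Finset.sum_congr rfl fun i _ => mul_comm _ _
  refine measure_mono_null (t := (AffineSubspace.mk' ω₀ (LinearMap.ker f) : Set (Fin 2 → ℝ)))
    (fun ω hω => ?_) (Measure.addHaar_affineSubspace _ _ fun h => hn ?_)
  · change ω ∈ AffineSubspace.mk' ω₀ (LinearMap.ker f)
    rw [AffineSubspace.mem_mk', LinearMap.mem_ker, vsub_eq_sub, map_sub, hf, hf, hω, h₀, sub_self]
  · have hker : LinearMap.ker f = ⊤ := by
      rw [← AffineSubspace.direction_mk' ω₀ (LinearMap.ker f), h, AffineSubspace.direction_top]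
    ext i
    have h1 : f (Pi.single i 1) = 0 := LinearMap.mem_ker.1 (hker ▸ Submodule.mem_top)
    rw [hf] at h1
    simpa [Pi.single_apply] using h1

/-- The nonresonant frequencies in a thin cusp have positive measure. -/
lemma volume_cusp_pos {t : ℝ} (ht : 0 < t) (ht1 : t ≤ 1) {S : Set (Fin 2 → ℝ)}
    (hS : ∀ ω : Fin 2 → ℝ, 0 < 2 * Real.pi * ω 1 → 2 * Real.pi * ω 1 < t →
      0 ≤ 2 * Real.pi * ω 0 → 2 * Real.pi * ω 0 ≤ (2 * Real.pi * ω 1) ^ 3 →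
      (∀ n : Fin 2 → ℤ, n ≠ 0 → ∀ m : ℤ, ∑ i, (n i : ℝ) * ω i ≠ m) → ω ∈ S) :
    0 < volume {ω : Fin 2 → ℝ | ω ∈ Set.Icc (0 : Fin 2 → ℝ) 1 ∧ ω ∈ S} := by
  set O : Set (Fin 2 → ℝ) := {ω | (0 < 2 * Real.pi * ω 1 ∧ 2 * Real.pi * ω 1 < t) ∧
    0 < 2 * Real.pi * ω 0 ∧ 2 * Real.pi * ω 0 < (2 * Real.pi * ω 1) ^ 3}
  have hO : IsOpen O := by
    simp only [O, Set.ofPred_and]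
    exact ((isOpen_lt (by fun_prop) (by fun_prop)).inter
      (isOpen_lt (by fun_prop) (by fun_prop))).inter
      ((isOpen_lt (by fun_prop) (by fun_prop)).inter (isOpen_lt (by fun_prop) (by fun_prop)))
  have hpi := Real.pi_pos
  have hne : O.Nonempty := by
    refine ⟨![(t / 2) ^ 3 / 2 / (2 * Real.pi), t / 2 / (2 * Real.pi)], ?_⟩
    simp only [O, Set.mem_ofPred_eq, Matrix.cons_val_zero, Matrix.cons_val_one]
    rw [mul_div_cancel₀ _ (by positivity), mul_div_cancel₀ _ (by positivity)]
    have : 0 < (t / 2) ^ 3 := by positivity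
    refine ⟨⟨?_, ?_⟩, ?_, ?_⟩ <;> linarith
  have hnull : volume (⋃ n ∈ {n : Fin 2 → ℤ | n ≠ 0}, ⋃ m : ℤ,
      {ω : Fin 2 → ℝ | ∑ i, (n i : ℝ) * ω i = m}) = 0 :=
    (measure_biUnion_null_iff (Set.to_countable _)).2 fun n hn =>
      measure_iUnion_null fun m => volume_hyperplane_eq_zero hn m
  have hpos := hO.measure_pos volume hne
  rw [← measure_sdiff_null hnull] at hpos
  refine hpos.trans_le (measure_mono fun ω ⟨⟨⟨h1, h2⟩, h3, h4⟩, hres⟩ => ⟨?_, ?_⟩)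
  · have h5 : (2 * Real.pi * ω 1) ^ 3 ≤ 1 := pow_le_one₀ h1.le (h2.le.trans ht1)
    have h6 : ∀ i, 0 < 2 * Real.pi * ω i → 2 * Real.pi * ω i ≤ 1 → 0 ≤ ω i ∧ ω i ≤ 1 :=
      fun i hi hi2 => by
        have h7 : 0 < ω i := pos_of_mul_pos_right hi (by positivity)
        refine ⟨h7.le, ?_⟩
        nlinarith [Real.pi_gt_three]
    refine ⟨fun i => ?_, fun i => ?_⟩ <;> fin_cases i
    · exact (h6 0 h3 (h4.le.trans h5)).1
    · exact (h6 1 h1 (h2.le.trans ht1)).1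
    · exact (h6 0 h3 (h4.le.trans h5)).2
    · exact (h6 1 h1 (h2.le.trans ht1)).2
  · refine hS ω h1 h2 h3.le h4.le fun n hn m h => hres ?_
    simp only [Set.mem_iUnion]
    exact ⟨n, hn, m, h⟩

end Frequencies

/-- **Bourgain**: for `d = 2` and `V_n = λ cos(2π n·ω)` on `ℓ²(ℤ²)`, for every `λ` the set of
frequencies `ω ∈ 𝕋²` for which `H_ω` has some continuous spectrum (the eigenvectors do not
span `ℓ²(ℤ²)`) has positive Lebesgue measure. -/
theorem some_continuous_spectrum_positive_measure (lam : ℝ) :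
    0 < volume {ω : Fin 2 → ℝ | ω ∈ Set.Icc (0 : Fin 2 → ℝ) 1 ∧
      (Submodule.span ℂ (eigenvectors lam ω)).topologicalClosure ≠ ⊤} := by
  rcases lt_trichotomy lam 0 with h | rfl | h
  · obtain ⟨t, ht, ht1, hS⟩ := closure_span_eigenvectors_ne_top (neg_pos.2 h)
    exact volume_cusp_pos ht ht1 fun ω h1 h2 h3 h4 h5 htop =>
      hS ω h1 h2 h3 h4 h5 (closure_span_eigenvectors_neg htop)
  · exact volume_cusp_pos one_pos le_rfl fun ω _ _ _ _ _ => closure_span_eigenvectors_zero_ne_top ω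
  · obtain ⟨t, ht, ht1, hS⟩ := closure_span_eigenvectors_ne_top h
    exact volume_cusp_pos ht ht1 hS
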